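/- arXiv:1105.4908 — 4 statements merged into one kernel-verified Lean document; each statement's English description precedes it below -/
import Mathlib

section
/- Any finitely generated subgroup of PL_o(I) is either solvable or has infinite girth. -/
/-- The group of self-homeomorphisms of a topological space,
with `(f * g) x = f (g x)`. -/
instance homeoGroup (X : Type*) [TopologicalSpace X] : Group (X ≃ₜ X) where
  mul f g := g.trans f
  one := Homeomorph.refl X
  inv := Homeomorph.symm
  mul_assoc f g h := rfl
  one_mul f := Homeomorph.ext fun _ => rfl
  mul_one f := Homeomorph.ext fun _ => rfl
  inv_mul_cancel f := Homeomorph.ext fun x => f.symm_apply_apply x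

/-- A finitely generated group has infinite girth: for every `n` there is a finite
generating set with no nontrivial relation of length at most `n`. -/
def HasInfiniteGirth (G : Type*) [Group G] : Prop :=
  ∀ n : ℕ, ∃ (k : ℕ) (s : Fin k → G), Subgroup.closure (Set.range s) = ⊤ ∧
    ∀ w : FreeGroup (Fin k), w ≠ 1 → w.norm ≤ n → FreeGroup.lift s w ≠ 1

/-- `f` is an element of `PL_o(I)`: an orientation-preserving (monotone)
homeomorphism of `[0,1]` that is piecewise linear with finitely many breakpoints. -/
def IsPLo (f : unitInterval ≃ₜ unitInterval) : Prop :=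
  Monotone (⇑f : unitInterval → unitInterval) ∧
  ∃ (n : ℕ) (x : ℕ → ℝ), x 0 = 0 ∧ x n = 1 ∧ (∀ i < n, x i < x (i + 1)) ∧
    ∀ i < n, ∃ a b : ℝ, ∀ t : unitInterval,
      (t : ℝ) ∈ Set.Icc (x i) (x (i + 1)) → ((f t : ℝ)) = a * (t : ℝ) + b

namespace PLoGirth

local notation "𝕀" => unitInterval

section Rewriting

variable {ι V κ X : Type*}

/-- Total displacement of a word whose `i`-th letter moves by `e i`. -/
def wordPos [AddCommGroup V] (e : ι → V) : List (ι × Bool) → V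
  | [] => 0
  | (i, true) :: l => wordPos e l + e i
  | (i, false) :: l => wordPos e l - e i

/-- The word read off along the path of a word: the letter `i` read at position `p`
contributes `a i p`. -/
def rewriteWord [AddCommGroup V] (e : ι → V) (a : ι → V → FreeGroup κ) :
    List (ι × Bool) → FreeGroup κ
  | [] => 1
  | (i, true) :: l => a i (wordPos e l) * rewriteWord e a l
  | (i, false) :: l => (a i (wordPos e l - e i))⁻¹ * rewriteWord e a l

theorem mk_cons_true (i : ι) (l : List (ι × Bool)) :
    FreeGroup.mk ((i, true) :: l) = FreeGroup.of i * FreeGroup.mk l := by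
  simp [FreeGroup.of]

theorem mk_cons_false (i : ι) (l : List (ι × Bool)) :
    FreeGroup.mk ((i, false) :: l) = (FreeGroup.of i)⁻¹ * FreeGroup.mk l := by
  simp [FreeGroup.of, FreeGroup.invRev]

theorem homeo_mul_apply [TopologicalSpace X] (f g : X ≃ₜ X) (x : X) : (f * g) x = f (g x) := rfl

theorem homeo_inv_apply_self [TopologicalSpace X] (f : X ≃ₜ X) (x : X) : f⁻¹ (f x) = x :=
  f.symm_apply_apply x

theorem homeo_apply_inv_self [TopologicalSpace X] (f : X ≃ₜ X) (x : X) : f (f⁻¹ x) = x :=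
  f.apply_symm_apply x

theorem lift_mem_iff [TopologicalSpace X] {f : κ → X ≃ₜ X} {J : Set X}
    (hJ : ∀ k x, f k x ∈ J ↔ x ∈ J) (w : FreeGroup κ) (x : X) :
    FreeGroup.lift f w x ∈ J ↔ x ∈ J := by
  induction w using FreeGroup.induction_on generalizing x with
  | C1 => simp
  | of i => simpa using hJ i x
  | inv_of i _ =>
    rw [map_inv, FreeGroup.lift_apply_of, ← hJ i, homeo_apply_inv_self]
  | mul a b ha hb => rw [map_mul, homeo_mul_apply, ha, hb]

theorem lift_rewriteWord [TopologicalSpace X] [AddCommGroup V] {e : ι → V}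
    {a : ι → V → FreeGroup κ} {P : Set V} {J : Set X} {y : ι → X ≃ₜ X} {c : V → X ≃ₜ X}
    {f : κ → X ≃ₜ X} (hJ : ∀ k x, f k x ∈ J ↔ x ∈ J)
    (hy : ∀ i, ∀ p ∈ P, p + e i ∈ P → ∀ x ∈ J,
      y i (c p x) = c (p + e i) (FreeGroup.lift f (a i p) x))
    {n : ℕ} (hP : ∀ l : List (ι × Bool), l.length ≤ n → wordPos e l ∈ P)
    (l : List (ι × Bool)) (hl : l.length ≤ n) {x : X} (hx : x ∈ J) :
    FreeGroup.lift y (FreeGroup.mk l) (c 0 x) =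
      c (wordPos e l) (FreeGroup.lift f (rewriteWord e a l) x) := by
  induction l with
  | nil => simp [← FreeGroup.one_eq_mk, wordPos, rewriteWord]
  | cons il l ih =>
    have hl' : l.length ≤ n := by simp at hl; omega
    specialize ih hl'
    have h1 := hP l hl'
    have h2 := hP _ hl
    obtain ⟨i, b⟩ := il
    cases b
    · rw [mk_cons_false, map_mul, map_inv, FreeGroup.lift_apply_of, homeo_mul_apply, ih]
      have hx' : (FreeGroup.lift f (a i (wordPos e l - e i)))⁻¹
          (FreeGroup.lift f (rewriteWord e a l) x) ∈ J := by
        rw [← map_inv, lift_mem_iff hJ, lift_mem_iff hJ]; exact hx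
      have := hy i (wordPos e l - e i) h2 (by simpa using h1) _ hx'
      rw [homeo_apply_inv_self, sub_add_cancel] at this
      rw [← this, homeo_inv_apply_self]
      simp [wordPos, rewriteWord]
    · rw [mk_cons_true, map_mul, FreeGroup.lift_apply_of, homeo_mul_apply, ih,
        hy i _ h1 h2 _ ((lift_mem_iff hJ _ _).2 hx)]
      simp [wordPos, rewriteWord]

theorem mk_eq_rewriteWord [AddCommGroup V] {e : ι → V}
    {a : ι → V → FreeGroup κ} {P : Set V} {S : V → FreeGroup ι} (hS : S 0 = 1)
    {ρ : FreeGroup κ →* FreeGroup ι}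
    (hρ : ∀ i, ∀ p ∈ P, ρ (a i p) = (S (p + e i))⁻¹ * FreeGroup.of i * S p)
    {n : ℕ} (hP : ∀ l : List (ι × Bool), l.length ≤ n → wordPos e l ∈ P)
    (l : List (ι × Bool)) (hl : l.length ≤ n) :
    FreeGroup.mk l = S (wordPos e l) * ρ (rewriteWord e a l) := by
  induction l with
  | nil => simp [← FreeGroup.one_eq_mk, wordPos, rewriteWord, hS]
  | cons il l ih =>
    have hl' : l.length ≤ n := by simp at hl; omega
    specialize ih hl'
    have h1 := hP l hl'
    have h2 := hP _ hl
    obtain ⟨i, b⟩ := il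
    cases b
    · rw [mk_cons_false, ih]
      simp only [wordPos, rewriteWord, map_mul, map_inv] at h2 ⊢
      rw [hρ i _ h2]
      simp [mul_assoc]
    · rw [mk_cons_true, ih]
      simp only [wordPos, rewriteWord, map_mul] at h2 ⊢
      rw [hρ i _ h1]
      simp [mul_assoc]

theorem rewriteWord_ne_one [AddCommGroup V] {e : ι → V} {i₀ : ι} (π : V →+ ℤ) (hπ : π (e i₀) = 1)
    {a : ι → V → FreeGroup κ} {P : Set V} (ha₀ : ∀ p, a i₀ p = 1)
    {lab : ι → V → κ} (ha : ∀ i, i ≠ i₀ → ∀ p ∈ P, a i p = FreeGroup.of (lab i p))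
    (hlab : ∀ i, i ≠ i₀ → ∀ p ∈ P, ∀ j, j ≠ i₀ → ∀ q ∈ P, lab i p = lab j q → i = j ∧ p = q)
    {n : ℕ} (hP : ∀ l : List (ι × Bool), l.length ≤ n → wordPos e l ∈ P)
    (l : List (ι × Bool)) (hl : l.length ≤ n) (hne : FreeGroup.mk l ≠ 1)
    (hpos : wordPos e l = 0) : rewriteWord e a l ≠ 1 := by
  classical
  set S : V → FreeGroup ι := fun p => FreeGroup.of i₀ ^ (π p) with hSdef
  have hS : S 0 = 1 := by simp [S]
  set ρ : FreeGroup κ →* FreeGroup ι := FreeGroup.lift fun k =>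
    if h : ∃ ip : ι × V, ip.1 ≠ i₀ ∧ ip.2 ∈ P ∧ lab ip.1 ip.2 = k then
      (S (h.choose.2 + e h.choose.1))⁻¹ * FreeGroup.of h.choose.1 * S h.choose.2 else 1
    with hρdef
  have hρ : ∀ i, ∀ p ∈ P, ρ (a i p) = (S (p + e i))⁻¹ * FreeGroup.of i * S p := by
    intro i p hp
    by_cases hi : i = i₀
    · subst hi
      simp only [ha₀, map_one, hSdef, map_add, hπ]
      group
    · rw [ha i hi p hp, hρdef, FreeGroup.lift_apply_of]
      have h : ∃ ip : ι × V, ip.1 ≠ i₀ ∧ ip.2 ∈ P ∧ lab ip.1 ip.2 = lab i p :=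
        ⟨(i, p), hi, hp, rfl⟩
      rw [dif_pos h]
      obtain ⟨h1, h2, h3⟩ := h.choose_spec
      obtain ⟨h4, h5⟩ := hlab _ h1 _ h2 _ hi _ hp h3
      rw [h4, h5]
  intro h
  have := mk_eq_rewriteWord hS hρ hP l hl
  rw [h, hpos, hS] at this
  simp [this] at hne

theorem norm_rewriteWord_le [DecidableEq κ] [AddCommGroup V] {e : ι → V}
    {a : ι → V → FreeGroup κ} (good : ι → Bool)
    (ha : ∀ i p, (a i p).norm ≤ if good i then 1 else 0) (l : List (ι × Bool)) :
    (rewriteWord e a l).norm ≤ l.countP fun x => good x.1 := by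
  induction l with
  | nil => simp [rewriteWord]
  | cons il l ih =>
    obtain ⟨i, b⟩ := il
    rw [List.countP_cons]
    cases b
    · have h1 := ha i (wordPos e l - e i)
      have h2 := FreeGroup.norm_mul_le (a i (wordPos e l - e i))⁻¹ (rewriteWord e a l)
      rw [FreeGroup.norm_inv_eq] at h2
      simp only [rewriteWord]
      omega
    · have h1 := ha i (wordPos e l)
      have h2 := FreeGroup.norm_mul_le (a i (wordPos e l)) (rewriteWord e a l)
      simp only [rewriteWord]
      omega

/-- If the homeomorphisms `y i` permute the windows `c p '' J` as prescribed by `e`, acting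
inside them through a family `f` without short relations, then `y` satisfies no short relation. -/
theorem exists_lift_apply_ne [TopologicalSpace X] [DecidableEq ι] [DecidableEq κ] [AddCommGroup V]
    {e : ι → V} {i₀ : ι} (π : V →+ ℤ) (hπ : π (e i₀) = 1)
    {a : ι → V → FreeGroup κ} {P : Set V} (ha₀ : ∀ p, a i₀ p = 1)
    (ha_norm : ∀ i p, (a i p).norm ≤ 1)
    {lab : ι → V → κ} (ha : ∀ i, i ≠ i₀ → ∀ p ∈ P, a i p = FreeGroup.of (lab i p))
    (hlab : ∀ i, i ≠ i₀ → ∀ p ∈ P, ∀ j, j ≠ i₀ → ∀ q ∈ P, lab i p = lab j q → i = j ∧ p = q)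
    {J : Set X} {y : ι → X ≃ₜ X} {c : V → X ≃ₜ X} {f : κ → X ≃ₜ X}
    (hJne : J.Nonempty) (hJ : ∀ k x, f k x ∈ J ↔ x ∈ J)
    (hy : ∀ i, ∀ p ∈ P, p + e i ∈ P → ∀ x ∈ J,
      y i (c p x) = c (p + e i) (FreeGroup.lift f (a i p) x))
    (hdisj : ∀ p ∈ P, p ≠ 0 → ∀ u ∈ J, ∀ v ∈ J, c p u ≠ c 0 v)
    {n : ℕ} (hP : ∀ l : List (ι × Bool), l.length ≤ n → wordPos e l ∈ P)
    {w : FreeGroup ι} (hw : w ≠ 1) (hwn : w.norm ≤ n)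
    (hf : ∀ v : FreeGroup κ, v ≠ 1 → v.norm ≤ (w.toWord.countP fun x => decide (x.1 ≠ i₀)) →
      ∃ u ∈ J, FreeGroup.lift f v u ≠ u) :
    ∃ u ∈ J, FreeGroup.lift y w (c 0 u) ≠ c 0 u := by
  have key := fun x hx => lift_rewriteWord hJ hy hP w.toWord hwn (x := x) hx
  rw [FreeGroup.mk_toWord] at key
  by_cases hpos : wordPos e w.toWord = 0
  · obtain ⟨u, hu, hne⟩ := hf (rewriteWord e a w.toWord)
      (rewriteWord_ne_one π hπ ha₀ ha hlab hP _ hwn (by rwa [FreeGroup.mk_toWord]) hpos)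
      (norm_rewriteWord_le (fun i => decide (i ≠ i₀)) (fun i p => by
        by_cases hi : i = i₀
        · simp [hi, ha₀]
        · simpa [hi] using ha_norm i p) _)
    refine ⟨u, hu, ?_⟩
    rw [key u hu, hpos]
    exact fun h => hne ((c 0).injective h)
  · obtain ⟨u, hu⟩ := hJne
    refine ⟨u, hu, ?_⟩
    rw [key u hu]
    exact hdisj _ (hP _ hwn) hpos _ ((lift_mem_iff hJ _ _).2 hu) _ hu

end Rewriting

section Windows

variable {X Q : Type*} [TopologicalSpace X]

/-- A product of conjugates supported on pairwise disjoint windows acts on each window through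
the corresponding factor. -/
theorem window_prod_apply {J : Set X} {c F : Q → X ≃ₜ X} (hF : ∀ q, ∀ x ∈ J, F q x ∈ J)
    (hfix : ∀ q q', q ≠ q' → ∀ x ∈ J, F q ((c q)⁻¹ (c q' x)) = (c q)⁻¹ (c q' x))
    (L : List Q) (hL : L.Nodup) (q : Q) (x : X) (hx : x ∈ J) :
    (q ∉ L → (L.map fun q => c q * F q * (c q)⁻¹).prod (c q x) = c q x) ∧
    (q ∈ L → (L.map fun q => c q * F q * (c q)⁻¹).prod (c q x) = c q (F q x)) := by
  induction L generalizing x with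
  | nil => simp
  | cons r L ih =>
    rw [List.nodup_cons] at hL
    have step : ∀ x ∈ J, q ≠ r → (c r * F r * (c r)⁻¹) (c q x) = c q x := by
      intro x hx hqr
      simp only [homeo_mul_apply]
      rw [hfix r q (Ne.symm hqr) x hx, homeo_apply_inv_self]
    refine ⟨fun hq => ?_, fun hq => ?_⟩
    · rw [List.mem_cons, not_or] at hq
      rw [List.map_cons, List.prod_cons, homeo_mul_apply, (ih hL.2 x hx).1 hq.2, step x hx hq.1]
    · rw [List.map_cons, List.prod_cons, homeo_mul_apply]
      by_cases hqr : q = r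
      · subst hqr
        rw [(ih hL.2 x hx).1 hL.1]
        simp only [homeo_mul_apply]
        rw [homeo_inv_apply_self]
      · rw [(ih hL.2 x hx).2 ((List.mem_cons.1 hq).resolve_left hqr), step _ (hF q x hx) hqr]

end Windows

section Germs

open Filter Topology Set

theorem strictMono_of_isPLo {g : 𝕀 ≃ₜ 𝕀} (hg : IsPLo g) : StrictMono g :=
  hg.1.strictMono_of_injective g.injective

/-- Pairs `(g, a)` such that `g` preserves the filter `F` and is, along `F`, the homothety of
ratio `a > 0` centred at `b`. -/
def germSubgroup (F : Filter 𝕀) (b : ℝ) : Subgroup ((𝕀 ≃ₜ 𝕀) × ℝˣ) where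
  carrier := {p | 0 < (p.2 : ℝ) ∧ map p.1 F = F ∧ ∀ᶠ u in F, (p.1 u : ℝ) - b = p.2 * ((u : ℝ) - b)}
  one_mem' := ⟨by simp, map_id, by simp⟩
  mul_mem' := by
    rintro ⟨g, a⟩ ⟨h, a'⟩ ⟨h1, h2, h3⟩ ⟨h1', h2', h3'⟩
    refine ⟨by simpa using mul_pos h1 h1', ?_, ?_⟩
    · change map (g ∘ h) F = F
      rw [← map_map, h2', h2]
    · have : ∀ᶠ u in F, (g (h u) : ℝ) - b = a * ((h u : ℝ) - b) := by
        rw [← h2'] at h3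
        exact h3
      filter_upwards [this, h3'] with u hu hu'
      simp only [Prod.mk_mul_mk, homeo_mul_apply, Units.val_mul]
      rw [hu, hu', mul_assoc]
  inv_mem' := by
    rintro ⟨g, a⟩ ⟨h1, h2, h3⟩
    change 0 < (a : ℝ) at h1
    change map g F = F at h2
    change ∀ᶠ u in F, (g u : ℝ) - b = a * ((u : ℝ) - b) at h3
    have h2' : map (g⁻¹ : 𝕀 ≃ₜ 𝕀) F = F := by
      conv_lhs => rw [← h2]
      rw [map_map]
      have : (g⁻¹ : 𝕀 ≃ₜ 𝕀) ∘ g = id := funext fun x => homeo_inv_apply_self g x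
      rw [this, map_id]
    refine ⟨by simpa using h1, h2', ?_⟩
    have : ∀ᶠ u in F, (g (g⁻¹ u) : ℝ) - b = a * ((g⁻¹ u : 𝕀) - b) := by
      rw [← h2'] at h3
      exact h3
    filter_upwards [this] with u hu
    simp only [Prod.inv_mk, Units.val_inv_eq_inv_val]
    rw [homeo_apply_inv_self] at hu
    rw [hu, inv_mul_cancel_left₀ h1.ne']

theorem eventually_commutator_apply_eq {F : Filter 𝕀} {b : ℝ} {G : Subgroup (𝕀 ≃ₜ 𝕀)}
    (hG : ∀ g ∈ G, ∃ a, (g, a) ∈ germSubgroup F b) {f : 𝕀 ≃ₜ 𝕀} (hf : f ∈ ⁅G, G⁆) :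
    ∀ᶠ u in F, f u = u := by
  have : (f, (1 : ℝˣ)) ∈ germSubgroup F b := by
    have hle : ⁅G, G⁆ ≤ (germSubgroup F b).comap (MonoidHom.inl (𝕀 ≃ₜ 𝕀) ℝˣ) := by
      rw [Subgroup.commutator_le]
      intro g hg h hh
      obtain ⟨a, ha⟩ := hG g hg
      obtain ⟨a', ha'⟩ := hG h hh
      have h1 : (g, a) * (h, a') * (g, a)⁻¹ * (h, a')⁻¹ ∈ germSubgroup F b :=
        mul_mem (mul_mem (mul_mem ha ha') (inv_mem ha)) (inv_mem ha')
      simp only [Prod.mk_mul_mk, Prod.inv_mk] at h1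
      rw [mul_right_comm a a', mul_inv_cancel, one_mul, mul_inv_cancel] at h1
      exact h1
    exact hle hf
  filter_upwards [this.2.2] with u hu
  exact Subtype.ext (by simpa using hu)

theorem map_nhdsLT {g : 𝕀 ≃ₜ 𝕀} (hg : StrictMono g) {β : 𝕀} (hβ : g β = β) :
    map g (𝓝[<] β) = 𝓝[<] β := by
  rw [g.isEmbedding.map_nhdsWithin_eq, hβ]
  congr 1
  ext u
  obtain ⟨v, rfl⟩ := g.surjective u
  nth_rw 2 [← hβ]
  simp [hg.lt_iff_lt]

theorem map_nhdsGT {g : 𝕀 ≃ₜ 𝕀} (hg : StrictMono g) {β : 𝕀} (hβ : g β = β) :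
    map g (𝓝[>] β) = 𝓝[>] β := by
  rw [g.isEmbedding.map_nhdsWithin_eq, hβ]
  congr 1
  ext u
  obtain ⟨v, rfl⟩ := g.surjective u
  nth_rw 2 [← hβ]
  simp [hg.lt_iff_lt]

theorem exists_germ_nhdsLT {g : 𝕀 ≃ₜ 𝕀} (hg : IsPLo g) {β : 𝕀} (hβ : g β = β) (h0 : 0 < β) :
    ∃ a, (g, a) ∈ germSubgroup (𝓝[<] β) β := by
  have hmono := strictMono_of_isPLo hg
  obtain ⟨-, n, x, hx0, hxn, hxlt, haff⟩ := hg
  have hex : ∃ j, (β : ℝ) ≤ x j := ⟨n, hxn ▸ β.2.2⟩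
  classical
  have hj0 : Nat.find hex ≠ 0 := by
    intro h
    have := Nat.find_spec hex
    rw [h, hx0] at this
    exact absurd (Subtype.coe_lt_coe.2 h0) (not_lt.2 this)
  obtain ⟨i, hi⟩ := Nat.exists_eq_succ_of_ne_zero hj0
  have hin : i < n := by
    have := Nat.find_min' hex (hxn ▸ β.2.2 : (β : ℝ) ≤ x n)
    omega
  have hi1 : (β : ℝ) ≤ x (i + 1) := by
    have := Nat.find_spec hex
    rwa [hi] at this
  have hi2 : x i < β := not_le.1 (Nat.find_min hex (by omega))
  obtain ⟨a, b, hab⟩ := haff i hin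
  have hβ' := hab β ⟨hi2.le, hi1⟩
  rw [hβ] at hβ'
  have hev : ∀ᶠ u in 𝓝[<] β, u < β ∧ (g u : ℝ) - β = a * ((u : ℝ) - β) := by
    have h1 : ∀ᶠ u : 𝕀 in 𝓝[<] β, x i < (u : ℝ) :=
      nhdsWithin_le_nhds (continuous_subtype_val.continuousAt.eventually (lt_mem_nhds hi2))
    filter_upwards [h1, self_mem_nhdsWithin] with u hu hu'
    refine ⟨hu', ?_⟩
    have hu'' : (u : ℝ) < β := hu'
    rw [hab u ⟨hu.le, hu''.le.trans hi1⟩]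
    linarith
  have : (𝓝[<] β).NeBot := nhdsLT_neBot_of_exists_lt ⟨0, h0⟩
  obtain ⟨u, hu, hu'⟩ := hev.exists
  have hgu : (g u : ℝ) < β := by
    have := hmono hu
    rwa [hβ] at this
  have hu2 : (u : ℝ) < β := hu
  have ha : 0 < a := by
    by_contra! ha
    nlinarith
  exact ⟨Units.mk0 a ha.ne', ha, map_nhdsLT hmono hβ, hev.mono fun u hu => hu.2⟩

theorem exists_germ_nhdsGT {g : 𝕀 ≃ₜ 𝕀} (hg : IsPLo g) {β : 𝕀} (hβ : g β = β) (h1 : β < 1) :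
    ∃ a, (g, a) ∈ germSubgroup (𝓝[>] β) β := by
  have hmono := strictMono_of_isPLo hg
  obtain ⟨-, n, x, hx0, hxn, hxlt, haff⟩ := hg
  have hβ1 : (β : ℝ) < 1 := h1
  have hex : ∃ j, (β : ℝ) < x j := ⟨n, hxn ▸ hβ1⟩
  classical
  have hj0 : Nat.find hex ≠ 0 := by
    intro h
    have := Nat.find_spec hex
    rw [h, hx0] at this
    exact absurd β.2.1 (not_le.2 this)
  obtain ⟨i, hi⟩ := Nat.exists_eq_succ_of_ne_zero hj0
  have hin : i < n := by
    have := Nat.find_min' hex (hxn ▸ hβ1 : (β : ℝ) < x n)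
    omega
  have hi1 : (β : ℝ) < x (i + 1) := by
    have := Nat.find_spec hex
    rwa [hi] at this
  have hi2 : x i ≤ β := not_lt.1 (Nat.find_min hex (by omega))
  obtain ⟨a, b, hab⟩ := haff i hin
  have hβ' := hab β ⟨hi2, hi1.le⟩
  rw [hβ] at hβ'
  have hev : ∀ᶠ u in 𝓝[>] β, β < u ∧ (g u : ℝ) - β = a * ((u : ℝ) - β) := by
    have h1 : ∀ᶠ u : 𝕀 in 𝓝[>] β, (u : ℝ) < x (i + 1) :=
      nhdsWithin_le_nhds (continuous_subtype_val.continuousAt.eventually (gt_mem_nhds hi1))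
    filter_upwards [h1, self_mem_nhdsWithin] with u hu hu'
    refine ⟨hu', ?_⟩
    have hu'' : (β : ℝ) < u := hu'
    rw [hab u ⟨hi2.trans hu''.le, hu.le⟩]
    linarith
  have : (𝓝[>] β).NeBot := nhdsGT_neBot_of_exists_gt ⟨1, h1⟩
  obtain ⟨u, hu, hu'⟩ := hev.exists
  have hgu : (β : ℝ) < g u := by
    have := hmono hu
    rwa [hβ] at this
  have hu2 : (β : ℝ) < u := hu
  have ha : 0 < a := by
    by_contra! ha
    nlinarith
  exact ⟨Units.mk0 a ha.ne', ha, map_nhdsGT hmono hβ, hev.mono fun u hu => hu.2⟩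

end Germs

section Orbits

open Filter Topology Set

/-- The convex hull of the orbit of `x`. -/
def orbitHull (G : Subgroup (𝕀 ≃ₜ 𝕀)) (x : 𝕀) : Set 𝕀 :=
  {u | ∃ g ∈ G, ∃ h ∈ G, g x ≤ u ∧ u ≤ h x}

variable {G : Subgroup (𝕀 ≃ₜ 𝕀)} {x : 𝕀}

theorem orbitHull_mono {K : Subgroup (𝕀 ≃ₜ 𝕀)} (h : K ≤ G) : orbitHull K x ⊆ orbitHull G x :=
  fun _ ⟨g, hg, k, hk, h1⟩ => ⟨g, h hg, k, h hk, h1⟩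

theorem apply_mem_orbitHull (hG : ∀ g ∈ G, IsPLo g) {g : 𝕀 ≃ₜ 𝕀} (hg : g ∈ G) {u : 𝕀}
    (hu : u ∈ orbitHull G x) : g u ∈ orbitHull G x := by
  obtain ⟨h, hh, k, hk, h1, h2⟩ := hu
  exact ⟨g * h, mul_mem hg hh, g * k, mul_mem hg hk, (hG g hg).1 h1, (hG g hg).1 h2⟩

theorem apply_isLUB_eq (hG : ∀ g ∈ G, IsPLo g) {β : 𝕀} (hβ : IsLUB {u | ∃ g ∈ G, g x = u} β)
    {g : 𝕀 ≃ₜ 𝕀} (hg : g ∈ G) : g β = β := by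
  have key : ∀ g ∈ G, β ≤ g β := by
    intro g hg
    refine hβ.2 ?_
    rintro _ ⟨h, hh, rfl⟩
    have := (hG g hg).1 (hβ.1 ⟨g⁻¹ * h, mul_mem (inv_mem hg) hh, rfl⟩)
    rwa [homeo_mul_apply, homeo_apply_inv_self] at this
  refine le_antisymm ?_ (key g hg)
  have := (hG g hg).1 (key _ (inv_mem hg))
  rwa [homeo_apply_inv_self] at this

theorem apply_isGLB_eq (hG : ∀ g ∈ G, IsPLo g) {β : 𝕀} (hβ : IsGLB {u | ∃ g ∈ G, g x = u} β)
    {g : 𝕀 ≃ₜ 𝕀} (hg : g ∈ G) : g β = β := by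
  have key : ∀ g ∈ G, g β ≤ β := by
    intro g hg
    refine hβ.2 ?_
    rintro _ ⟨h, hh, rfl⟩
    have := (hG g hg).1 (hβ.1 ⟨g⁻¹ * h, mul_mem (inv_mem hg) hh, rfl⟩)
    rwa [homeo_mul_apply, homeo_apply_inv_self] at this
  refine le_antisymm (key g hg) ?_
  have := (hG g hg).1 (key _ (inv_mem hg))
  rwa [homeo_apply_inv_self] at this

theorem apply_ne_of_fixed (hx : ∃ h ∈ G, h x ≠ x) {β : 𝕀} (hβ : ∀ g ∈ G, g β = β) {g : 𝕀 ≃ₜ 𝕀}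
    (hg : g ∈ G) : g x ≠ β := by
  intro h
  have hxβ : x = β := by
    rw [← homeo_inv_apply_self g x, h]
    exact hβ _ (inv_mem hg)
  obtain ⟨k, hk, hne⟩ := hx
  exact hne (by rw [hxβ]; exact hβ k hk)

theorem apply_lt_isLUB (hG : ∀ g ∈ G, IsPLo g) (hx : ∃ h ∈ G, h x ≠ x) {β : 𝕀}
    (hβ : IsLUB {u | ∃ g ∈ G, g x = u} β) {g : 𝕀 ≃ₜ 𝕀} (hg : g ∈ G) : g x < β :=
  lt_of_le_of_ne (hβ.1 ⟨g, hg, rfl⟩) (apply_ne_of_fixed hx (fun _ => apply_isLUB_eq hG hβ) hg)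

theorem isGLB_lt_apply (hG : ∀ g ∈ G, IsPLo g) (hx : ∃ h ∈ G, h x ≠ x) {β : 𝕀}
    (hβ : IsGLB {u | ∃ g ∈ G, g x = u} β) {g : 𝕀 ≃ₜ 𝕀} (hg : g ∈ G) : β < g x :=
  lt_of_le_of_ne (hβ.1 ⟨g, hg, rfl⟩) (apply_ne_of_fixed hx (fun _ => apply_isGLB_eq hG hβ) hg).symm

theorem exists_germ_isLUB (hG : ∀ g ∈ G, IsPLo g) (hx : ∃ h ∈ G, h x ≠ x) {β : 𝕀}
    (hβ : IsLUB {u | ∃ g ∈ G, g x = u} β) {g : 𝕀 ≃ₜ 𝕀} (hg : g ∈ G) :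
    ∃ a, (g, a) ∈ germSubgroup (𝓝[<] β) β :=
  exists_germ_nhdsLT (hG g hg) (apply_isLUB_eq hG hβ hg)
    ((bot_le (a := g x)).trans_lt (apply_lt_isLUB hG hx hβ hg))

theorem exists_lt_apply_of_eventually (hG : ∀ g ∈ G, IsPLo g) (hx : ∃ h ∈ G, h x ≠ x) {β : 𝕀}
    (hβ : IsLUB {u | ∃ g ∈ G, g x = u} β) {p : 𝕀 → Prop} (hp : ∀ᶠ u in 𝓝[<] β, p u) :
    ∃ g ∈ G, ∀ u, g x ≤ u → u < β → p u := by
  have h1 := apply_lt_isLUB hG hx hβ (one_mem G)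
  obtain ⟨a, ha, h⟩ := (mem_nhdsLT_iff_exists_Ioo_subset' h1).1 hp
  obtain ⟨_, ⟨g, hg, rfl⟩, h2, -⟩ := hβ.exists_between ha
  exact ⟨g, hg, fun u hu hu' => h ⟨h2.trans_le hu, hu'⟩⟩

theorem exists_apply_lt_of_eventually (hG : ∀ g ∈ G, IsPLo g) (hx : ∃ h ∈ G, h x ≠ x) {β : 𝕀}
    (hβ : IsGLB {u | ∃ g ∈ G, g x = u} β) {p : 𝕀 → Prop} (hp : ∀ᶠ u in 𝓝[>] β, p u) :
    ∃ g ∈ G, ∀ u, u ≤ g x → β < u → p u := by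
  have h1 := isGLB_lt_apply hG hx hβ (one_mem G)
  obtain ⟨a, ha, h⟩ := (mem_nhdsGT_iff_exists_Ioo_subset' h1).1 hp
  obtain ⟨_, ⟨g, hg, rfl⟩, -, h2⟩ := hβ.exists_between ha
  exact ⟨g, hg, fun u hu hu' => h ⟨hu', hu.trans_lt h2⟩⟩

/-- Finitely many elements of the commutator subgroup are supported, within the hull of an
orbit, in a common interval with endpoints in the orbit. -/
theorem exists_support_interval (hG : ∀ g ∈ G, IsPLo g) (hx : ∃ h ∈ G, h x ≠ x)
    {κ : Type*} [Finite κ] {f : κ → 𝕀 ≃ₜ 𝕀} (hf : ∀ k, f k ∈ ⁅G, G⁆) :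
    ∃ g ∈ G, ∃ h ∈ G, g x ≤ h x ∧
      ∀ k, ∀ u ∈ orbitHull G x, u ∉ Icc (g x) (h x) → f k u = u := by
  have hβ := isLUB_sSup {u | ∃ g ∈ G, g x = u}
  have hα := isGLB_sInf {u | ∃ g ∈ G, g x = u}
  have e1 : ∀ᶠ u in 𝓝[<] (sSup {u | ∃ g ∈ G, g x = u}), ∀ k, f k u = u :=
    eventually_all.2 fun k =>
      eventually_commutator_apply_eq (fun g hg => exists_germ_isLUB hG hx hβ hg) (hf k)
  have e2 : ∀ᶠ u in 𝓝[>] (sInf {u | ∃ g ∈ G, g x = u}), ∀ k, f k u = u :=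
    eventually_all.2 fun k =>
      eventually_commutator_apply_eq (fun g hg => exists_germ_nhdsGT (hG g hg)
        (apply_isGLB_eq hG hα hg) ((isGLB_lt_apply hG hx hα hg).trans_le le_top)) (hf k)
  obtain ⟨h, hh, hh'⟩ := exists_lt_apply_of_eventually hG hx hβ e1
  obtain ⟨g, hg, hg'⟩ := exists_apply_lt_of_eventually hG hx hα e2
  have hout : ∀ k, ∀ u ∈ orbitHull G x, (u ≤ g x ∨ h x ≤ u) → f k u = u := by
    rintro k u ⟨g', hg1, h', hh1, hu1, hu2⟩ (hu | hu)
    · exact hg' u hu ((isGLB_lt_apply hG hx hα hg1).trans_le hu1) k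
    · exact hh' u hu (hu2.trans_lt (apply_lt_isLUB hG hx hβ hh1)) k
  rcases le_total (g x) (h x) with hgh | hgh
  · refine ⟨g, hg, h, hh, hgh, fun k u hu hu' => hout k u hu ?_⟩
    by_contra! hc
    exact hu' ⟨hc.1.le, hc.2.le⟩
  · refine ⟨g, hg, g, hg, le_rfl, fun k u hu hu' => hout k u hu ?_⟩
    rcases le_total u (g x) with h1 | h1
    · exact Or.inl h1
    · exact Or.inr (hgh.trans h1)

end Orbits

section Lawless

open Set

variable {G : Subgroup (𝕀 ≃ₜ 𝕀)} {x : 𝕀}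

theorem abs_wordPos_le {ι V : Type*} [AddCommGroup V] {e : ι → V} (π : V →+ ℤ)
    (he : ∀ i, |π (e i)| ≤ 1) (l : List (ι × Bool)) : |π (wordPos e l)| ≤ l.length := by
  induction l with
  | nil => simp [wordPos]
  | cons il l ih =>
    obtain ⟨i, b⟩ := il
    have hi := abs_le.1 (he i)
    rw [abs_le] at ih ⊢
    cases b <;> simp only [wordPos, map_add, map_sub, List.length_cons, Nat.cast_add,
      Nat.cast_one] <;> constructor <;> linarith [hi.1, hi.2, ih.1, ih.2]

theorem lift_apply_eq_self {X κ : Type*} [TopologicalSpace X] {f : κ → X ≃ₜ X} {x : X}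
    (h : ∀ k, f k x = x) (w : FreeGroup κ) : FreeGroup.lift f w x = x :=
  (lift_mem_iff (J := {x}) (fun k y => by
    simp only [mem_singleton_iff]
    nth_rw 1 [← h k]
    exact (f k).injective.eq_iff) w x).2 rfl

theorem mem_support_iff (hG : ∀ g ∈ G, IsPLo g) {J : Set 𝕀} (hJ : J ⊆ orbitHull G x)
    {f : 𝕀 ≃ₜ 𝕀} (hf : f ∈ G) (hfJ : ∀ u ∈ orbitHull G x, u ∉ J → f u = u) (u : 𝕀) :
    f u ∈ J ↔ u ∈ J := by
  constructor
  · intro h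
    by_contra hu
    have hO := apply_mem_orbitHull hG (inv_mem hf) (hJ h)
    rw [homeo_inv_apply_self] at hO
    rw [hfJ u hO hu] at h
    exact hu h
  · intro h
    by_contra hu
    have := hfJ _ (apply_mem_orbitHull hG hf (hJ h)) hu
    rw [(f.injective this)] at hu
    exact hu h

theorem Icc_subset_orbitHull {g h : 𝕀 ≃ₜ 𝕀} (hg : g ∈ G) (hh : h ∈ G) :
    Icc (g x) (h x) ⊆ orbitHull G x :=
  fun _ hu => ⟨g, hg, h, hh, hu.1, hu.2⟩

theorem iterate_commutator_le (n : ℕ) (G : Subgroup (𝕀 ≃ₜ 𝕀)) :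
    (fun K : Subgroup (𝕀 ≃ₜ 𝕀) => ⁅K, K⁆)^[n] G ≤ G := by
  induction n generalizing G with
  | zero => exact le_rfl
  | succ n ih =>
    rw [Function.iterate_succ_apply]
    exact (ih _).trans (Subgroup.commutator_le.2 fun a ha b hb =>
      mul_mem (mul_mem (mul_mem ha hb) (inv_mem ha)) (inv_mem hb))

theorem commutator_le_self (G : Subgroup (𝕀 ≃ₜ 𝕀)) : ⁅G, G⁆ ≤ G := iterate_commutator_le 1 G

theorem exists_lt_apply (hG : ∀ g ∈ G, IsPLo g) (hx : ∃ h ∈ G, h x ≠ x) {g h : 𝕀 ≃ₜ 𝕀}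
    (hg : g ∈ G) (hh : h ∈ G) : ∃ k ∈ G, h x < k (g x) := by
  obtain ⟨_, ⟨k, hk, rfl⟩, h1, -⟩ := (isLUB_sSup {u | ∃ g ∈ G, g x = u}).exists_between
    (apply_lt_isLUB hG hx (isLUB_sSup _) hh)
  refine ⟨k * g⁻¹, mul_mem hk (inv_mem hg), ?_⟩
  rwa [homeo_mul_apply, homeo_inv_apply_self]

theorem zpow_apply_ne {g : 𝕀 ≃ₜ 𝕀} (hg : StrictMono g) {a b : 𝕀} (hab : b < g a)
    {m : ℤ} (hm : m ≠ 0) {u v : 𝕀} (hu : u ∈ Icc a b) (hv : v ∈ Icc a b) :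
    (g ^ m) u ≠ v := by
  have key : ∀ n : ℕ, ∀ u ∈ Icc a b, b < (g ^ (n + 1)) u := by
    intro n u hu
    induction n with
    | zero =>
      rw [zero_add, pow_one]
      exact hab.trans_le (hg.monotone hu.1)
    | succ n ih =>
      rw [pow_succ', homeo_mul_apply]
      exact hab.trans_le (hg.monotone ((hu.1.trans hu.2).trans ih.le))
  intro h
  rcases lt_or_gt_of_ne hm with hm | hm
  · obtain ⟨n, rfl⟩ : ∃ n : ℕ, m = -(n + 1 : ℕ) := ⟨(-m).toNat - 1, by omega⟩
    have h' : (g ^ (n + 1)) v = u := by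
      rw [← h, zpow_neg, zpow_natCast, homeo_apply_inv_self]
    have := key n v hv
    rw [h'] at this
    exact not_lt.2 hu.2 this
  · obtain ⟨n, rfl⟩ : ∃ n : ℕ, m = (n + 1 : ℕ) := ⟨m.toNat - 1, by omega⟩
    have := key n u hu
    rw [← zpow_natCast, h] at this
    exact not_lt.2 hv.2 this

theorem mul_add_injOn {N n : ℤ} (hN : 2 * n < N) {a b p q : ℤ} (hp : p ∈ Icc (-n) n)
    (hq : q ∈ Icc (-n) n) (h : a * N + p = b * N + q) : a = b ∧ p = q := by
  obtain ⟨hp1, hp2⟩ := hp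
  obtain ⟨hq1, hq2⟩ := hq
  have hab : a = b := by
    rcases lt_trichotomy a b with h' | h' | h'
    · nlinarith
    · exact h'
    · nlinarith
  subst hab
  exact ⟨rfl, by linarith⟩

/-- If the `L`-th derived subgroup of `G` moves `x`, then `G` contains finite families of any size
satisfying no nontrivial relation of length at most `L`, as witnessed on the hull of the orbit
of `x`. -/
theorem exists_family_without_short_relations (L : ℕ) (G : Subgroup (𝕀 ≃ₜ 𝕀))
    (hG : ∀ g ∈ G, IsPLo g) (x : 𝕀)
    (hx : ∃ h ∈ (fun K : Subgroup (𝕀 ≃ₜ 𝕀) => ⁅K, K⁆)^[L] G, h x ≠ x)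
    (ι : Type) [Finite ι] [DecidableEq ι] :
    ∃ y : ι → 𝕀 ≃ₜ 𝕀, (∀ i, y i ∈ G) ∧ ∀ w : FreeGroup ι, w ≠ 1 → w.norm ≤ L →
      ∃ u ∈ orbitHull G x, FreeGroup.lift y w u ≠ u := by
  induction L generalizing G ι with
  | zero =>
    refine ⟨fun _ => 1, fun _ => one_mem G, fun w hw hwn => ?_⟩
    exact absurd (FreeGroup.norm_eq_zero.1 (Nat.le_zero.1 hwn)) hw
  | succ L ih =>
    have hxG : ∃ h ∈ G, h x ≠ x := by
      obtain ⟨h, hh, hne⟩ := hx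
      exact ⟨h, iterate_commutator_le _ _ hh, hne⟩
    rw [Function.iterate_succ_apply] at hx
    set n : ℤ := L + 1 with hn
    obtain ⟨f, hf, hfw⟩ := ih ⁅G, G⁆ (fun g hg => hG g (commutator_le_self G hg)) hx
      (ι × Icc (-n) n)
    have hfG : ∀ k, f k ∈ G := fun k => commutator_le_self G (hf k)
    obtain ⟨g₁, hg₁, g₂, hg₂, h12, hsupp⟩ := exists_support_interval hG hxG hf
    obtain ⟨g, hg, hgJ⟩ := exists_lt_apply hG hxG hg₁ hg₂
    set J : Set 𝕀 := Icc (g₁ x) (g₂ x) with hJdef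
    have hJO : J ⊆ orbitHull G x := Icc_subset_orbitHull hg₁ hg₂
    have hfJ : ∀ k u, f k u ∈ J ↔ u ∈ J := fun k => mem_support_iff hG hJO (hfG k) (hsupp k)
    have hgmono := strictMono_of_isPLo (hG g hg)
    set N : ℤ := 2 * n + 1 with hN
    obtain ⟨k, ⟨ν⟩⟩ := Finite.exists_equiv_fin ι
    have := Fintype.ofFinite ι
    let c : ι × Icc (-n) n → 𝕀 ≃ₜ 𝕀 := fun q => g ^ ((ν q.1 : ℕ) * N + q.2 : ℤ)
    let F : ι → ι × Icc (-n) n → 𝕀 ≃ₜ 𝕀 := fun i q => if i = q.1 then 1 else f (i, q.2)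
    let E : ι → 𝕀 ≃ₜ 𝕀 := fun i =>
      ((Finset.univ : Finset (ι × Icc (-n) n)).toList.map fun q => c q * F i q * (c q)⁻¹).prod
    have hcG : ∀ q, c q ∈ G := fun q => zpow_mem hg _
    have hFG : ∀ i q, F i q ∈ G := by
      intro i q
      simp only [F]
      split_ifs
      exacts [one_mem G, hfG _]
    have hEG : ∀ i, E i ∈ G := fun i => list_prod_mem fun z hz => by
      obtain ⟨q, -, rfl⟩ := List.mem_map.1 hz
      exact mul_mem (mul_mem (hcG q) (hFG i q)) (inv_mem (hcG q))
    have hFJ : ∀ i q, ∀ u ∈ J, F i q u ∈ J := by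
      intro i q u hu
      simp only [F]
      split_ifs
      exacts [hu, (hfJ _ _).2 hu]
    have hE : ∀ i q, ∀ u ∈ J, E i (c q u) = c q (F i q u) := by
      intro i q u hu
      refine (window_prod_apply (hFJ i) ?_ _ (Finset.nodup_toList _) q u hu).2 (by simp)
      intro q q' hqq u hu
      simp only [F]
      split_ifs
      · rfl
      refine hsupp _ _ (apply_mem_orbitHull hG (inv_mem (hcG q))
        (apply_mem_orbitHull hG (hcG q') (hJO hu))) fun hmem => ?_
      have heq : (c q)⁻¹ (c q' u) =
          (g ^ (-((ν q.1 : ℕ) * N + q.2) + ((ν q'.1 : ℕ) * N + q'.2) : ℤ)) u := by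
        rw [zpow_add, zpow_neg]
        rfl
      refine zpow_apply_ne hgmono hgJ ?_ hu hmem heq.symm
      intro h0
      obtain ⟨h1, h2⟩ := mul_add_injOn (by omega : 2 * n < N) q.2.2 q'.2.2
        (by linarith : ((ν q.1 : ℕ) : ℤ) * N + q.2 = (ν q'.1 : ℕ) * N + q'.2)
      refine hqq (Prod.ext (ν.injective (Fin.ext (by exact_mod_cast h1))) (Subtype.ext h2))
    refine ⟨fun i => g * E i, fun i => mul_mem hg (hEG i), fun w hw hwn => ?_⟩
    obtain ⟨⟨b, ε⟩, hbmem⟩ := List.exists_mem_of_ne_nil w.toWord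
      (fun h => hw (FreeGroup.toWord_eq_nil_iff.1 h))
    have hnn : -n ≤ n := by omega
    obtain ⟨u, hu, hne⟩ := exists_lift_apply_ne (e := fun _ : ι => (1 : ℤ)) (i₀ := b)
      (AddMonoidHom.id ℤ) rfl (P := Icc (-n) n)
      (a := fun i p => if i = b then 1 else FreeGroup.of (i, projIcc (-n) n hnn p))
      (lab := fun i p => (i, projIcc (-n) n hnn p)) (J := J) (y := fun i => g * E i)
      (c := fun p => g ^ ((ν b : ℕ) * N + p : ℤ)) (f := f) (n := L + 1) (w := w)
      (by simp) (by intro i p; split_ifs <;> simp) (by intro i hi p _; simp [hi])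
      (by
        intro i _ p hp j _ q hq h
        rw [Prod.mk.injEq, projIcc_of_mem _ hp, projIcc_of_mem _ hq] at h
        exact ⟨h.1, congrArg Subtype.val h.2⟩)
      ⟨g₁ x, le_rfl, h12⟩ hfJ
      (by
        intro i p hp _ u hu
        have := hE i (b, ⟨p, hp⟩) u hu
        simp only [c, F] at this
        rw [homeo_mul_apply, this, ← homeo_mul_apply, ← add_assoc, add_comm _ (1 : ℤ),
          zpow_one_add]
        congr 1
        split_ifs
        · simp
        · rw [FreeGroup.lift_apply_of, projIcc_of_mem _ hp])
      (by
        intro p hp hp0 u hu v hv h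
        rw [add_zero, zpow_add, homeo_mul_apply] at h
        exact zpow_apply_ne hgmono hgJ hp0 hu hv ((g ^ _).injective h))
      (by
        intro l hl
        have := abs_wordPos_le (e := fun _ : ι => (1 : ℤ)) (AddMonoidHom.id ℤ) (by simp) l
        rw [AddMonoidHom.id_apply, abs_le] at this
        constructor <;> omega)
      hw hwn
      (by
        intro v hv hvn
        have hlt : (w.toWord.countP fun x => decide (x.1 ≠ b)) < w.toWord.length := by
          refine lt_of_le_of_ne List.countP_le_length fun h => ?_
          have := List.countP_eq_length.1 h _ hbmem
          simp at this
        obtain ⟨u, hu, hne⟩ := hfw v hv (by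
          have : w.toWord.length ≤ L + 1 := hwn
          omega)
        refine ⟨u, ?_, hne⟩
        by_contra huJ
        exact hne (lift_apply_eq_self (fun k =>
          hsupp k u (orbitHull_mono (commutator_le_self G) hu) huJ) v))
    exact ⟨_, apply_mem_orbitHull hG (zpow_mem hg _) (hJO hu), hne⟩

end Lawless

section Slopes

open Filter Topology Set

theorem eq_zero_of_sum_pow_mul_eq_zero {R : ℕ} {B : ℤ} {p : Fin R → ℤ} (hp : ∀ i, |p i| < B)
    (h : ∑ i : Fin R, B ^ (i : ℕ) * p i = 0) : p = 0 := by
  induction R with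
  | zero => exact Subsingleton.elim _ _
  | succ R ih =>
    have hB : 0 < B := (abs_nonneg _).trans_lt (hp 0)
    have hs : ∑ i : Fin (R + 1), B ^ (i : ℕ) * p i
        = p 0 + B * ∑ i : Fin R, B ^ (i : ℕ) * p i.succ := by
      rw [Fin.sum_univ_succ, Finset.mul_sum]
      simp [pow_succ', mul_assoc]
    rw [hs] at h
    have h0 : p 0 = 0 := Int.eq_zero_of_abs_lt_dvd (m := B)
      ⟨-∑ i : Fin R, B ^ (i : ℕ) * p i.succ, by linarith⟩ (hp 0)
    rw [h0, zero_add] at h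
    have hsucc := ih (fun i => hp i.succ) ((mul_eq_zero.1 h).resolve_left hB.ne')
    funext i
    cases i using Fin.cases with
    | zero => exact h0
    | succ i => exact congrFun hsucc i

theorem exists_separating_exponent {ι : Type*} [Fintype ι] {μ : ℝ} (hμ0 : 0 < μ) (hμ1 : μ < 1)
    {ν : ι → ℝ} (hν : ∀ i, 0 < ν i) {k : ι → ℤ} {K : Set (ι → ℤ)} (hK : K.Finite)
    (hk : ∀ p ∈ K, ∀ q ∈ K, p ≠ q → ∑ i, k i * p i ≠ ∑ i, k i * q i) {v w : ℝ}
    (hw : 0 < w) :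
    ∃ N : ℕ, ∀ p ∈ K, ∀ q ∈ K, p ≠ q →
      (∏ i, (ν i * (μ ^ N) ^ k i) ^ p i) * v < (∏ i, (ν i * (μ ^ N) ^ k i) ^ q i) * w ∨
      (∏ i, (ν i * (μ ^ N) ^ k i) ^ q i) * v < (∏ i, (ν i * (μ ^ N) ^ k i) ^ p i) * w := by
  have hprod : ∀ (N : ℕ) (p : ι → ℤ), ∏ i, (ν i * (μ ^ N) ^ k i) ^ p i =
      (∏ i, ν i ^ p i) * (μ ^ N) ^ (∑ i, k i * p i) := by
    intro N p
    simp_rw [mul_zpow, Finset.prod_mul_distrib, ← zpow_mul]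
    congr 1
    generalize (Finset.univ : Finset ι) = s
    classical
    induction s using Finset.induction_on with
    | empty => simp
    | insert a s ha ih =>
      rw [Finset.prod_insert ha, Finset.sum_insert ha, ih, zpow_add₀ (pow_pos hμ0 N).ne']
  have hpos : ∀ p : ι → ℤ, 0 < ∏ i, ν i ^ p i :=
    fun p => Finset.prod_pos fun i _ => zpow_pos (hν i) _
  have key : ∀ p q : ι → ℤ, ∑ i, k i * q i < ∑ i, k i * p i → ∀ᶠ N : ℕ in atTop,
      (∏ i, (ν i * (μ ^ N) ^ k i) ^ p i) * v < (∏ i, (ν i * (μ ^ N) ^ k i) ^ q i) * w := by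
    intro p q hpq
    obtain ⟨m, hm⟩ := Int.eq_ofNat_of_zero_le (sub_nonneg.2 hpq.le)
    have hm0 : m ≠ 0 := by
      rintro rfl
      simp at hm
      omega
    have hlim : Tendsto (fun N : ℕ => (∏ i, ν i ^ p i) * v * (μ ^ m) ^ N) atTop (𝓝 0) := by
      have := (tendsto_pow_atTop_nhds_zero_of_lt_one (pow_nonneg hμ0.le m)
        (pow_lt_one₀ hμ0.le hμ1 hm0)).const_mul ((∏ i, ν i ^ p i) * v)
      simpa using this
    filter_upwards [hlim.eventually (gt_mem_nhds (mul_pos (hpos q) hw))] with N hN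
    have hsum : ∑ i, k i * p i = m + ∑ i, k i * q i := by linarith
    have hN0 : (0 : ℝ) < (μ ^ N) ^ (∑ i, k i * q i) := zpow_pos (pow_pos hμ0 N) _
    rw [hprod, hprod, hsum, zpow_add₀ (pow_pos hμ0 N).ne', zpow_natCast, ← pow_mul, mul_comm N m,
      pow_mul]
    have := mul_lt_mul_of_pos_right hN hN0
    linarith
  have hall : ∀ᶠ N : ℕ in atTop, ∀ p ∈ K, ∀ q ∈ K, p ≠ q →
      (∏ i, (ν i * (μ ^ N) ^ k i) ^ p i) * v < (∏ i, (ν i * (μ ^ N) ^ k i) ^ q i) * w ∨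
      (∏ i, (ν i * (μ ^ N) ^ k i) ^ q i) * v < (∏ i, (ν i * (μ ^ N) ^ k i) ^ p i) * w := by
    refine (eventually_all_finite hK).2 fun p hp => (eventually_all_finite hK).2 fun q hq => ?_
    by_cases hpq : p = q
    · simp [hpq]
    rcases lt_or_gt_of_ne (hk p hp q hq hpq) with h | h
    · exact (key q p h).mono fun N hN _ => Or.inr hN
    · exact (key p q h).mono fun N hN _ => Or.inl hN
  exact hall.exists

theorem le_closure_range_of_twist {H ι : Type*} [Group H] [DecidableEq ι] {s : ι → H} {i₀ i₁ : ι}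
    (h01 : i₁ ≠ i₀) (h0 : s i₀ = 1) (h1 : s i₁ = 1) {t z : H} {k M : ι → ℤ} (hk : k i₀ = 1) :
    Subgroup.closure (range s) ≤ Subgroup.closure (range fun i =>
      s i * t ^ k i * if i = i₀ then 1 else (t ^ M i)⁻¹ * z * t ^ M i) := by
  set K := Subgroup.closure (range fun i =>
      s i * t ^ k i * if i = i₀ then 1 else (t ^ M i)⁻¹ * z * t ^ M i) with hK
  have hy : ∀ i, (s i * t ^ k i * if i = i₀ then 1 else (t ^ M i)⁻¹ * z * t ^ M i) ∈ K :=
    fun i => Subgroup.subset_closure ⟨i, rfl⟩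
  have ht : t ∈ K := by simpa [h0, hk] using hy i₀
  have hz : z ∈ K := by
    have h2 := hy i₁
    rw [h1, if_neg h01, one_mul, K.mul_mem_cancel_left (zpow_mem ht _),
      K.mul_mem_cancel_right (zpow_mem ht _),
      K.mul_mem_cancel_left (inv_mem (zpow_mem ht _))] at h2
    exact h2
  rw [Subgroup.closure_le]
  rintro _ ⟨i, rfl⟩
  have h2 := hy i
  rw [K.mul_mem_cancel_right, K.mul_mem_cancel_right (zpow_mem ht _)] at h2
  · exact h2
  · split_ifs
    · exact one_mem K
    · exact mul_mem (mul_mem (inv_mem (zpow_mem ht _)) hz) (zpow_mem ht _)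

end Slopes

section Windows

open Filter Topology Set

variable {G : Subgroup (𝕀 ≃ₜ 𝕀)} {x β : 𝕀}

theorem eventually_eq_of_mem_germSubgroup {F : Filter 𝕀} {b : ℝ} {g h : 𝕀 ≃ₜ 𝕀} {a : ℝˣ}
    (hg : (g, a) ∈ germSubgroup F b) (hh : (h, a) ∈ germSubgroup F b) : ∀ᶠ u in F, g u = h u := by
  filter_upwards [hg.2.2, hh.2.2] with u hu hu'
  exact Subtype.ext (by simpa using hu.trans hu'.symm)

theorem list_prod_mem_germSubgroup {F : Filter 𝕀} {b : ℝ} {R : ℕ} {σ : Fin R → 𝕀 ≃ₜ 𝕀}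
    {l : Fin R → ℝˣ} (h : ∀ i, (σ i, l i) ∈ germSubgroup F b) (p : Fin R → ℤ) :
    ((List.ofFn fun i => σ i ^ p i).prod, ∏ i, l i ^ p i) ∈ germSubgroup F b := by
  have hmem : (List.ofFn fun i => (σ i, l i) ^ p i).prod ∈ germSubgroup F b :=
    list_prod_mem fun z hz => by
      obtain ⟨i, rfl⟩ := (List.mem_ofFn' _ _).1 hz
      exact zpow_mem (h i) _
  convert hmem
  · change _ = MonoidHom.fst (𝕀 ≃ₜ 𝕀) ℝˣ _
    rw [map_list_prod, List.map_ofFn]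
    rfl
  · change _ = MonoidHom.snd (𝕀 ≃ₜ 𝕀) ℝˣ _
    rw [map_list_prod, List.map_ofFn, ← List.prod_ofFn]
    rfl

theorem eventually_zpow_mul_list_prod_apply {F : Filter 𝕀} {b : ℝ} {R : ℕ} {σ : Fin R → 𝕀 ≃ₜ 𝕀}
    {l : Fin R → ℝˣ} (h : ∀ i, (σ i, l i) ∈ germSubgroup F b) (p : Fin R → ℤ) (i : Fin R) (m : ℤ) :
    ∀ᶠ u in F, (σ i ^ m) ((List.ofFn fun j => σ j ^ p j).prod u) =
      (List.ofFn fun j => σ j ^ (p + Pi.single i m : Fin R → ℤ) j).prod u := by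
  have h1 := mul_mem (zpow_mem (h i) m) (list_prod_mem_germSubgroup h p)
  have h2 := list_prod_mem_germSubgroup h (p + Pi.single i m)
  have heq : ∏ j, l j ^ (p + Pi.single i m : Fin R → ℤ) j = l i ^ m * ∏ j, l j ^ p j := by
    simp_rw [Pi.add_apply, zpow_add, Finset.prod_mul_distrib]
    rw [mul_comm, Fintype.prod_eq_single i (fun j hj => by simp [hj]), Pi.single_eq_same]
  rw [heq] at h2
  exact eventually_eq_of_mem_germSubgroup h1 h2

/-- An interval can be pushed arbitrarily close to the supremum of the orbit while keeping the
ratio of the distances of its endpoints to the supremum bounded. -/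
theorem exists_contracting_window (hG : ∀ g ∈ G, IsPLo g) (hx : ∃ h ∈ G, h x ≠ x)
    (hβ : IsLUB {u | ∃ g ∈ G, g x = u} β) {t : 𝕀 ≃ₜ 𝕀} (ht : t ∈ G) {μ : ℝˣ}
    (hμ : (t, μ) ∈ germSubgroup (𝓝[<] β) β) (hμ1 : (μ : ℝ) < 1) {g₁ g₂ : 𝕀 ≃ₜ 𝕀} (hg₁ : g₁ ∈ G)
    (hg₂ : g₂ ∈ G) :
    ∃ v w : ℝ, 0 < w ∧ ∀ p : 𝕀 → Prop, (∀ᶠ u in 𝓝[<] β, p u) → ∃ h ∈ G, ∃ r > 0,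
      ∀ u ∈ Icc (g₁ x) (g₂ x), p (h u) ∧ r * w ≤ β - h u ∧ (β - h u : ℝ) ≤ r * v := by
  obtain ⟨hμ0, -, hlin⟩ := hμ
  change 0 < (μ : ℝ) at hμ0
  obtain ⟨g', hg', hlin'⟩ := exists_lt_apply_of_eventually hG hx hβ hlin
  obtain ⟨g, hg, hgg⟩ := exists_lt_apply hG hx hg₁ hg'
  have hiter : ∀ (K : ℕ) (u : 𝕀), g' x ≤ u → u < β →
      g' x ≤ (t ^ K) u ∧ (t ^ K) u < β ∧ ((t ^ K) u : ℝ) - β = (μ : ℝ) ^ K * ((u : ℝ) - β) := by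
    intro K u hu hu'
    induction K with
    | zero => exact ⟨hu, hu', by simp⟩
    | succ K ih =>
      obtain ⟨h1, h2, h3⟩ := ih
      have h4 : (t ((t ^ K) u) : ℝ) - β = μ * (((t ^ K) u : 𝕀) - β) := hlin' _ h1 h2
      have h2' : ((t ^ K) u : ℝ) < β := h2
      rw [pow_succ', homeo_mul_apply]
      refine ⟨h1.trans (Subtype.coe_le_coe.1 ?_), Subtype.coe_lt_coe.1 ?_, ?_⟩
      · nlinarith
      · nlinarith
      · rw [h4, h3]
        ring
  have hlt : ∀ k ∈ G, (k x : ℝ) < β := fun k hk => apply_lt_isLUB hG hx hβ hk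
  refine ⟨β - g (g₁ x), β - g (g₂ x), sub_pos.2 (hlt _ (mul_mem hg hg₂)), fun p hp => ?_⟩
  obtain ⟨g'', hg'', hp'⟩ := exists_lt_apply_of_eventually hG hx hβ hp
  obtain ⟨K, hK⟩ : ∃ K : ℕ, (μ : ℝ) ^ K * (β - g (g₁ x)) < β - g'' x := by
    have := (tendsto_pow_atTop_nhds_zero_of_lt_one hμ0.le hμ1).mul_const ((β : ℝ) - g (g₁ x))
    rw [zero_mul] at this
    exact (this.eventually (gt_mem_nhds (sub_pos.2 (hlt _ hg'')))).exists
  refine ⟨t ^ K * g, mul_mem (pow_mem ht K) hg, (μ : ℝ) ^ K, pow_pos hμ0 K, fun u hu => ?_⟩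
  have hu1 : (g (g₁ x) : ℝ) ≤ g u := (hG g hg).1 hu.1
  have hu2 : (g u : ℝ) ≤ g (g₂ x) := (hG g hg).1 hu.2
  have huβ : g u < β :=
    Subtype.coe_lt_coe.1 (hu2.trans_lt (hlt _ (mul_mem hg hg₂)))
  obtain ⟨-, h2, h3⟩ := hiter K (g u) (hgg.le.trans hu1) huβ
  rw [homeo_mul_apply]
  have hKpos := pow_pos hμ0 K
  refine ⟨hp' _ (Subtype.coe_le_coe.1 ?_) h2, ?_, ?_⟩ <;> nlinarith

/-- Some element of any generating family has a germ of slope different from `1` at the supremum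
of the orbit, so that one of its powers is a contraction there. -/
theorem exists_contraction (hG : ∀ g ∈ G, IsPLo g) (hx : ∃ h ∈ G, h x ≠ x)
    (hβ : IsLUB {u | ∃ g ∈ G, g x = u} β) {ι : Type*} [Finite ι] {s : ι → 𝕀 ≃ₜ 𝕀}
    (hs : Subgroup.closure (range s) = G) :
    ∃ t ∈ G, ∃ μ : ℝˣ, (t, μ) ∈ germSubgroup (𝓝[<] β) β ∧ (μ : ℝ) < 1 := by
  have hsG : ∀ i, s i ∈ G := fun i => hs ▸ Subgroup.subset_closure ⟨i, rfl⟩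
  choose a ha using fun i => exists_germ_isLUB hG hx hβ (hsG i)
  by_cases h : ∀ i, a i = 1
  · exfalso
    have hev : ∀ᶠ u in 𝓝[<] β, ∀ i, s i u = u := eventually_all.2 fun i =>
      eventually_eq_of_mem_germSubgroup (h i ▸ ha i) (one_mem (germSubgroup (𝓝[<] β) β))
    obtain ⟨g, hg, hfix⟩ := exists_lt_apply_of_eventually hG hx hβ hev
    refine apply_ne_of_fixed hx (β := g x) (fun k hk => ?_) hg rfl
    rw [← hs] at hk
    induction hk using Subgroup.closure_induction with
    | mem k hk =>
      obtain ⟨i, rfl⟩ := hk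
      exact hfix _ le_rfl (apply_lt_isLUB hG hx hβ hg) i
    | one => rfl
    | mul k k' _ _ ih ih' => rw [homeo_mul_apply, ih', ih]
    | inv k _ ih =>
      nth_rw 1 [← ih]
      exact homeo_inv_apply_self _ _
  · push Not at h
    obtain ⟨i, hi⟩ := h
    have hpos : 0 < (a i : ℝ) := (ha i).1
    rcases lt_or_gt_of_ne (fun h' => hi (Units.ext h') : (a i : ℝ) ≠ 1) with h1 | h1
    · exact ⟨s i, hsG i, a i, ha i, h1⟩
    · refine ⟨(s i)⁻¹, inv_mem (hsG i), (a i)⁻¹, inv_mem (ha i), ?_⟩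
      rw [Units.val_inv_eq_inv_val]
      exact inv_lt_one_of_one_lt₀ h1

end Windows

section Generators

open Filter Topology Set

theorem exists_generators_without_short_relations (n : ℕ) (G : Subgroup (𝕀 ≃ₜ 𝕀))
    (hG : ∀ g ∈ G, IsPLo g) (x : 𝕀)
    (hx : ∃ h ∈ (fun K : Subgroup (𝕀 ≃ₜ 𝕀) => ⁅K, K⁆)^[n + 1] G, h x ≠ x) {r : ℕ}
    {s : Fin (r + 2) → 𝕀 ≃ₜ 𝕀} (hs : Subgroup.closure (range s) = G) (h0 : s 0 = 1)
    (h1 : s 1 = 1) :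
    ∃ y : Fin (r + 2) → 𝕀 ≃ₜ 𝕀, (∀ i, y i ∈ G) ∧ G ≤ Subgroup.closure (range y) ∧
      ∀ w : FreeGroup (Fin (r + 2)), w ≠ 1 → w.norm ≤ n → FreeGroup.lift y w ≠ 1 := by
  have hxG : ∃ h ∈ G, h x ≠ x := by
    obtain ⟨h, hh, hne⟩ := hx
    exact ⟨h, iterate_commutator_le _ _ hh, hne⟩
  rw [Function.iterate_succ_apply] at hx
  have hsG : ∀ i, s i ∈ G := fun i => hs ▸ Subgroup.subset_closure ⟨i, rfl⟩
  have hβ := isLUB_sSup {u | ∃ g ∈ G, g x = u}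
  set β : 𝕀 := sSup {u | ∃ g ∈ G, g x = u}
  -- positions of the windows
  set N : ℤ := 2 * n + 1 with hN
  set D : ℤ := n + (r + 2) * N with hD
  have hnD : (n : ℤ) ≤ D := by
    have : 0 ≤ ((r : ℤ) + 2) * N := by positivity
    omega
  let M : Fin (r + 2) → ℤ := fun i => (i : ℕ) * N
  let P : Set (Fin (r + 2) → ℤ) := Icc (fun _ => -(n : ℤ)) (fun _ => n)
  let κ : Set (Fin (r + 2) → ℤ) := Icc (fun _ => -D) (fun _ => D)
  have hκ : κ.Finite := finite_Icc _ _
  have : Finite κ := hκ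
  have := Fintype.ofFinite κ
  have hPκ : P ⊆ κ := Icc_subset_Icc (fun _ => neg_le_neg hnD) (fun _ => hnD)
  have hMκ : ∀ i, ∀ p ∈ P, p + Pi.single 0 (M i) ∈ κ := by
    intro i p hp
    have hM0 : 0 ≤ M i := by positivity
    have hMD : n + M i ≤ D := by
      have : ((i : ℕ) : ℤ) ≤ r + 2 := by
        have := i.2
        omega
      have : ((i : ℕ) : ℤ) * N ≤ (r + 2) * N := mul_le_mul_of_nonneg_right this (by positivity)
      simp only [M]
      omega
    constructor
    all_goals
      intro j
      have h1 : -(n : ℤ) ≤ p j := hp.1 j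
      have h2 : p j ≤ (n : ℤ) := hp.2 j
      change _ ≤ _
      rcases eq_or_ne j 0 with rfl | hj
      · simp only [Pi.add_apply, Pi.single_eq_same]
        omega
      · simp only [Pi.add_apply, Pi.single_eq_of_ne hj]
        omega
  have hzero : (0 : Fin (r + 2) → ℤ) ∈ P :=
    ⟨fun _ => neg_nonpos.2 (Nat.cast_nonneg n), fun _ => Nat.cast_nonneg n⟩
  -- a lawless family supported on a compact window
  obtain ⟨f, hf, hfw⟩ := exists_family_without_short_relations n ⁅G, G⁆
    (fun g hg => hG g (commutator_le_self G hg)) x hx κ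
  have hfG : ∀ k, f k ∈ G := fun k => commutator_le_self G (hf k)
  obtain ⟨g₁, hg₁, g₂, hg₂, h12, hsupp⟩ := exists_support_interval hG hxG hf
  set J : Set 𝕀 := Icc (g₁ x) (g₂ x) with hJdef
  have hJO : J ⊆ orbitHull G x := Icc_subset_orbitHull hg₁ hg₂
  have hfJ : ∀ k u, f k u ∈ J ↔ u ∈ J := fun k => mem_support_iff hG hJO (hfG k) (hsupp k)
  -- a contraction near `β` and generators with independent slopes
  obtain ⟨t₀, ht₀, μ, hμ, hμ1⟩ := exists_contraction hG hxG hβ hs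
  obtain ⟨v, w₀, hw₀, hwindow⟩ := exists_contracting_window hG hxG hβ ht₀ hμ hμ1 hg₁ hg₂
  choose ν hν using fun i => exists_germ_isLUB hG hxG hβ (hsG i)
  let k : Fin (r + 2) → ℤ := fun i => (2 * D + 1) ^ (i : ℕ)
  obtain ⟨m, hm⟩ := exists_separating_exponent (ι := Fin (r + 2)) (v := v) hμ.1 hμ1
    (fun i => (hν i).1) (k := k) hκ
    (by
      intro p hp q hq hpq h
      refine hpq (sub_eq_zero.1 (eq_zero_of_sum_pow_mul_eq_zero (B := 2 * D + 1) ?_ ?_))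
      · intro i
        have h1 : -D ≤ p i := hp.1 i
        have h2 : p i ≤ D := hp.2 i
        have h3 : -D ≤ q i := hq.1 i
        have h4 : q i ≤ D := hq.2 i
        rw [Pi.sub_apply, abs_lt]
        constructor <;> omega
      · simp only [Pi.sub_apply, mul_sub, Finset.sum_sub_distrib]
        exact sub_eq_zero.2 h) hw₀
  let t : 𝕀 ≃ₜ 𝕀 := t₀ ^ m
  have ht : t ∈ G := pow_mem ht₀ m
  let σ : Fin (r + 2) → 𝕀 ≃ₜ 𝕀 := fun i => s i * t ^ k i
  have hσG : ∀ i, σ i ∈ G := fun i => mul_mem (hsG i) (zpow_mem ht _)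
  have hσ0 : σ 0 = t := by simp [σ, k, h0]
  let l : Fin (r + 2) → ℝˣ := fun i => ν i * (μ ^ m) ^ k i
  have hσ : ∀ i, (σ i, l i) ∈ germSubgroup (𝓝[<] β) β :=
    fun i => mul_mem (hν i) (zpow_mem (pow_mem hμ m) (k i))
  let c₀ : (Fin (r + 2) → ℤ) → 𝕀 ≃ₜ 𝕀 := fun p => (List.ofFn fun i => σ i ^ p i).prod
  have hc₀ : ∀ p, c₀ p ∈ G := fun p => list_prod_mem fun z hz => by
    obtain ⟨i, rfl⟩ := (List.mem_ofFn' _ _).1 hz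
    exact zpow_mem (hσG i) _
  let Λ : (Fin (r + 2) → ℤ) → ℝ := fun p => ∏ i, (ν i * ((μ : ℝ) ^ m) ^ k i) ^ p i
  have hΛ : ∀ p, ((∏ i, l i ^ p i : ℝˣ) : ℝ) = Λ p := fun p => by simp [Λ, l]
  have hΛ0 : ∀ p, 0 < Λ p := fun p => hΛ p ▸ (list_prod_mem_germSubgroup hσ p).1
  obtain ⟨h, hh, ρ, hρ, hwin⟩ := hwindow
    (fun u => (∀ p : κ, ∀ i, σ i (c₀ p u) = c₀ (p.1 + Pi.single i 1) u) ∧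
      (∀ p : κ, ∀ i, (t ^ M i) (c₀ p u) = c₀ (p.1 + Pi.single 0 (M i)) u) ∧
      ∀ p : κ, (c₀ p u : ℝ) - β = Λ p * (u - β))
    (by
      refine .and (eventually_all.2 fun p => eventually_all.2 fun i => ?_)
        (.and (eventually_all.2 fun p => eventually_all.2 fun i => ?_)
          (eventually_all.2 fun p => ?_))
      · simpa only [zpow_one] using eventually_zpow_mul_list_prod_apply hσ p i 1
      · simpa only [hσ0] using eventually_zpow_mul_list_prod_apply hσ p 0 (M i)
      · rw [← hΛ]
        exact (list_prod_mem_germSubgroup hσ p).2.2)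
  let c : (Fin (r + 2) → ℤ) → 𝕀 ≃ₜ 𝕀 := fun p => c₀ p * h
  have hcG : ∀ p, c p ∈ G := fun p => mul_mem (hc₀ p) hh
  have hcσ : ∀ p ∈ κ, ∀ i, ∀ u ∈ J, σ i (c p u) = c (p + Pi.single i 1) u :=
    fun p hp i u hu => (hwin u hu).1.1 ⟨p, hp⟩ i
  have hct : ∀ p ∈ κ, ∀ i, ∀ u ∈ J, (t ^ M i) (c p u) = c (p + Pi.single 0 (M i)) u :=
    fun p hp i u hu => (hwin u hu).1.2.1 ⟨p, hp⟩ i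
  have hsep : ∀ p ∈ κ, ∀ q ∈ κ, Λ p * v < Λ q * w₀ → ∀ u ∈ J, ∀ u' ∈ J, c p u ≠ c q u' := by
    intro p hp q hq hpq u hu u' hu' heq
    have e1 : (c p u : ℝ) - β = Λ p * (h u - β) := (hwin u hu).1.2.2 ⟨p, hp⟩
    have e2 : (c q u' : ℝ) - β = Λ q * (h u' - β) := (hwin u' hu').1.2.2 ⟨q, hq⟩
    rw [heq, e2] at e1
    have b1 := mul_le_mul_of_nonneg_left (hwin u hu).2.2 (hΛ0 p).le
    have b2 := mul_le_mul_of_nonneg_left (hwin u' hu').2.1 (hΛ0 q).le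
    have b3 := mul_lt_mul_of_pos_left hpq hρ
    linarith
  have hdisj : ∀ p ∈ κ, ∀ q ∈ κ, p ≠ q → ∀ u ∈ J, ∀ u' ∈ J, c p u ≠ c q u' := by
    intro p hp q hq hpq u hu u' hu'
    rcases hm p hp q hq hpq with h' | h'
    · exact hsep p hp q hq h' u hu u' hu'
    · exact (hsep q hq p hp h' u' hu' u hu).symm
  -- the twisting element
  let z : 𝕀 ≃ₜ 𝕀 :=
    ((Finset.univ : Finset κ).toList.map fun q : κ => c q * f q * (c q)⁻¹).prod
  have hzG : z ∈ G := list_prod_mem fun b hb => by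
    obtain ⟨q, -, rfl⟩ := List.mem_map.1 hb
    exact mul_mem (mul_mem (hcG q) (hfG q)) (inv_mem (hcG q))
  have hz : ∀ q : κ, ∀ u ∈ J, z (c q u) = c q (f q u) := by
    intro q u hu
    refine (window_prod_apply (c := fun q : κ => c q) (fun q u hu => (hfJ q u).2 hu) ?_ _
      (Finset.nodup_toList _) q u hu).2 (by simp)
    intro q q' hqq u hu
    refine hsupp _ _ (apply_mem_orbitHull hG (inv_mem (hcG q))
      (apply_mem_orbitHull hG (hcG q') (hJO hu))) fun hmem => ?_
    exact hdisj q q.2 q' q'.2 (fun h => hqq (Subtype.ext h)) _ hmem u hu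
      (homeo_apply_inv_self _ _)
  refine ⟨fun i => σ i * if i = 0 then 1 else (t ^ M i)⁻¹ * z * t ^ M i, fun i => ?_, ?_, ?_⟩
  · refine mul_mem (hσG i) ?_
    split_ifs
    exacts [one_mem G, mul_mem (mul_mem (inv_mem (zpow_mem ht _)) hzG) (zpow_mem ht _)]
  · rw [← hs]
    exact le_closure_range_of_twist (i₁ := 1) (by simp) h0 h1 (by simp [k])
  intro w hw hwn
  classical
  let lab : Fin (r + 2) → (Fin (r + 2) → ℤ) → κ := fun i p =>
    if hp : p + Pi.single 0 (M i) ∈ κ then ⟨_, hp⟩ else ⟨0, hPκ hzero⟩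
  have hlab : ∀ i p, ∀ hp : p ∈ P, lab i p = ⟨p + Pi.single 0 (M i), hMκ i p hp⟩ :=
    fun i p hp => dif_pos (hMκ i p hp)
  obtain ⟨u, -, hne⟩ := exists_lift_apply_ne
    (e := fun i : Fin (r + 2) => (Pi.single i 1 : Fin (r + 2) → ℤ)) (i₀ := 0)
    (Pi.evalAddMonoidHom (fun _ => ℤ) 0) (by simp) (P := P)
    (a := fun i p => if i = 0 then 1 else FreeGroup.of (lab i p)) (lab := lab) (J := J)
    (y := fun i => σ i * if i = 0 then 1 else (t ^ M i)⁻¹ * z * t ^ M i) (c := c) (f := f)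
    (n := n) (w := w)
    (by simp) (by intro i p; split_ifs <;> simp) (by intro i hi p _; simp [hi])
    (by
      intro i _ p hp j _ q hq h
      rw [hlab i p hp, hlab j q hq, Subtype.mk.injEq] at h
      have h0 := congrFun h 0
      simp only [Pi.add_apply, Pi.single_eq_same, M] at h0
      obtain ⟨hij, -⟩ := mul_add_injOn (n := n) (N := N) (by omega) ⟨hp.1 0, hp.2 0⟩
        ⟨hq.1 0, hq.2 0⟩
        (by linarith : ((i : ℕ) : ℤ) * N + p 0 = ((j : ℕ) : ℤ) * N + q 0)
      obtain rfl : i = j := Fin.ext (by exact_mod_cast hij)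
      exact ⟨rfl, add_right_cancel h⟩)
    ⟨g₁ x, le_rfl, h12⟩ hfJ
    (by
      intro i p hp _ u hu
      rw [homeo_mul_apply]
      split_ifs with hi
      · rw [map_one]
        exact hcσ p (hPκ hp) i u hu
      · rw [FreeGroup.lift_apply_of, hlab i p hp]
        set q : κ := ⟨p + Pi.single 0 (M i), hMκ i p hp⟩
        have hfu := (hfJ q u).2 hu
        have e1 : (t ^ M i) (c p u) = c q u := hct p (hPκ hp) i u hu
        have e2 : (t ^ M i) (c p (f q u)) = c q (f q u) := hct p (hPκ hp) i _ hfu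
        change σ i ((t ^ M i)⁻¹ (z ((t ^ M i) (c p u)))) = _
        rw [e1, hz q u hu, ← e2, homeo_inv_apply_self]
        exact hcσ p (hPκ hp) i _ hfu)
    (fun p hp hp0 => hdisj p (hPκ hp) 0 (hPκ hzero) hp0)
    (by
      intro b hb
      have habs : ∀ j, |wordPos (fun i : Fin (r + 2) => (Pi.single i 1 : Fin (r + 2) → ℤ)) b j|
          ≤ n := fun j => by
        refine (abs_wordPos_le (Pi.evalAddMonoidHom (fun _ => ℤ) j) (fun i => ?_) b).trans
          (by exact_mod_cast hb)
        rcases eq_or_ne i j with rfl | hij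
        · simp
        · simp [hij.symm]
      exact ⟨fun j => (abs_le.1 (habs j)).1, fun j => (abs_le.1 (habs j)).2⟩)
    hw hwn
    (by
      intro b hb hbn
      obtain ⟨u, hu, hne⟩ := hfw b hb (hbn.trans (List.countP_le_length.trans hwn))
      refine ⟨u, ?_, hne⟩
      by_contra huJ
      exact hne (lift_apply_eq_self (fun k =>
        hsupp k u (orbitHull_mono (commutator_le_self G) hu) huJ) b))
  intro h1
  rw [h1] at hne
  exact hne rfl

theorem map_subtype_derivedSeries (G : Subgroup (𝕀 ≃ₜ 𝕀)) (m : ℕ) :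
    (derivedSeries G m).map G.subtype = (fun K : Subgroup (𝕀 ≃ₜ 𝕀) => ⁅K, K⁆)^[m] G := by
  induction m with
  | zero =>
    rw [derivedSeries_zero, ← MonoidHom.range_eq_map, Subgroup.range_subtype]
    rfl
  | succ m ih =>
    rw [derivedSeries_succ, Subgroup.map_commutator, ih, Function.iterate_succ_apply']

end Generators

end PLoGirth

/-- Girth Alternative for `PL_o(I)`: any finitely generated subgroup of `PL_o(I)`
is either solvable or has infinite girth. -/
theorem girth_alternative_PLo (Γ : Subgroup (unitInterval ≃ₜ unitInterval))
    (hPL : ∀ g ∈ Γ, IsPLo g) (hfg : Group.FG Γ) :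
    IsSolvable Γ ∨ HasInfiniteGirth Γ := by
  refine or_iff_not_imp_left.2 fun hsol n => ?_
  obtain ⟨x, hx⟩ : ∃ x, ∃ h ∈ (fun K : Subgroup (unitInterval ≃ₜ unitInterval) => ⁅K, K⁆)^[n + 1] Γ,
      h x ≠ x := by
    by_contra! hall
    refine hsol ⟨n + 1, ?_⟩
    rw [← Subgroup.map_eq_bot_iff_of_injective _ Γ.subtype_injective,
      PLoGirth.map_subtype_derivedSeries, eq_bot_iff]
    intro h hh
    exact Subgroup.mem_bot.2 (Homeomorph.ext fun x => hall x h hh)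
  obtain ⟨S, hS, hSfin⟩ := (Subgroup.fg_iff Γ).1 ((Group.fg_iff_subgroup_fg Γ).1 hfg)
  obtain ⟨r, g, rfl⟩ := hSfin.fin_embedding
  obtain ⟨y, hyΓ, hgen, hy⟩ := PLoGirth.exists_generators_without_short_relations n Γ hPL x hx
    (s := Fin.cons 1 (Fin.cons 1 g)) (by simp [Fin.range_cons, hS]) rfl rfl
  refine ⟨r + 2, fun i => ⟨y i, hyΓ i⟩, ?_, fun w hw hwn h => hy w hw hwn ?_⟩
  · refine Subgroup.map_injective Γ.subtype_injective (le_antisymm (Subgroup.map_mono le_top) ?_)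
    rw [MonoidHom.map_closure, ← Set.range_comp, ← MonoidHom.range_eq_map, Subgroup.range_subtype]
    exact hgen
  · have hcomp : (FreeGroup.lift y : FreeGroup (Fin (r + 2)) →* _) =
        Γ.subtype.comp (FreeGroup.lift fun i => ⟨y i, hyΓ i⟩) := by
      ext1 i
      simp
    rw [hcomp, MonoidHom.comp_apply, h, map_one]
end

section
/- Every virtually solvable subgroup of PL_o(I) is solvable. -/
open Filter Topology
open scoped commutatorElement

/-- The derived series of a subgroup, formed inside the ambient group. -/
def Subgroup.innerDerivedSeries {G : Type*} [Group G] : ℕ → Subgroup G → Subgroup G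
  | 0, H => H
  | n + 1, H => Subgroup.innerDerivedSeries n ⁅H, H⁆

namespace Subgroup

variable {G : Type*} [Group G]

theorem innerDerivedSeries_succ (n : ℕ) (H : Subgroup G) :
    innerDerivedSeries (n + 1) H = ⁅innerDerivedSeries n H, innerDerivedSeries n H⁆ := by
  induction n generalizing H with
  | zero => rfl
  | succ n ih => exact ih ⁅H, H⁆

theorem innerDerivedSeries_mono (n : ℕ) {H K : Subgroup G} (h : H ≤ K) :
    innerDerivedSeries n H ≤ innerDerivedSeries n K := by
  induction n generalizing H K with
  | zero => exact h
  | succ n ih => exact ih (commutator_mono h h)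

theorem map_derivedSeries_eq_innerDerivedSeries {G' : Type*} [Group G'] (f : G' →* G) (n : ℕ) :
    (derivedSeries G' n).map f = innerDerivedSeries n f.range := by
  induction n with
  | zero => exact f.range_eq_map.symm
  | succ n ih => rw [derivedSeries_succ, map_commutator, ih, innerDerivedSeries_succ]

theorem innerDerivedSeries_range_eq_bot_iff {G' : Type*} [Group G'] {f : G' →* G}
    (hf : Function.Injective f) (n : ℕ) :
    innerDerivedSeries n f.range = ⊥ ↔ derivedSeries G' n = ⊥ := by
  rw [← map_derivedSeries_eq_innerDerivedSeries, map_eq_bot_iff_of_injective _ hf]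

end Subgroup

open Subgroup

local notation "I" => unitInterval

namespace PLo

theorem mul_apply (f g : I ≃ₜ I) (x : I) : (f * g) x = f (g x) := rfl

theorem inv_apply_self (f : I ≃ₜ I) (x : I) : f⁻¹ (f x) = x := f.symm_apply_apply x

theorem apply_inv_self (f : I ≃ₜ I) (x : I) : f (f⁻¹ x) = x := f.apply_symm_apply x

theorem lt_pow_apply {g : I ≃ₜ I} (hg : Monotone g) {x : I} (hx : x < g x) (k : ℕ) :
    x < (g ^ (k + 1)) x := by
  induction k with
  | zero => simpa using hx
  | succ k ih =>
    rw [pow_succ']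
    exact hx.trans_le (hg ih.le)

theorem pow_apply_lt {g : I ≃ₜ I} (hg : Monotone g) {x : I} (hx : g x < x) (k : ℕ) :
    (g ^ (k + 1)) x < x := by
  induction k with
  | zero => simpa using hx
  | succ k ih =>
    rw [pow_succ']
    exact (hg ih.le).trans_lt hx

theorem apply_eq_of_pow_apply_eq {g : I ≃ₜ I} (hg : Monotone g) {x : I} {k : ℕ} (hk : 0 < k)
    (hx : (g ^ k) x = x) : g x = x := by
  obtain ⟨k, rfl⟩ := Nat.exists_eq_succ_of_ne_zero hk.ne'
  rcases lt_trichotomy (g x) x with h | h | h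
  · exact absurd hx (pow_apply_lt hg h k).ne
  · exact h
  · exact absurd hx (lt_pow_apply hg h k).ne'

theorem exists_right_slope {g : I ≃ₜ I} (hg : IsPLo g) {p : I} (hp : g p = p) :
    ∃ a : ℝ, ∀ᶠ y in 𝓝[≥] p, (g y : ℝ) = p + a * (y - p) := by
  obtain ⟨-, n, x, h0, hn, -, hlin⟩ := hg
  by_cases hp1 : (p : ℝ) < 1
  · have hex : ∃ i, (p : ℝ) < x i := ⟨n, hn ▸ hp1⟩
    classical
    have hspec := Nat.find_spec hex
    have hmin : ∀ m < Nat.find hex, ¬ (p : ℝ) < x m := fun m hm => Nat.find_min hex hm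
    have hle : Nat.find hex ≤ n := Nat.find_min' hex (hn ▸ hp1)
    generalize Nat.find hex = j at hspec hmin hle
    obtain _ | i := j
    · exact absurd p.2.1 (by linarith)
    obtain ⟨a, b, hab⟩ := hlin i (by omega)
    have hi : x i ≤ p := not_lt.1 (hmin i (by omega))
    refine ⟨a, ?_⟩
    have hev : ∀ᶠ y : I in 𝓝[≥] p, (y : ℝ) < x (i + 1) :=
      nhdsWithin_le_nhds (continuous_subtype_val.continuousAt.eventually_lt_const hspec)
    filter_upwards [hev, self_mem_nhdsWithin] with y hy hpy
    have hpy' : (p : ℝ) ≤ y := hpy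
    have h1 := hab y ⟨hi.trans hpy', hy.le⟩
    have h2 := hab p ⟨hi, hspec.le⟩
    rw [hp] at h2
    linarith
  · refine ⟨0, ?_⟩
    filter_upwards [self_mem_nhdsWithin] with y hpy
    have hpy' : (p : ℝ) ≤ y := hpy
    have : y = p := Subtype.ext (by linarith [y.2.2])
    simp [this, hp]

theorem tendsto_nhdsGE {g : I ≃ₜ I} (hg : Monotone g) {p : I} (hp : g p = p) :
    Tendsto g (𝓝[≥] p) (𝓝[≥] p) := by
  have h : Tendsto g (𝓝[≥] p) (𝓝[≥] (g p)) :=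
    g.continuous.continuousWithinAt.tendsto_nhdsWithin fun y hy => hg hy
  rwa [hp] at h

theorem eventually_commute {g h : I ≃ₜ I} (hg : IsPLo g) (hh : IsPLo h) {p : I}
    (hgp : g p = p) (hhp : h p = p) : ∀ᶠ y in 𝓝[≥] p, g (h y) = h (g y) := by
  obtain ⟨a, ha⟩ := exists_right_slope hg hgp
  obtain ⟨b, hb⟩ := exists_right_slope hh hhp
  filter_upwards [ha, hb, (tendsto_nhdsGE hh.1 hhp).eventually ha,
    (tendsto_nhdsGE hg.1 hgp).eventually hb] with y h1 h2 h3 h4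
  apply Subtype.ext
  rw [h3, h4, h1, h2]
  ring

/-- The homeomorphisms that are the identity on a right neighbourhood of every point of `F`. -/
def trivialRightGerms (F : Set I) : Subgroup (I ≃ₜ I) where
  carrier := {g | ∀ p ∈ F, ∀ᶠ y in 𝓝[≥] p, g y = y}
  one_mem' _ _ := Eventually.of_forall fun _ => rfl
  mul_mem' {g h} hg hh p hp := by
    filter_upwards [hg p hp, hh p hp] with y h1 h2
    rw [mul_apply, h2, h1]
  inv_mem' {g} hg p hp := by
    filter_upwards [hg p hp] with y hy
    conv_lhs => rw [← hy]
    exact inv_apply_self g y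

theorem commutator_le_trivialRightGerms {G : Subgroup (I ≃ₜ I)} (hG : ∀ g ∈ G, IsPLo g)
    {F : Set I} (hF : ∀ g ∈ G, ∀ p ∈ F, g p = p) : ⁅G, G⁆ ≤ trivialRightGerms F := by
  rw [commutator_le]
  intro g hg h hh p hp
  have hmem : g⁻¹ * h⁻¹ ∈ G := G.mul_mem (G.inv_mem hg) (G.inv_mem hh)
  have key := (tendsto_nhdsGE (hG _ hmem).1 (hF _ hmem p hp)).eventually
    (eventually_commute (hG g hg) (hG h hh) (hF g hg p hp) (hF h hh p hp))
  filter_upwards [key] with y hy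
  rw [commutatorElement_def, mul_assoc, mul_apply, mul_apply, hy, mul_apply, apply_inv_self,
    apply_inv_self]

/-- Every element of `L` agrees on each proper initial part of `C` with some element of `M`. -/
def InitiallyApproximates (C : Set I) (L M : Subgroup (I ≃ₜ I)) : Prop :=
  ∀ k ∈ L, ∀ d ∈ C, ∃ k' ∈ M, ∀ y ∈ C, y ≤ d → k' y = k y

theorem InitiallyApproximates.commutator {C : Set I} {L M : Subgroup (I ≃ₜ I)}
    (hLM : InitiallyApproximates C L M) (hmono : ∀ g ∈ L, Monotone g)
    (hC : ∀ g ∈ L, ∀ y ∈ C, g y ∈ C) : InitiallyApproximates C ⁅L, L⁆ ⁅M, M⁆ := by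
  have hinv : ∀ k ∈ L, ∀ k' : I ≃ₜ I, ∀ d, (∀ y ∈ C, y ≤ k⁻¹ d → k' y = k y) →
      ∀ y ∈ C, y ≤ d → k'⁻¹ y = k⁻¹ y := by
    intro k hk k' d h y hy hyd
    have := h (k⁻¹ y) (hC _ (L.inv_mem hk) y hy) (hmono _ (L.inv_mem hk) hyd)
    rw [apply_inv_self] at this
    conv_lhs => rw [← this]
    exact inv_apply_self _ _
  have hmax : ∀ a ∈ C, ∀ b ∈ C, max a b ∈ C := fun a ha b hb => max_rec' (· ∈ C) ha hb
  intro k hk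
  rw [Subgroup.commutator_def] at hk
  have hle : closure {g | ∃ g₁ ∈ L, ∃ g₂ ∈ L, ⁅g₁, g₂⁆ = g} ≤ L :=
    (Subgroup.commutator_def L L).symm.le.trans L.commutator_le_self
  induction hk using closure_induction with
  | mem k hk =>
    obtain ⟨g, hg, h, hh, rfl⟩ := hk
    intro d hd
    have hg' := L.inv_mem hg
    have hh' := L.inv_mem hh
    have d1 := hC _ hh' d hd
    have d2 := hC _ hg' _ d1
    have d3 := hC _ hh _ d2
    set e := max (max d (h⁻¹ d)) (max (g⁻¹ (h⁻¹ d)) (h (g⁻¹ (h⁻¹ d)))) with he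
    have heC : e ∈ C := hmax _ (hmax _ hd _ d1) _ (hmax _ d2 _ d3)
    obtain ⟨g', hgM, hgg⟩ := hLM g hg e heC
    obtain ⟨h', hhM, hhh⟩ := hLM h hh e heC
    refine ⟨⁅g', h'⁆, commutator_mem_commutator hgM hhM, fun y hy hyd => ?_⟩
    simp only [commutatorElement_def, mul_apply]
    have y1 := hC _ hh' y hy
    have l1 := hmono _ hh' hyd
    have y2 := hC _ hg' _ y1
    have l2 := hmono _ hg' l1
    have y3 := hC _ hh _ y2
    have l3 := hmono _ hh l2
    rw [hinv h hh h' d (fun z hz hzd => hhh z hz (hzd.trans (by simp [he]))) y hy hyd,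
      hinv g hg g' (h⁻¹ d) (fun z hz hzd => hgg z hz (hzd.trans (by simp [he]))) _ y1 l1,
      hhh _ y2 (l2.trans (by simp [he])), hgg _ y3 (l3.trans (by simp [he]))]
  | one => exact fun d _ => ⟨1, one_mem _, fun _ _ _ => rfl⟩
  | mul g h hg hh ihg ihh =>
    intro d hd
    obtain ⟨h', hhM, hhh⟩ := ihh d hd
    obtain ⟨g', hgM, hgg⟩ := ihg _ (hC h (hle hh) d hd)
    refine ⟨g' * h', mul_mem hgM hhM, fun y hy hyd => ?_⟩
    rw [mul_apply, hhh y hy hyd, hgg _ (hC h (hle hh) y hy) (hmono h (hle hh) hyd), mul_apply]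
  | inv g hg ih =>
    intro d hd
    obtain ⟨g', hgM, hgg⟩ := ih _ (hC _ (L.inv_mem (hle hg)) d hd)
    exact ⟨g'⁻¹, inv_mem hgM, hinv g (hle hg) g' d hgg⟩

theorem InitiallyApproximates.innerDerivedSeries {C : Set I} (n : ℕ) {L M : Subgroup (I ≃ₜ I)}
    (hLM : InitiallyApproximates C L M) (hmono : ∀ g ∈ L, Monotone g)
    (hC : ∀ g ∈ L, ∀ y ∈ C, g y ∈ C) :
    InitiallyApproximates C (innerDerivedSeries n L) (innerDerivedSeries n M) := by
  induction n generalizing L M with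
  | zero => exact hLM
  | succ n ih =>
    exact ih (hLM.commutator hmono hC) (fun g hg => hmono g (L.commutator_le_self hg))
      fun g hg => hC g (L.commutator_le_self hg)

/-- The points squeezed between two points of the `H`-orbit of `x`. -/
def orbitHull (H : Subgroup (I ≃ₜ I)) (x : I) : Set I :=
  {y | (∃ g ∈ H, g x ≤ y) ∧ ∃ g ∈ H, y ≤ g x}

theorem self_mem_orbitHull (H : Subgroup (I ≃ₜ I)) (x : I) : x ∈ orbitHull H x :=
  ⟨⟨1, one_mem H, le_rfl⟩, ⟨1, one_mem H, le_rfl⟩⟩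

theorem apply_mem_orbitHull {H : Subgroup (I ≃ₜ I)} (hmono : ∀ g ∈ H, Monotone g) {x : I}
    {g : I ≃ₜ I} (hg : g ∈ H) {y : I} (hy : y ∈ orbitHull H x) : g y ∈ orbitHull H x := by
  obtain ⟨⟨a, ha, hay⟩, b, hb, hyb⟩ := hy
  exact ⟨⟨g * a, mul_mem hg ha, hmono g hg hay⟩, g * b, mul_mem hg hb, hmono g hg hyb⟩

theorem exists_forall_le_apply_eq {H : Subgroup (I ≃ₜ I)} (hmono : ∀ g ∈ H, Monotone g) (x : I)
    {k : I ≃ₜ I} (hk : k ∈ trivialRightGerms {p | ∀ h ∈ H, h p = p}) :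
    ∃ g ∈ H, ∀ y ∈ orbitHull H x, y ≤ g x → k y = y := by
  set S : Set I := {z | ∃ g ∈ H, g x = z} with hS
  have hglb : IsGLB S (sInf S) := isGLB_sInf S
  have hle : ∀ h ∈ H, sInf S ≤ h (sInf S) := by
    intro h hh
    have : h⁻¹ (sInf S) ∈ lowerBounds S := by
      rintro _ ⟨g, hg, rfl⟩
      have h1 := hmono _ (inv_mem hh) (hglb.1 ⟨h * g, mul_mem hh hg, rfl⟩)
      rwa [mul_apply, inv_apply_self] at h1
    have h2 := hmono h hh (hglb.2 this)
    rwa [apply_inv_self] at h2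
  have hfix : sInf S ∈ {p | ∀ h ∈ H, h p = p} := by
    intro h hh
    refine le_antisymm ?_ (hle h hh)
    have h2 := hmono h hh (hle _ (inv_mem hh))
    rwa [apply_inv_self] at h2
  have hlow : ∀ y ∈ orbitHull H x, sInf S ≤ y := by
    rintro y ⟨⟨g, hg, hgy⟩, -⟩
    exact (hglb.1 ⟨g, hg, rfl⟩).trans hgy
  have hev := hk _ hfix
  rcases (hlow x (self_mem_orbitHull H x)).eq_or_lt with heq | hlt
  · refine ⟨1, one_mem H, fun y hy hyx => ?_⟩
    have hyx' : y = sInf S := le_antisymm (hyx.trans heq.ge) (hlow y hy)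
    rw [hyx']
    exact hev.self_of_nhdsWithin Set.self_mem_Ici
  · obtain ⟨u, hu, hsub⟩ := (mem_nhdsGE_iff_exists_mem_Ioc_Ico_subset hlt).1 hev
    obtain ⟨_, ⟨g, hg, rfl⟩, -, hgu⟩ := hglb.exists_between hu.1
    exact ⟨g, hg, fun y hy hyg => hsub ⟨hlow y hy, hyg.trans_lt hgu⟩⟩

theorem initiallyApproximates_commutator {H : Subgroup (I ≃ₜ I)}
    (hmono : ∀ g ∈ H, Monotone g) (x : I) :
    InitiallyApproximates (orbitHull H x)
      (H ⊓ trivialRightGerms {p | ∀ h ∈ H, h p = p}) ⁅H, H⁆ := by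
  rintro k ⟨hkH, hk⟩ d ⟨-, b, hb, hdb⟩
  obtain ⟨g, hg, hfix⟩ := exists_forall_le_apply_eq hmono x (inv_mem hk)
  have hh : b * g⁻¹ ∈ H := mul_mem hb (inv_mem hg)
  refine ⟨⁅k, b * g⁻¹⁆, commutator_mem_commutator hkH hh, fun y hy hyd => ?_⟩
  have hle : (b * g⁻¹)⁻¹ y ≤ g x := by
    have h1 := hmono _ (inv_mem hh) (hyd.trans hdb)
    rwa [mul_inv_rev, inv_inv, mul_apply g b⁻¹ (b x), inv_apply_self, ← inv_inv g, ← mul_inv_rev,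
      inv_inv] at h1
  rw [commutatorElement_def, mul_apply, mul_assoc, mul_apply, mul_apply,
    hfix _ (apply_mem_orbitHull hmono (inv_mem hh) hy) hle, apply_inv_self]

theorem innerDerivedSeries_inf_trivialRightGerms_eq_bot {H : Subgroup (I ≃ₜ I)}
    (hmono : ∀ g ∈ H, Monotone g) {n : ℕ} (hn : innerDerivedSeries (n + 1) H = ⊥) :
    innerDerivedSeries n (H ⊓ trivialRightGerms {p | ∀ h ∈ H, h p = p}) = ⊥ := by
  rw [eq_bot_iff]
  intro k hk
  rw [Subgroup.mem_bot]
  ext1 x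
  obtain ⟨k', hk', h⟩ := (initiallyApproximates_commutator hmono x).innerDerivedSeries n
    (fun g hg => hmono g hg.1) (fun g hg _ hy => apply_mem_orbitHull hmono hg.1 hy)
    k hk x (self_mem_orbitHull H x)
  have hk1 : k' = 1 := Subgroup.mem_bot.1 (hn ▸ hk')
  rw [← h x (self_mem_orbitHull H x) le_rfl, hk1]

theorem innerDerivedSeries_eq_bot_of_pow_mem (n : ℕ) {G H : Subgroup (I ≃ₜ I)} (hHG : H ≤ G)
    (hG : ∀ g ∈ G, IsPLo g) (hpow : ∀ g ∈ G, ∃ k, 0 < k ∧ g ^ k ∈ H)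
    (hH : innerDerivedSeries n H = ⊥) : innerDerivedSeries n G = ⊥ := by
  induction n generalizing G H with
  | zero =>
    rw [eq_bot_iff]
    intro g hg
    obtain ⟨k, hk, hgk⟩ := hpow g hg
    have h1 : g ^ k = 1 := Subgroup.mem_bot.1 (hH ▸ hgk)
    rw [Subgroup.mem_bot]
    ext1 x
    exact apply_eq_of_pow_apply_eq (hG g hg).1 hk (by rw [h1]; rfl)
  | succ n ih =>
    set F : Set I := {p | ∀ h ∈ H, h p = p}
    have hF : ∀ g ∈ G, ∀ p ∈ F, g p = p := by
      intro g hg p hp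
      obtain ⟨k, hk, hgk⟩ := hpow g hg
      exact apply_eq_of_pow_apply_eq (hG g hg).1 hk (hp _ hgk)
    have hbot : innerDerivedSeries n (G ⊓ trivialRightGerms F) = ⊥ := by
      refine ih (H := H ⊓ trivialRightGerms F) (inf_le_inf_right _ hHG) (fun g hg => hG g hg.1) ?_
        (innerDerivedSeries_inf_trivialRightGerms_eq_bot (fun g hg => (hG g (hHG hg)).1) hH)
      rintro g ⟨hg, hgF⟩
      obtain ⟨k, hk, hgk⟩ := hpow g hg
      exact ⟨k, hk, hgk, pow_mem hgF k⟩
    exact eq_bot_mono (innerDerivedSeries_mono n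
      (le_inf G.commutator_le_self (commutator_le_trivialRightGerms hG hF))) hbot

end PLo

/-- Every virtually solvable subgroup of `PL_o(I)` is solvable. -/
theorem solvable_of_virtuallySolvable_PLo (Γ : Subgroup (unitInterval ≃ₜ unitInterval))
    (hPL : ∀ g ∈ Γ, IsPLo g)
    (hvs : ∃ H : Subgroup Γ, IsSolvable H ∧ H.index ≠ 0) :
    IsSolvable Γ := by
  obtain ⟨H, hH, hindex⟩ := hvs
  obtain ⟨n, hn⟩ := (Group.isSolvable_def H).1 hH
  have hHn := (innerDerivedSeries_range_eq_bot_iff (f := Γ.subtype.comp H.subtype)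
    (Γ.subtype_injective.comp H.subtype_injective) n).2 hn
  refine (Group.isSolvable_def Γ).2
    ⟨n, (innerDerivedSeries_range_eq_bot_iff Γ.subtype_injective n).1 ?_⟩
  rw [Γ.range_subtype]
  refine PLo.innerDerivedSeries_eq_bot_of_pow_mem n ?_ hPL ?_ hHn
  · rintro _ ⟨h, rfl⟩
    exact h.1.2
  · intro g hg
    obtain ⟨k, hk, -, hgk⟩ := H.exists_pow_mem_of_index_ne_zero hindex ⟨g, hg⟩
    exact ⟨k, hk, ⟨_, hgk⟩, rfl⟩
end

section
/- Thompson's group F has infinite girth. -/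
/-- `f` belongs to Thompson's group `F`: an orientation-preserving piecewise-linear
homeomorphism of `[0,1]` whose breakpoints are dyadic rationals and whose slopes
are integer powers of `2`. -/
def IsThompsonF (f : unitInterval ≃ₜ unitInterval) : Prop :=
  Monotone (⇑f : unitInterval → unitInterval) ∧
  ∃ (n : ℕ) (x : ℕ → ℝ), x 0 = 0 ∧ x n = 1 ∧ (∀ i < n, x i < x (i + 1)) ∧
    (∀ i ≤ n, ∃ (a : ℤ) (k : ℕ), x i = (a : ℝ) / 2 ^ k) ∧
    ∀ i < n, ∃ (m : ℤ) (b : ℝ), ∀ t : unitInterval,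
      (t : ℝ) ∈ Set.Icc (x i) (x (i + 1)) → ((f t : ℝ)) = (2 : ℝ) ^ m * (t : ℝ) + b

section Escape

open Pointwise

variable {G X : Type*} [Group G] [MulAction G X]

/-- A word `w` in one variable with coefficients in `G` escapes: any `h₀` can be changed outside
a given finite set to some `h` for which `w h` takes a point `x` to a point `y`, a fact which only
depends on the values of `h` on a finite set `D`. The propositions `p`, `m`, `z`, `n` govern which
of the conditions `y ∉ D`, `y ∉ h • D`, `a • y ∉ D ∪ h • D ∪ {x}` for all `a ∈ A`, and `y ≠ x`
are imposed. -/
def Escapes (X : Type*) [MulAction G X] (A : Set G) (w : G → G) (p m z n : Prop) : Prop :=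
  ∀ (h₀ : G) (P : Set X), P.Finite → ∃ (h : G) (D : Set X) (x y : X), D.Finite ∧ P ⊆ D ∧
    (∀ q ∈ P, h • q = h₀ • q) ∧
    (∀ h' : G, (∀ q ∈ D, h' • q = h • q) → w h' • x = y) ∧
    (p → y ∉ D) ∧ (m → y ∉ h • D) ∧
    (z → ∀ a ∈ A, a • y ∉ D ∧ a • y ∉ h • D ∧ a • y ≠ x) ∧ (n → y ≠ x)

/-- Every point off a finite set can be moved out of any other finite set by an element which
fixes the first one pointwise. -/
def MovesFreely (G X : Type*) [Group G] [MulAction G X] : Prop :=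
  ∀ (P B : Set X) (y : X), P.Finite → B.Finite → y ∉ P →
    ∃ φ : G, (∀ q ∈ P, φ • q = q) ∧ φ • y ∉ B

namespace Escapes

variable {A : Set G} {w : G → G} {p m z n p' m' z' n' : Prop}

lemma mono (hw : Escapes X A w p m z n) (hp : p' → p) (hm : m' → m) (hz : z' → z)
    (hn : n' → n) : Escapes X A w p' m' z' n' := by
  intro h₀ P hP
  obtain ⟨h, D, x, y, h1, h2, h3, h4, h5, h6, h7, h8⟩ := hw h₀ P hP
  exact ⟨h, D, x, y, h1, h2, h3, h4, fun t => h5 (hp t), fun t => h6 (hm t),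
    fun t => h7 (hz t), fun t => h8 (hn t)⟩

lemma one [Infinite X] (hA : A.Finite) (hfree : ∀ a ∈ A, ∀ x : X, a • x ≠ x) :
    Escapes X A (fun _ => 1) True True True False := by
  intro h₀ P hP
  have hE : (P ∪ h₀ • P).Finite := hP.union hP.smul_set
  obtain ⟨x, hx⟩ := (hE.union (hA.inv.smul hE)).exists_notMem
  have hx' : ∀ a ∈ A, a • x ∉ P ∪ h₀ • P := fun a ha h =>
    hx (Or.inr ⟨a⁻¹, Set.inv_mem_inv.2 ha, a • x, h, inv_smul_smul a x⟩)
  refine ⟨h₀, P, x, x, hP, subset_rfl, fun _ _ => rfl, fun _ _ => one_smul G x,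
    fun _ h => hx (Or.inl (Or.inl h)), fun _ h => hx (Or.inl (Or.inr h)), fun _ a ha =>
    ⟨fun h => hx' a ha (Or.inl h), fun h => hx' a ha (Or.inr h), hfree a ha x⟩, False.elim⟩

lemma coeff_mul (hw : Escapes X A w p m True n) {a : G} (ha : a ∈ A) :
    Escapes X A (fun h => a * w h) True True False True := by
  intro h₀ P hP
  obtain ⟨h, D, x, y, h1, h2, h3, h4, h5, h6, h7, h8⟩ := hw h₀ P hP
  obtain ⟨h7, h7', h7''⟩ := h7 trivial a ha
  exact ⟨h, D, x, a • y, h1, h2, h3, fun h' hh => by rw [mul_smul, h4 h' hh],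
    fun _ => h7, fun _ => h7', False.elim, fun _ => h7''⟩

lemma var_mul (hG : MovesFreely G X) (hA : A.Finite) (hfree : ∀ a ∈ A, ∀ x : X, a • x ≠ x)
    (hw : Escapes X A w True m z n) :
    Escapes X A (fun h => h * w h) True False True True := by
  intro h₀ P hP
  obtain ⟨h, D, x, y, h1, h2, h3, h4, h5, h6, h7, h8⟩ := hw h₀ P hP
  have hE : (insert x (insert y (D ∪ h • D))).Finite :=
    ((h1.union h1.smul_set).insert y).insert x
  obtain ⟨φ, hφ, hφy⟩ := hG (h • D) _ (h • y) h1.smul_set (hE.union (hA.inv.smul hE))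
    (by rw [Set.smul_mem_smul_set_iff]; exact h5 trivial)
  have hD : ∀ q ∈ D, (φ * h) • q = h • q := fun q hq => by
    rw [mul_smul]; exact hφ _ (Set.smul_mem_smul_set hq)
  rw [← mul_smul] at hφy
  set k := φ * h with hk
  have hy : ∀ a ∈ A, a • k • y ∉ insert x (insert y (D ∪ h • D)) := fun a ha hh =>
    hφy (Or.inr ⟨a⁻¹, Set.inv_mem_inv.2 ha, a • k • y, hh, inv_smul_smul a _⟩)
  refine ⟨k, insert y D, x, k • y, h1.insert y, h2.trans (Set.subset_insert _ _),
    fun q hq => (hD q (h2 hq)).trans (h3 q hq), fun h' hh => ?_, fun _ hh => hφy (Or.inl ?_),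
    False.elim, fun _ a ha => ⟨fun hh => hy a ha ?_, ?_, fun hh => hy a ha (Or.inl hh)⟩,
    fun _ hh => hφy (Or.inl (Or.inl hh))⟩
  · rw [mul_smul, h4 h' fun q hq => (hh q (Or.inr hq)).trans (hD q hq)]
    exact hh y (Or.inl rfl)
  · exact Or.inr (hh.imp id Or.inl)
  · exact Or.inr (hh.imp id Or.inl)
  · rintro ⟨q, rfl | hq, hh⟩
    · exact hfree a ha _ hh.symm
    · refine hy a ha (Or.inr (Or.inr (Or.inr ?_)))
      rw [← hh]
      exact ⟨q, hq, (hD q hq).symm⟩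

lemma var_inv_mul (hG : MovesFreely G X) (hA : A.Finite)
    (hfree : ∀ a ∈ A, ∀ x : X, a • x ≠ x) (hw : Escapes X A w p True z n) :
    Escapes X A (fun h => h⁻¹ * w h) False True True True := by
  intro h₀ P hP
  obtain ⟨h, D, x, y, h1, h2, h3, h4, h5, h6, h7, h8⟩ := hw h₀ P hP
  have hE : (insert x (insert y (D ∪ h • D))).Finite :=
    ((h1.union h1.smul_set).insert y).insert x
  obtain ⟨φ, hφ, hφy⟩ := hG D _ (h⁻¹ • y) h1 (hE.union (hA.inv.smul hE))
    (by rw [← Set.mem_smul_set_iff_inv_smul_mem]; exact h6 trivial)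
  set k := h * φ⁻¹ with hk
  have hD : ∀ q ∈ D, k • q = h • q := fun q hq => by
    rw [mul_smul, inv_smul_eq_iff.2 (hφ q hq).symm]
  have hky : φ • h⁻¹ • y = k⁻¹ • y := by simp [hk, mul_smul]
  rw [hky] at hφy
  have hy : ∀ a ∈ A, a • k⁻¹ • y ∉ insert x (insert y (D ∪ h • D)) := fun a ha hh =>
    hφy (Or.inr ⟨a⁻¹, Set.inv_mem_inv.2 ha, a • k⁻¹ • y, hh, inv_smul_smul a _⟩)
  have hkD : ∀ t, t ∈ k • insert (k⁻¹ • y) D → t ∈ insert x (insert y (D ∪ h • D)) := by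
    rintro t ⟨q, rfl | hq, rfl⟩
    · exact Or.inr (Or.inl (smul_inv_smul k y))
    · exact Or.inr (Or.inr (Or.inr ⟨q, hq, (hD q hq).symm⟩))
  refine ⟨k, insert (k⁻¹ • y) D, x, k⁻¹ • y, h1.insert _, h2.trans (Set.subset_insert _ _),
    fun q hq => (hD q (h2 hq)).trans (h3 q hq), fun h' hh => ?_, False.elim,
    fun _ hh => hφy (Or.inl (hkD _ hh)),
    fun _ a ha => ⟨?_, fun hh => hy a ha (hkD _ hh), fun hh => hy a ha (Or.inl hh)⟩,
    fun _ hh => hφy (Or.inl (Or.inl hh))⟩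
  · rw [mul_smul, h4 h' fun q hq => (hh q (Or.inr hq)).trans (hD q hq), inv_smul_eq_iff,
      hh _ (Or.inl rfl), smul_inv_smul]
  · rintro (hh | hh)
    · exact hfree a ha _ hh
    · exact hy a ha (Or.inr (Or.inr (Or.inl hh)))

lemma zpow_mul (hG : MovesFreely G X) (hA : A.Finite) (hfree : ∀ a ∈ A, ∀ x : X, a • x ≠ x)
    (hw : Escapes X A w True True z n) {e : ℤ} (he : e ≠ 0) :
    Escapes X A (fun h => h ^ e * w h) False False True True := by
  have hpos : ∀ k : ℕ, Escapes X A (fun h => h ^ (k + 1) * w h) True False True True := by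
    intro k
    induction k with
    | zero => simpa using hw.var_mul hG hA hfree
    | succ k ih => simpa only [pow_succ' _ (k + 1), mul_assoc] using ih.var_mul hG hA hfree
  have hneg : ∀ k : ℕ, Escapes X A (fun h => h⁻¹ ^ (k + 1) * w h) False True True True := by
    intro k
    induction k with
    | zero => simpa using hw.var_inv_mul hG hA hfree
    | succ k ih =>
      simpa only [pow_succ' _ (k + 1), mul_assoc] using ih.var_inv_mul hG hA hfree
  obtain ⟨k, hk | hk⟩ := e.eq_nat_or_neg
  all_goals
    obtain ⟨k, rfl⟩ := Nat.exists_eq_succ_of_ne_zero (show k ≠ 0 by omega)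
    subst hk
  · simpa only [zpow_natCast] using (hpos k).mono id id id id |>.mono False.elim id id id
  · simpa only [zpow_neg, zpow_natCast, inv_pow] using (hneg k).mono id False.elim id id

lemma exists_ne_one {W : Set (G → G)} (hW : W.Finite)
    (h : ∀ w ∈ W, Escapes X A w False False False True) : ∃ h : G, ∀ w ∈ W, w h ≠ 1 := by
  suffices ∃ (h : G) (D : Set X), D.Finite ∧ ∀ h' : G, (∀ q ∈ D, h' • q = h • q) →
      ∀ w ∈ W, w h' ≠ 1 by
    obtain ⟨h, D, -, hh⟩ := this
    exact ⟨h, hh h fun _ _ => rfl⟩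
  induction W, hW using Set.Finite.induction_on with
  | empty => exact ⟨1, ∅, Set.finite_empty, by simp⟩
  | @insert w W _ _ ih =>
    obtain ⟨h₀, P, hP, hh⟩ := ih fun w hw => h w (Or.inr hw)
    obtain ⟨h, D, x, y, h1, h2, h3, h4, -, -, -, h8⟩ := h w (Or.inl rfl) h₀ P hP
    refine ⟨h, D, h1, fun h' hq w' hw' => ?_⟩
    rcases hw' with rfl | hw'
    · intro h9
      have := h4 h' hq
      rw [h9, one_smul] at this
      exact h8 trivial this.symm
    · exact hh h' (fun q hqP => (hq q (h2 hqP)).trans (h3 q hqP)) w' hw'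

end Escapes

end Escape

section Girth

variable {G : Type*} [Group G] {k : ℕ}

/-- The tuple `(h, h ^ c₀ * g₀ * h ^ c₀, …)` with exponents `cᵢ = (i + 1) * N`. -/
def twist (N : ℤ) (g : Fin k → G) (h : G) : Fin (k + 1) → G :=
  Fin.cons h fun i => h ^ ((i + 1 : ℤ) * N) * g i * h ^ ((i + 1 : ℤ) * N)

lemma closure_range_twist (N : ℤ) {g : Fin k → G} (hg : Subgroup.closure (Set.range g) = ⊤)
    (h : G) : Subgroup.closure (Set.range (twist N g h)) = ⊤ := by
  have hmem : ∀ i, twist N g h i ∈ Subgroup.closure (Set.range (twist N g h)) := fun i =>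
    Subgroup.subset_closure ⟨i, rfl⟩
  rw [eq_top_iff, ← hg, Subgroup.closure_le]
  rintro _ ⟨i, rfl⟩
  have h0 : h ^ ((i + 1 : ℤ) * N) ∈ Subgroup.closure (Set.range (twist N g h)) :=
    Subgroup.zpow_mem _ (hmem 0) _
  have h1 := hmem i.succ
  simp only [twist, Fin.cons_succ] at h1 h0
  rwa [Subgroup.mul_mem_cancel_right _ h0, Subgroup.mul_mem_cancel_left _ h0] at h1

/-- The signed exponent which surrounds the letter `(i, b)` in `twist`. -/
def twistExp (N : ℤ) (l : Fin k × Bool) : ℤ := if l.2 then (l.1 + 1) * N else -((l.1 + 1) * N)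

/-- The coefficient of the letter `(i, b)`. -/
def coeff (g : Fin k → G) (l : Fin k × Bool) : G := if l.2 then g l.1 else (g l.1)⁻¹

lemma cond_twist_succ (N : ℤ) (g : Fin k → G) (h : G) (l : Fin k × Bool) :
    cond l.2 (twist N g h l.1.succ) (twist N g h l.1.succ)⁻¹ =
      h ^ twistExp N l * (coeff g l * h ^ twistExp N l) := by
  obtain ⟨i, _ | _⟩ := l <;> simp [twist, twistExp, coeff, mul_assoc]

lemma twistExp_add_ne_zero {N a : ℤ} (ha : |a| < N) {l l' : Fin k × Bool}
    (h : l.1 = l'.1 → l.2 ≠ l'.2 → a ≠ 0) : twistExp N l + (a + twistExp N l') ≠ 0 := by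
  obtain ⟨i, b⟩ := l
  obtain ⟨j, b'⟩ := l'
  rw [abs_lt] at ha
  have key : ∀ d : ℤ, a + d * N = 0 → d = 0 ∧ a = 0 := by
    intro d hd
    have : d = 0 := by
      by_contra hne
      rcases lt_or_gt_of_ne hne with h | h <;> nlinarith
    subst this
    exact ⟨rfl, by linarith⟩
  intro h0
  cases b <;> cases b' <;> simp only [twistExp, if_true, if_false, Bool.false_eq_true] at h0
  · have := (key (-(i + 1) - (j + 1)) (by linarith)).1
    omega
  · have := key (-(i + 1) + (j + 1)) (by linarith)
    exact h (Fin.ext (by simp only; omega)) (by simp) this.2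
  · have := key ((i + 1) - (j + 1)) (by linarith)
    exact h (Fin.ext (by simp only; omega)) (by simp) this.2
  · have := (key ((i + 1) + (j + 1)) (by linarith)).1
    omega

variable {X : Type*} [MulAction G X]

/-- The value of a list of letters at a tuple. -/
def evalList {m : ℕ} (s : Fin m → G) (L : List (Fin m × Bool)) : G :=
  (L.map fun x => cond x.2 (s x.1) (s x.1)⁻¹).prod

/-- The normal form of a word in the entries of `twist N g h`, as a word in `h` with coefficients. -/
lemma evalList_twist [Infinite X] {N : ℤ} {g : Fin k → G} {A : Set G}
    (hG : MovesFreely G X) (hA : A.Finite) (hfree : ∀ a ∈ A, ∀ x : X, a • x ≠ x)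
    (hgA : ∀ l, coeff g l ∈ A) (L : List (Fin (k + 1) × Bool)) (hL : FreeGroup.IsReduced L)
    (hN : (L.length : ℤ) < N) :
    ∃ a : ℤ, |a| ≤ L.length ∧ (∀ b ∈ L.head?, b.1 = 0 → 0 < if b.2 then a else -a) ∧
      (((∀ h, evalList (twist N g h) L = h ^ a) ∧ (L = [] → a = 0) ∧
          ∀ b ∈ L.head?, b.1 = 0) ∨
        ∃ (l : Fin k × Bool) (w : G → G), Escapes X A w True True False True ∧ L ≠ [] ∧
          (∀ h, evalList (twist N g h) L = h ^ (a + twistExp N l) * w h) ∧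
          ∀ l' : Fin k × Bool, (l'.1.succ, l'.2) ∈ L.head? → l' = l ∧ a = 0) := by
  induction L with
  | nil => exact ⟨0, by simp, by simp, Or.inl ⟨by simp [evalList], by simp, by simp⟩⟩
  | cons b L ih =>
    obtain ⟨a, ha, hpos, hcase⟩ := ih (List.IsChain.of_cons hL) (by simp at hN; omega)
    have hhead : ∀ b' ∈ L.head?, b.1 = b'.1 → b.2 = b'.2 := by
      cases L with
      | nil => simp
      | cons c L => simpa using (List.isChain_cons_cons.1 hL).1
    have heval : ∀ s : Fin (k + 1) → G,
      evalList s (b :: L) = cond b.2 (s b.1) (s b.1)⁻¹ * evalList s L := fun s => by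
        simp [evalList]
    obtain ⟨i, ε⟩ := b
    simp only [List.length_cons, Nat.cast_add, Nat.cast_one] at hN
    have ha' := abs_le.1 ha
    induction i using Fin.cases with
    | zero =>
      have hmul : ∀ h : G, cond ε h h⁻¹ = h ^ (if ε then (1 : ℤ) else -1) := fun h => by
        cases ε <;> simp
      have hpos' : 0 < if ε then a + (if ε then 1 else -1)
          else -(a + (if ε then 1 else -1)) := by
        suffices 0 ≤ if ε then a else -a by
          cases ε <;> simp at this ⊢ <;> omega
        rcases hcase with ⟨-, h2, h3⟩ | ⟨l, w, -, h2, -, h4⟩ <;> cases L with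
        | nil => simp_all
        | cons c L =>
          simp only [List.head?_cons, Option.mem_some_iff, forall_eq'] at *
          obtain ⟨c, δ⟩ := c
          induction c using Fin.cases with
          | zero => rw [hhead rfl]; exact (hpos rfl).le
          | succ c =>
            first
            | exact absurd h3 (Fin.succ_ne_zero c)
            | simp [(h4 (c, δ) rfl).2]
      refine ⟨a + (if ε then 1 else -1), ?_, by simpa using hpos', ?_⟩
      · rw [abs_le]
        push_cast [List.length_cons]
        split_ifs <;> omega
      rcases hcase with ⟨h1, -, -⟩ | ⟨l, w, hw, -, h3, -⟩
      · refine Or.inl ⟨fun h => ?_, by simp, by simp⟩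
        rw [heval, h1, add_comm a, zpow_add, ← hmul]
        rfl
      · refine Or.inr ⟨l, w, hw, by simp, fun h => ?_, fun l' hl' => ?_⟩
        · rw [heval, h3, add_comm a (ite _ _ _), add_assoc, zpow_add _ (ite _ _ _), ← hmul,
            mul_assoc]
          rfl
        · simp only [List.head?_cons, Option.mem_some_iff, Prod.mk.injEq] at hl'
          exact absurd hl'.1.symm (Fin.succ_ne_zero _)
    | succ j =>
      refine ⟨0, by simp; positivity, by simp, Or.inr ⟨(j, ε), fun h => coeff g (j, ε) *
        (h ^ twistExp N (j, ε) * evalList (twist N g h) L), ?_, by simp, fun h => ?_, ?_⟩⟩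
      · refine Escapes.coeff_mul (p := False) (m := False) (n := False) ?_ (hgA _)
        rcases hcase with ⟨h1, -, -⟩ | ⟨l, w, hw, h2, h3, h4⟩
        · simp only [h1, ← zpow_add]
          rcases eq_or_ne (twistExp N (j, ε) + a) 0 with h0 | h0
          · simpa [h0] using (Escapes.one hA hfree).mono
              (p' := False) (m' := False) (z' := True) (n' := False) False.elim False.elim id id
          · simpa using ((Escapes.one hA hfree).zpow_mul hG hA hfree h0).mono
              (p' := False) (m' := False) (z' := True) (n' := False) id id id False.elim
        · simp only [h3, ← mul_assoc, ← zpow_add]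
          refine (hw.zpow_mul hG hA hfree ?_).mono id id id False.elim
          refine twistExp_add_ne_zero (by omega) fun hj hε ha0 => ?_
          obtain ⟨⟨c, δ⟩, L, rfl⟩ := List.exists_cons_of_ne_nil h2
          simp only [List.head?_cons, Option.mem_some_iff, forall_eq'] at *
          induction c using Fin.cases with
          | zero => have := hpos rfl; simp [ha0] at this
          | succ c =>
            obtain ⟨rfl, -⟩ := h4 (c, δ) rfl
            exact hε (hhead (congrArg Fin.succ hj))
      · simpa only [heval, zero_add, mul_assoc] using
          congrArg (· * evalList (twist N g h) L) (cond_twist_succ N g h (j, ε))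
      · rintro ⟨j', ε'⟩ hl'
        simp only [List.head?_cons, Option.mem_some_iff, Prod.mk.injEq,
          Fin.succ_inj] at hl'
        simp [hl'.1, hl'.2]

theorem hasInfiniteGirth_of_movesFreely [Infinite X] (hG : MovesFreely G X) {g : Fin k → G}
    (hg : Subgroup.closure (Set.range g) = ⊤) (hfree : ∀ i, ∀ x : X, g i • x ≠ x) :
    HasInfiniteGirth G := by
  intro n
  set A : Set G := Set.range (coeff g) with hAdef
  have hA : A.Finite := Set.finite_range _
  have hfreeA : ∀ a ∈ A, ∀ x : X, a • x ≠ x := by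
    rintro _ ⟨⟨i, _ | _⟩, rfl⟩ x
    · simpa [coeff, inv_smul_eq_iff] using (hfree i x).symm
    · simpa [coeff] using hfree i x
  set N : ℤ := n + 1 with hN
  have hfin : {w : FreeGroup (Fin (k + 1)) | w ≠ 1 ∧ w.norm ≤ n}.Finite :=
    ((List.finite_length_le _ n).preimage FreeGroup.toWord_injective.injOn).subset
      fun w hw => hw.2
  obtain ⟨h, hh⟩ := Escapes.exists_ne_one (X := X) (A := A)
    (hfin.image fun w h => FreeGroup.lift (twist N g h) w) (by
      rintro _ ⟨w, ⟨hw1, hwn⟩, rfl⟩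
      have hval : ∀ h, FreeGroup.lift (twist N g h) w = evalList (twist N g h) w.toWord :=
        fun h => by
          conv_lhs => rw [← FreeGroup.mk_toWord (x := w)]
          rfl
      obtain ⟨a, ha, hpos, ⟨h1, h2, h3⟩ | ⟨l, v, hv, h1, h2, h3⟩⟩ :=
        evalList_twist (N := N) hG hA hfreeA (fun l => ⟨l, rfl⟩) w.toWord
          FreeGroup.isReduced_toWord (by simp only [FreeGroup.norm] at hwn; omega)
      · simp only [hval, h1]
        have ha0 : a ≠ 0 := by
          rintro rfl
          obtain ⟨b, L, hbL⟩ := List.exists_cons_of_ne_nil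
            (mt FreeGroup.toWord_eq_nil_iff.1 hw1)
          simp only [hbL, List.head?_cons, Option.mem_some_iff, forall_eq'] at hpos h3
          simpa using hpos h3
        simpa using ((Escapes.one hA hfreeA).zpow_mul hG hA hfreeA ha0).mono
          (p' := False) (m' := False) (z' := False) (n' := True) id id False.elim id
      · simp only [hval, h2]
        rcases eq_or_ne (a + twistExp N l) 0 with h0 | h0
        · simpa [h0] using hv.mono
            (p' := False) (m' := False) (z' := False) (n' := True) False.elim False.elim id id
        · exact (hv.zpow_mul hG hA hfreeA h0).mono id id False.elim id)
  exact ⟨k + 1, twist N g h, closure_range_twist N hg h, fun w hw1 hwn =>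
    hh _ ⟨w, ⟨hw1, hwn⟩, rfl⟩⟩

end Girth

section Bump

/-- The map which is the identity off `[a, b]` and, on `[a, b]`, has slopes `2`, `1`, `1/2` on
the first quarter, the second quarter, and the second half. -/
noncomputable def bumpFun (a b t : ℝ) : ℝ := max t (min (2 * t - a) (min (t + (b - a) / 4) ((t + b) / 2)))

/-- The inverse of `bumpFun`. -/
noncomputable def bumpInv (a b u : ℝ) : ℝ := min u (max ((u + a) / 2) (max (u - (b - a) / 4) (2 * u - b)))

variable {a b t : ℝ}

lemma bumpFun_of_le (h : t ≤ a) : bumpFun a b t = t :=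
  max_eq_left (min_le_of_left_le (by linarith))

lemma bumpFun_of_ge (h : b ≤ t) : bumpFun a b t = t :=
  max_eq_left (min_le_of_right_le (min_le_of_right_le (by linarith)))

lemma bumpFun_first (h : a ≤ t) (h' : t ≤ a + (b - a) / 4) : bumpFun a b t = 2 * t - a := by
  rw [bumpFun, min_eq_left (le_min (by linarith) (by linarith)), max_eq_right (by linarith)]

lemma bumpFun_second (h : a + (b - a) / 4 ≤ t) (h' : t ≤ a + (b - a) / 2) :
    bumpFun a b t = t + (b - a) / 4 := by
  rw [bumpFun, min_eq_left (a := t + (b - a) / 4) (by linarith), min_eq_right (by linarith),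
    max_eq_right (by linarith)]

lemma bumpFun_third (h : a + (b - a) / 2 ≤ t) (h' : t ≤ b) : bumpFun a b t = (t + b) / 2 := by
  rw [bumpFun, min_eq_right (a := t + (b - a) / 4) (by linarith), min_eq_right (by linarith),
    max_eq_right (by linarith)]

lemma lt_bumpFun (h : a < t) (h' : t < b) : t < bumpFun a b t :=
  lt_max_of_lt_right (lt_min (by linarith) (lt_min (by linarith) (by linarith)))

lemma bumpFun_mono : Monotone (bumpFun a b) := fun s t h => by
  unfold bumpFun
  gcongr

lemma bumpInv_bumpFun : bumpInv a b (bumpFun a b t) = t := by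
  unfold bumpInv bumpFun
  grind

lemma bumpFun_bumpInv : bumpFun a b (bumpInv a b t) = t := by
  unfold bumpInv bumpFun
  grind

/-- `bumpFun a b` as a homeomorphism of the unit interval. -/
noncomputable def bump (a b : ℝ) (ha : 0 ≤ a) (hb : b ≤ 1) : unitInterval ≃ₜ unitInterval where
  toFun t := ⟨bumpFun a b t, le_max_of_le_left t.2.1, by
    have := t.2.2
    refine max_le this ?_
    by_cases h : (t : ℝ) ≤ b
    · exact min_le_of_right_le (min_le_of_right_le (by linarith))
    · exact min_le_of_right_le (min_le_of_right_le (by linarith))⟩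
  invFun t := ⟨bumpInv a b t, le_min t.2.1 (le_max_of_le_left (by linarith [t.2.1])),
    min_le_of_left_le t.2.2⟩
  left_inv t := Subtype.ext bumpInv_bumpFun
  right_inv t := Subtype.ext bumpFun_bumpInv
  continuous_toFun := by unfold bumpFun; fun_prop
  continuous_invFun := by unfold bumpInv; fun_prop

lemma coe_bump (ha : 0 ≤ a) (hb : b ≤ 1) (t : unitInterval) :
    (bump a b ha hb t : ℝ) = bumpFun a b t := rfl

lemma bump_mono (ha : 0 ≤ a) (hb : b ≤ 1) : Monotone (bump a b ha hb) := fun _ _ h =>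
  bumpFun_mono h

/-- `y` is a dyadic rational. -/
def IsDyadicReal (y : ℝ) : Prop := ∃ (a : ℤ) (k : ℕ), y = (a : ℝ) / 2 ^ k

lemma IsDyadicReal.average (ha : IsDyadicReal a) (hb : IsDyadicReal b) :
    IsDyadicReal ((a + b) / 2) := by
  obtain ⟨m, k, rfl⟩ := ha
  obtain ⟨n, l, rfl⟩ := hb
  refine ⟨m * 2 ^ l + n * 2 ^ k, k + l + 1, ?_⟩
  push_cast
  field_simp
  ring

lemma bump_affine (a b : ℝ) (ha : 0 ≤ a) (hb : b ≤ 1) :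
    (∃ (m : ℤ) (c : ℝ), ∀ t : unitInterval, (t : ℝ) ∈ Set.Icc 0 a →
      (bump a b ha hb t : ℝ) = (2 : ℝ) ^ m * t + c) ∧
    (∃ (m : ℤ) (c : ℝ), ∀ t : unitInterval, (t : ℝ) ∈ Set.Icc a (a + (b - a) / 4) →
      (bump a b ha hb t : ℝ) = (2 : ℝ) ^ m * t + c) ∧
    (∃ (m : ℤ) (c : ℝ), ∀ t : unitInterval,
      (t : ℝ) ∈ Set.Icc (a + (b - a) / 4) (a + (b - a) / 2) →
      (bump a b ha hb t : ℝ) = (2 : ℝ) ^ m * t + c) ∧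
    (∃ (m : ℤ) (c : ℝ), ∀ t : unitInterval, (t : ℝ) ∈ Set.Icc (a + (b - a) / 2) b →
      (bump a b ha hb t : ℝ) = (2 : ℝ) ^ m * t + c) ∧
    ∃ (m : ℤ) (c : ℝ), ∀ t : unitInterval, (t : ℝ) ∈ Set.Icc b 1 →
      (bump a b ha hb t : ℝ) = (2 : ℝ) ^ m * t + c := by
  refine ⟨⟨0, 0, fun t ht => ?_⟩, ⟨1, -a, fun t ht => ?_⟩, ⟨0, (b - a) / 4, fun t ht => ?_⟩,
    ⟨-1, b / 2, fun t ht => ?_⟩, ⟨0, 0, fun t ht => ?_⟩⟩ <;> rw [coe_bump]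
  · rw [bumpFun_of_le ht.2]; simp
  · rw [bumpFun_first ht.1 ht.2]; norm_num; ring
  · rw [bumpFun_second ht.1 ht.2]; simp
  · rw [bumpFun_third ht.1 ht.2]; norm_num; ring
  · rw [bumpFun_of_ge ht.1]; simp

/-- In the definition of Thompson's group, breakpoints may be repeated. -/
lemma isThompsonF_of_le {f : unitInterval ≃ₜ unitInterval} (hf : Monotone f) (n : ℕ) (x : ℕ → ℝ)
    (h0 : x 0 = 0) (h1 : x n = 1) (hle : ∀ i < n, x i ≤ x (i + 1))
    (hd : ∀ i ≤ n, IsDyadicReal (x i))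
    (hp : ∀ i < n, ∃ (m : ℤ) (b : ℝ), ∀ t : unitInterval,
      (t : ℝ) ∈ Set.Icc (x i) (x (i + 1)) → (f t : ℝ) = (2 : ℝ) ^ m * t + b) :
    IsThompsonF f := by
  induction n generalizing x with
  | zero => exact ⟨hf, 0, x, h0, h1, by simp, hd, hp⟩
  | succ n ih =>
    by_cases hlt : ∀ i < n + 1, x i < x (i + 1)
    · exact ⟨hf, n + 1, x, h0, h1, hlt, hd, hp⟩
    push Not at hlt
    obtain ⟨i, hi, hi'⟩ := hlt
    have heq : x i = x (i + 1) := (hle i hi).antisymm hi'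
    have hx : ∀ j, (if j ≤ i then x j else x (j + 1)) = if j < i then x j else x (j + 1) := by
      intro j
      rcases lt_trichotomy j i with h | rfl | h
      · simp [h, h.le]
      · simp [heq]
      · simp [h.not_ge, h.not_gt]
    refine ih (fun j => if j ≤ i then x j else x (j + 1)) (by simpa using h0) ?_ ?_ ?_ ?_
    · rw [hx, if_neg (by omega), h1]
    · intro j hj
      simp only [hx j, Nat.succ_le_iff]
      split_ifs
      · exact hle j (by omega)
      · exact hle (j + 1) (by omega)
    · intro j hj
      split_ifs
      · exact hd j (by omega)
      · exact hd (j + 1) (by omega)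
    · intro j hj
      simp only [hx j, Nat.succ_le_iff]
      split_ifs
      · exact hp j (by omega)
      · exact hp (j + 1) (by omega)

lemma isThompsonF_bump (ha : 0 ≤ a) (hab : a ≤ b) (hb : b ≤ 1) (hda : IsDyadicReal a)
    (hdb : IsDyadicReal b) : IsThompsonF (bump a b ha hb) := by
  obtain ⟨h0, h1, h2, h3, h4⟩ := bump_affine a b ha hb
  have hd2 : IsDyadicReal (a + (b - a) / 2) := by
    have := hda.average hdb
    rwa [show (a + b) / 2 = a + (b - a) / 2 by ring] at this
  have hd1 : IsDyadicReal (a + (b - a) / 4) := by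
    have := hda.average hd2
    rwa [show (a + (a + (b - a) / 2)) / 2 = a + (b - a) / 4 by ring] at this
  refine isThompsonF_of_le (bump_mono ha hb) 5
    (fun i => [0, a, a + (b - a) / 4, a + (b - a) / 2, b, 1].getD i 1) rfl rfl ?_ ?_ ?_ <;>
    intro i hi <;> interval_cases i
  any_goals simp only [List.getD_cons_zero, List.getD_cons_succ]
  any_goals first | linarith | assumption
  · exact ⟨0, 0, by simp⟩
  · exact ⟨1, 0, by simp⟩

end Bump

section Uniform

lemma apply_zero_of_monotone {f : unitInterval ≃ₜ unitInterval} (hf : Monotone f) : f 0 = 0 :=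
  le_antisymm (by simpa using hf (unitInterval.nonneg' (t := f.symm 0))) unitInterval.nonneg'

lemma apply_one_of_monotone {f : unitInterval ≃ₜ unitInterval} (hf : Monotone f) : f 1 = 1 :=
  le_antisymm unitInterval.le_one' (by simpa using hf (unitInterval.le_one' (t := f.symm 1)))

/-- `d 0, …, d r` are the endpoints, scaled by `2 ^ M`, of a subdivision of `[0, 1]` into
intervals of the form `[c / 2 ^ k, (c + 1) / 2 ^ k]`. -/
def IsDyadicSubdivision (M r : ℕ) (d : ℕ → ℤ) : Prop :=
  d 0 = 0 ∧ d r = 2 ^ M ∧ ∀ j < r, ∃ e : ℕ, d (j + 1) = d j + 2 ^ e ∧ (2 : ℤ) ^ e ∣ d j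

lemma exists_eventually_dyadic {y : ℝ} (hy : IsDyadicReal y) :
    ∀ᶠ K : ℕ in Filter.atTop, ∃ a : ℤ, y * 2 ^ K = a := by
  obtain ⟨a, k, rfl⟩ := hy
  filter_upwards [Filter.eventually_ge_atTop k] with K hK
  obtain ⟨l, rfl⟩ := Nat.exists_eq_add_of_le hK
  exact ⟨a * 2 ^ l, by push_cast; field_simp; ring⟩

lemma IsDyadicReal.add {a b : ℝ} (ha : IsDyadicReal a) (hb : IsDyadicReal b) :
    IsDyadicReal (a + b) := by
  obtain ⟨m, k, rfl⟩ := ha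
  obtain ⟨n, l, rfl⟩ := hb
  refine ⟨m * 2 ^ l + n * 2 ^ k, k + l, ?_⟩
  push_cast
  field_simp
  ring

lemma IsDyadicReal.neg {a : ℝ} (ha : IsDyadicReal a) : IsDyadicReal (-a) := by
  obtain ⟨m, k, rfl⟩ := ha
  exact ⟨-m, k, by push_cast; ring⟩

lemma IsDyadicReal.zpow_mul {a : ℝ} (ha : IsDyadicReal a) (m : ℤ) :
    IsDyadicReal ((2 : ℝ) ^ m * a) := by
  obtain ⟨n, k, rfl⟩ := ha
  obtain ⟨l, rfl | rfl⟩ := m.eq_nat_or_neg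
  · exact ⟨2 ^ l * n, k, by push_cast; rw [zpow_natCast]; ring⟩
  · exact ⟨n, k + l, by rw [zpow_neg, zpow_natCast]; field_simp; ring⟩

/-- On a fine enough uniform partition an element of Thompson's group is affine on each interval
and maps the partition to a dyadic subdivision. -/
lemma IsThompsonF.exists_uniform {f : unitInterval ≃ₜ unitInterval} (hf : IsThompsonF f) :
    ∃ (N M : ℕ) (d : ℕ → ℤ), IsDyadicSubdivision M (2 ^ N) d ∧
      ∀ j : ℕ, j < 2 ^ N → ∀ (t : unitInterval) (s : ℝ), 0 ≤ s → s ≤ 1 → (t : ℝ) * 2 ^ N = j + s →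
        (f t : ℝ) * 2 ^ M = d j + s * (d (j + 1) - d j) := by
  obtain ⟨hmono, n, x, hx0, hxn, hlt, hdy, hpc⟩ := hf
  choose! m b hb using hpc
  have hxle : ∀ i ≤ n, 0 ≤ x i := by
    intro i hi
    induction i with
    | zero => exact hx0.ge
    | succ i ih => exact (ih (by omega)).trans (hlt i (by omega)).le
  have hxle1 : ∀ i ≤ n, x i ≤ 1 := fun i hi =>
    Nat.decreasingInduction (motive := fun i _ => x i ≤ 1)
      (fun i hi ih => (hlt i hi).le.trans ih) hxn.le hi
  have hbd : ∀ i < n, IsDyadicReal (b i) := by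
    intro i hi
    induction i with
    | zero =>
      have := hb 0 hi 0 (by simpa [hx0] using hx0.ge.trans (hlt 0 hi).le)
      rw [apply_zero_of_monotone hmono] at this
      have h0 : b 0 = 0 := by simpa using this.symm
      exact ⟨0, 0, by simp [h0]⟩
    | succ i ih =>
      have h1 := hb i (by omega) ⟨x (i + 1), hxle _ hi.le, hxle1 _ hi.le⟩
        ⟨(hlt i (by omega)).le, le_rfl⟩
      have h2 := hb (i + 1) hi ⟨x (i + 1), hxle _ hi.le, hxle1 _ hi.le⟩
        ⟨le_rfl, (hlt _ hi).le⟩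
      have hx : IsDyadicReal (x (i + 1)) := hdy _ hi.le
      have h3 := (((hx.zpow_mul (m i)).add (ih (by omega))).add (hx.zpow_mul (m (i + 1))).neg)
      rwa [show (2 : ℝ) ^ m i * x (i + 1) + b i + -((2 : ℝ) ^ m (i + 1) * x (i + 1)) = b (i + 1)
        by linarith] at h3
  obtain ⟨K, hK⟩ : ∃ K : ℕ, (∀ i ∈ Set.Iic n, ∃ a : ℤ, x i * 2 ^ K = a) ∧
      (∀ i ∈ Set.Iio n, ∃ a : ℤ, b i * 2 ^ K = a) ∧ ∀ i ∈ Set.Iio n, (m i).natAbs ≤ K := by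
    refine Filter.Eventually.exists (f := Filter.atTop) ?_
    refine Filter.Eventually.and ?_ (Filter.Eventually.and ?_ ?_)
    · exact (Set.finite_Iic n).eventually_all.2 fun i hi => exists_eventually_dyadic (hdy i hi)
    · exact (Set.finite_Iio n).eventually_all.2 fun i hi => exists_eventually_dyadic (hbd i hi)
    · exact (Set.finite_Iio n).eventually_all.2 fun i hi => Filter.eventually_ge_atTop _
  obtain ⟨hKx, hKb, hKm⟩ := hK
  have key : ∀ j : ℕ, j < 2 ^ (2 * K) → ∃ (e : ℕ) (B : ℤ), e ≤ 2 * K ∧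
      ∀ (t : unitInterval) (s : ℝ), 0 ≤ s → s ≤ 1 → (t : ℝ) * 2 ^ (2 * K) = j + s →
        (f t : ℝ) * 2 ^ (3 * K) = 2 ^ e * (j + s) + B * 2 ^ (2 * K) := by
    intro j hj
    have hpow : (0 : ℝ) < 2 ^ (2 * K) := by positivity
    have hex : ∃ i, (j : ℝ) < x i * 2 ^ (2 * K) ∧ i ≤ n :=
      ⟨n, by rw [hxn, one_mul]; exact_mod_cast hj, le_rfl⟩
    classical
    obtain ⟨hi, hin⟩ := Nat.find_spec hex
    have hmin := fun i => Nat.find_min hex (m := i)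
    set i₀ := Nat.find hex
    obtain ⟨i, hii⟩ : ∃ i, i₀ = i + 1 := Nat.exists_eq_succ_of_ne_zero fun h0 => by
      rw [h0, hx0, zero_mul] at hi
      exact absurd hi (Nat.cast_nonneg j).not_gt
    rw [hii] at hi hin hmin
    have hi' : x i * 2 ^ (2 * K) ≤ j := by
      by_contra! hc
      exact hmin i (by omega) ⟨hc, by omega⟩
    have hi1 : (j : ℝ) + 1 ≤ x (i + 1) * 2 ^ (2 * K) := by
      obtain ⟨a, ha⟩ := hKx (i + 1) hin
      have h2 : x (i + 1) * 2 ^ (2 * K) = ((a * 2 ^ K : ℤ) : ℝ) := by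
        push_cast
        rw [← ha]
        ring
      rw [h2] at hi ⊢
      exact_mod_cast hi
    obtain ⟨B, hB⟩ := hKb i (by simp; omega)
    have hm := hKm i (by simp; omega)
    obtain ⟨e, he⟩ : ∃ e : ℕ, m i + K = e := Int.eq_ofNat_of_zero_le (by omega)
    refine ⟨e, B, by omega, fun t s hs0 hs1 hts => ?_⟩
    rw [hb i (by omega) t ⟨by nlinarith, by nlinarith⟩]
    have h2 : (2 : ℝ) ^ m i * 2 ^ K = 2 ^ e := by
      rw [← zpow_natCast, ← zpow_natCast, ← he, zpow_add₀ two_ne_zero]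
    rw [← hB, ← hts, ← h2]
    ring
  set q : ℕ → unitInterval := fun j => Set.projIcc 0 1 zero_le_one ((j : ℝ) / 2 ^ (2 * K)) with hq
  have hqv : ∀ j : ℕ, j ≤ 2 ^ (2 * K) → (q j : ℝ) * 2 ^ (2 * K) = j := by
    intro j hj
    have hj' : (j : ℝ) ≤ 2 ^ (2 * K) := by exact_mod_cast hj
    have : (j : ℝ) / 2 ^ (2 * K) ∈ Set.Icc (0 : ℝ) 1 :=
      ⟨by positivity, div_le_one_of_le₀ hj' (by positivity)⟩
    simp only [hq, Set.projIcc_of_mem _ this]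
    field_simp
  set d : ℕ → ℤ := fun j => ⌊(f (q j) : ℝ) * 2 ^ (3 * K)⌋ with hd
  have hdv : ∀ j : ℕ, j < 2 ^ (2 * K) → ∃ (e : ℕ) (B : ℤ), e ≤ 2 * K ∧
      (∀ (t : unitInterval) (s : ℝ), 0 ≤ s → s ≤ 1 → (t : ℝ) * 2 ^ (2 * K) = j + s →
        (f t : ℝ) * 2 ^ (3 * K) = 2 ^ e * (j + s) + B * 2 ^ (2 * K)) ∧
      d j = 2 ^ e * j + B * 2 ^ (2 * K) ∧ d (j + 1) = 2 ^ e * (j + 1) + B * 2 ^ (2 * K) := by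
    intro j hj
    obtain ⟨e, B, he, h⟩ := key j hj
    refine ⟨e, B, he, h, ?_, ?_⟩
    · have := h (q j) 0 le_rfl zero_le_one (by rw [hqv j hj.le, add_zero])
      simp only [hd, this]
      rw [Int.floor_eq_iff]
      push_cast
      constructor <;> linarith
    · have := h (q (j + 1)) 1 zero_le_one le_rfl (by rw [hqv (j + 1) hj]; push_cast; ring)
      simp only [hd, this]
      rw [Int.floor_eq_iff]
      push_cast
      constructor <;> linarith
  refine ⟨2 * K, 3 * K, d, ⟨?_, ?_, fun j hj => ?_⟩, fun j hj t s hs0 hs1 hts => ?_⟩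
  · have : q 0 = 0 := by
      apply Subtype.ext
      have := hqv 0 (by positivity)
      simpa using this
    simp [hd, this, apply_zero_of_monotone hmono]
  · have : q (2 ^ (2 * K)) = 1 := by
      apply Subtype.ext
      have := hqv (2 ^ (2 * K)) le_rfl
      simpa using this
    simp only [hd, this, apply_one_of_monotone hmono, Set.Icc.coe_one, one_mul]
    exact_mod_cast Int.floor_intCast (R := ℝ) (2 ^ (3 * K))
  · obtain ⟨e, B, he, -, h1, h2⟩ := hdv j hj
    refine ⟨e, by rw [h1, h2]; ring, ?_⟩
    rw [h1]
    exact dvd_add (dvd_mul_right _ _) ((pow_dvd_pow 2 he).mul_left _)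
  · obtain ⟨e, B, he, h, h1, h2⟩ := hdv j hj
    rw [h t s hs0 hs1 hts, h1, h2]
    push_cast
    ring

end Uniform

section Generation

/-- The standard generators `x₀, x₁, x₂, …` of Thompson's group. -/
noncomputable def thompsonGen (n : ℕ) : unitInterval ≃ₜ unitInterval :=
  bump (1 - (1 / 2) ^ n) 1 (sub_nonneg.2 (pow_le_one₀ (by norm_num) (by norm_num))) le_rfl

lemma coe_thompsonGen (n : ℕ) (t : unitInterval) :
    (thompsonGen n t : ℝ) = bumpFun (1 - (1 / 2) ^ n) 1 t := rfl

lemma isThompsonF_thompsonGen (n : ℕ) : IsThompsonF (thompsonGen n) :=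
  isThompsonF_bump _ (by simp) _ ⟨2 ^ n - 1, n, by push_cast; rw [one_div, inv_pow]; field_simp⟩ ⟨1, 0, by simp⟩

lemma thompsonGen_mul_comm (n : ℕ) :
    thompsonGen 0 * thompsonGen (n + 1) = thompsonGen (n + 2) * thompsonGen 0 := by
  refine Homeomorph.ext fun t => Subtype.ext ?_
  change bumpFun _ 1 (bumpFun _ 1 t) = bumpFun _ 1 (bumpFun _ 1 t)
  have ht := t.2.1
  have ht' := t.2.2
  generalize (t : ℝ) = t at *
  have hp : (1 / 2 : ℝ) ^ n ≤ 1 := pow_le_one₀ (by norm_num) (by norm_num)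
  have hp' : (0 : ℝ) < (1 / 2) ^ n := by positivity
  simp only [pow_succ, pow_zero]
  set c := (1 / 2 : ℝ) ^ n
  have h3 : ∀ {t : ℝ}, 1 / 2 ≤ t → t ≤ 1 → bumpFun (1 - 1) 1 t = (t + 1) / 2 :=
    fun h h' => bumpFun_third (by linarith) h'
  rcases le_total t (1 / 2) with h | h
  · have h1 : bumpFun (1 - 1) 1 t ≤ 3 / 4 := by
      have := h3 (t := 1 / 2) le_rfl (by norm_num)
      exact (bumpFun_mono h).trans (by rw [this]; norm_num)
    rw [bumpFun_of_le (a := 1 - c * (1 / 2)) (by linarith),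
      bumpFun_of_le (a := 1 - c * (1 / 2) * (1 / 2)) (by linarith)]
  · rw [h3 h ht']
    have hle : t ≤ bumpFun (1 - c * (1 / 2)) 1 t := le_max_left _ _
    have hone : bumpFun (1 - c * (1 / 2)) 1 t ≤ 1 := by
      have := bumpFun_of_ge (a := 1 - c * (1 / 2)) (b := 1) (t := 1) le_rfl
      exact (bumpFun_mono ht').trans this.le
    rw [h3 (h.trans hle) hone]
    unfold bumpFun
    grind

/-- The group generated by `x₀` and `x₁`. -/
noncomputable def genGroup : Subgroup (unitInterval ≃ₜ unitInterval) :=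
  Subgroup.closure {thompsonGen 0, thompsonGen 1}

lemma thompsonGen_mem (n : ℕ) : thompsonGen n ∈ genGroup := by
  have h0 : thompsonGen 0 ∈ genGroup := Subgroup.subset_closure (by simp)
  match n with
  | 0 => exact h0
  | 1 => exact Subgroup.subset_closure (by simp)
  | n + 2 =>
    rw [← mul_inv_eq_of_eq_mul (thompsonGen_mul_comm n)]
    exact mul_mem (mul_mem h0 (thompsonGen_mem (n + 1))) (inv_mem h0)

/-- The endpoints of the subdivision of `[0, 1]` given by the right vine with `r` leaves. -/
noncomputable def vine (r j : ℕ) : ℝ := if j < r then 1 - (1 / 2) ^ j else 1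

lemma IsDyadicSubdivision.exists_merge {M r : ℕ} {d : ℕ → ℤ}
    (h : IsDyadicSubdivision M (r + 1) d) (hr : r ≠ 0) :
    ∃ i < r, ∃ e : ℕ, d (i + 1) = d i + 2 ^ e ∧ d (i + 2) = d i + 2 ^ (e + 1) ∧
      (2 : ℤ) ^ (e + 1) ∣ d i := by
  obtain ⟨h0, hM, hd⟩ := h
  choose! e he hdvd using hd
  have hpos : ∀ j ≤ r + 1, 0 ≤ d j ∧ (j ≠ 0 → 0 < d j) := by
    intro j hj
    induction j with
    | zero => simp [h0]
    | succ j ih =>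
      have := (ih (by omega)).1
      rw [he j (by omega)]
      exact ⟨by positivity, fun _ => by positivity⟩
  obtain ⟨i, hi, hmin⟩ := Finset.exists_min_image (Finset.range (r + 1)) e ⟨0, by simp⟩
  simp only [Finset.mem_range] at hi hmin
  obtain ⟨q, hq⟩ := hdvd i hi
  have hp : (0 : ℤ) < 2 ^ e i := by positivity
  have hstep : d (i + 1) = 2 ^ e i * (q + 1) := by rw [he i hi, hq]; ring
  have hlt : ∀ (l : ℕ) (z : ℤ), ¬ 2 ∣ z → (2 : ℤ) ^ l ∣ 2 ^ e i * z → l ≤ e i := by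
    intro l z hz hl
    by_contra! hc
    exact hz ((mul_dvd_mul_iff_left hp.ne').1
      ((pow_succ (2 : ℤ) (e i)) ▸ (pow_dvd_pow 2 hc).trans hl))
  rcases Int.even_or_odd q with hev | hodd
  · have hq1 : ¬ (2 : ℤ) ∣ q + 1 := by
      rw [← even_iff_two_dvd, Int.not_even_iff_odd]
      exact hev.add_one
    have hir : i < r := by
      by_contra! hc
      obtain rfl : i = r := by omega
      rw [hM] at hstep
      have h1 : M ≤ e i := hlt M (q + 1) hq1 (by rw [← hstep])
      have h2 := (hpos i (by omega)).2 hr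
      have h3 := he i hi
      have h4 : (2 : ℤ) ^ M ≤ 2 ^ e i := pow_le_pow_right₀ (by norm_num) h1
      linarith
    have hle := hlt (e (i + 1)) (q + 1) hq1 (hstep ▸ hdvd (i + 1) (by omega))
    have heq : e (i + 1) = e i := le_antisymm hle (hmin (i + 1) (by omega))
    refine ⟨i, hir, e i, he i hi, ?_, ?_⟩
    · rw [he (i + 1) (by omega), heq, he i hi]
      ring
    · rw [hq, pow_succ]
      exact mul_dvd_mul_left _ hev.two_dvd
  · obtain ⟨i, rfl⟩ : ∃ l, i = l + 1 := Nat.exists_eq_succ_of_ne_zero fun hi0 => by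
      subst hi0
      rw [h0] at hq
      rcases mul_eq_zero.1 hq.symm with h | h
      · exact hp.ne' h
      · subst h
        simp at hodd
    have hq1 : ¬ (2 : ℤ) ∣ q := by
      rwa [← even_iff_two_dvd, Int.not_even_iff_odd]
    have hle := hlt (e i) q hq1
      (hq ▸ he i (by omega) ▸ dvd_add (hdvd i (by omega)) dvd_rfl)
    have heq : e i = e (i + 1) := le_antisymm hle (hmin i (by omega))
    have hdi : d i = 2 ^ e (i + 1) * (q - 1) := by
      have := he i (by omega)
      rw [hq, heq] at this
      linarith
    refine ⟨i, by omega, e i, he i (by omega), ?_, ?_⟩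
    · rw [he (i + 1) hi, he i (by omega), heq]
      ring
    · rw [hdi, heq, pow_succ]
      exact mul_dvd_mul_left _ (hodd.sub_odd odd_one).two_dvd

/-- An element of `genGroup` which takes a dyadic subdivision to the right vine. -/
lemma IsDyadicSubdivision.exists_vine {M r : ℕ} {d : ℕ → ℤ} (h : IsDyadicSubdivision M r d) :
    ∃ f ∈ genGroup, ∀ j < r, ∀ (t : unitInterval) (s : ℝ), 0 ≤ s → s ≤ 1 →
      (t : ℝ) * 2 ^ M = d j + s * (d (j + 1) - d j) →
        (f t : ℝ) = vine r j + s * (vine r (j + 1) - vine r j) := by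
  induction r generalizing d with
  | zero => exact ⟨1, one_mem _, by simp⟩
  | succ r ih =>
    rcases eq_or_ne r 0 with rfl | hr
    · refine ⟨1, one_mem _, fun j hj t s hs0 hs1 ht => ?_⟩
      obtain rfl : j = 0 := by omega
      rw [h.1, h.2.1] at ht
      change (t : ℝ) = _
      have : (2 : ℝ) ^ M ≠ 0 := by positivity
      push_cast at ht
      simp only [vine]
      norm_num
      exact mul_right_cancel₀ this (by linarith)
    obtain ⟨i, hi, e, h1, h2, h3⟩ := h.exists_merge hr
    have hd' : IsDyadicSubdivision M r fun j => if j ≤ i then d j else d (j + 1) := by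
      refine ⟨by simp [h.1], by simp [hi.not_ge, h.2.1], fun j hj => ?_⟩
      rcases lt_trichotomy j i with hji | rfl | hji
      · simpa [hji.le, Nat.succ_le_iff, hji] using h.2.2 j (by omega)
      · exact ⟨e + 1, by simpa using h2, by simpa using h3⟩
      · simpa [hji.not_ge, (show ¬ j + 1 ≤ i by omega)] using h.2.2 (j + 1) (by omega)
    obtain ⟨f, hf, hfd⟩ := ih hd'
    have hmid : (d (i + 1) : ℝ) = (d i + d (i + 2)) / 2 := by
      rw [h1, h2]; push_cast; ring
    have hp : ∀ l, (0 : ℝ) < (1 / 2) ^ l := fun l => by positivity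
    have hanti : ∀ {l l'}, l ≤ l' → (1 / 2 : ℝ) ^ l' ≤ (1 / 2) ^ l := fun h =>
      pow_le_pow_of_le_one (by norm_num) (by norm_num) h
    have hlow : ∀ j < i, ∀ (t : unitInterval) (s : ℝ), 0 ≤ s → s ≤ 1 →
        (t : ℝ) * 2 ^ M = d j + s * (d (j + 1) - d j) →
        (f t : ℝ) = 1 - (1 / 2) ^ j + s * (1 / 2) ^ (j + 1) := by
      intro j hj t s hs0 hs1 ht
      rw [hfd j (by omega) t s hs0 hs1 (by simpa [hj.le, Nat.succ_le_iff, hj] using ht)]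
      simp only [vine, if_pos (show j < r by omega), if_pos (show j + 1 < r by omega), pow_succ]
      ring
    have hleft : ∀ (t : unitInterval) (s : ℝ), 0 ≤ s → s ≤ 1 →
        (t : ℝ) * 2 ^ M = d i + s * (d (i + 1) - d i) →
        (f t : ℝ) = vine r i + s / 2 * (vine r (i + 1) - vine r i) := by
      intro t s hs0 hs1 ht
      refine hfd i hi t (s / 2) (by linarith) (by linarith) ?_
      simp only [le_refl, if_true, add_le_iff_nonpos_right, nonpos_iff_eq_zero, one_ne_zero,
        if_false]
      rw [ht, hmid]
      ring
    have hright : ∀ (t : unitInterval) (s : ℝ), 0 ≤ s → s ≤ 1 →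
        (t : ℝ) * 2 ^ M = d (i + 1) + s * (d (i + 2) - d (i + 1)) →
        (f t : ℝ) = vine r i + (1 + s) / 2 * (vine r (i + 1) - vine r i) := by
      intro t s hs0 hs1 ht
      refine hfd i hi t ((1 + s) / 2) (by linarith) (by linarith) ?_
      simp only [le_refl, if_true, add_le_iff_nonpos_right, nonpos_iff_eq_zero, one_ne_zero,
        if_false]
      rw [ht, hmid]
      ring
    have hhigh : ∀ j, i < j → j < r → ∀ (t : unitInterval) (s : ℝ), 0 ≤ s → s ≤ 1 →
        (t : ℝ) * 2 ^ M = d (j + 1) + s * (d (j + 2) - d (j + 1)) →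
        (f t : ℝ) = vine r j + s * (vine r (j + 1) - vine r j) := by
      intro j hj hjr t s hs0 hs1 ht
      refine hfd j hjr t s hs0 hs1 ?_
      simpa only [if_neg hj.not_ge, if_neg (show ¬ j + 1 ≤ i by omega)] using ht
    rcases eq_or_ne (i + 1) r with hir | hir
    · refine ⟨f, hf, fun j hj t s hs0 hs1 ht => ?_⟩
      rcases lt_trichotomy j i with hji | rfl | hji
      · rw [hlow j hji t s hs0 hs1 ht]
        simp only [vine, if_pos (show j < r + 1 by omega), if_pos (show j + 1 < r + 1 by omega),
          pow_succ]
        ring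
      · rw [hleft t s hs0 hs1 ht]
        simp [vine, ← hir, pow_succ]
        ring
      · obtain rfl : j = i + 1 := by omega
        rw [hright t s hs0 hs1 ht]
        simp [vine, ← hir, pow_succ]
        ring
    · refine ⟨thompsonGen i * f, mul_mem (thompsonGen_mem i) hf, fun j hj t s hs0 hs1 ht => ?_⟩
      change (thompsonGen i (f t) : ℝ) = _
      rw [coe_thompsonGen]
      have hpi := hp i
      rcases lt_trichotomy j i with hji | rfl | hji
      · have h4 := hlow j hji t s hs0 hs1 ht
        have h5 : (1 / 2 : ℝ) ^ i ≤ (1 / 2) ^ (j + 1) := hanti hji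
        have h6 := hp j
        rw [bumpFun_of_le, h4]
        · simp only [vine, if_pos (show j < r + 1 by omega),
            if_pos (show j + 1 < r + 1 by omega), pow_succ]
          ring
        · rw [h4]
          rw [pow_succ] at h5 ⊢
          nlinarith
      · have h4 := hleft t s hs0 hs1 ht
        simp only [vine, if_pos hi, if_pos (show j + 1 < r by omega), pow_succ] at h4
        rw [bumpFun_first (by nlinarith) (by nlinarith), h4]
        simp only [vine, if_pos (show j < r + 1 by omega),
          if_pos (show j + 1 < r + 1 by omega), pow_succ]
        ring
      · obtain ⟨j, rfl⟩ := Nat.exists_eq_add_of_lt hji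
        rcases eq_or_ne j 0 with rfl | hj0
        · have h4 := hright t s hs0 hs1 ht
          simp only [vine, if_pos hi, if_pos (show i + 1 < r by omega), pow_succ] at h4
          rw [bumpFun_second (by nlinarith) (by nlinarith), h4]
          simp only [vine, add_zero, if_pos (show i + 1 < r + 1 by omega),
            if_pos (show i + 1 + 1 < r + 1 by omega), pow_succ]
          ring
        · have hv : ∀ l, vine (r + 1) (l + 1) = (vine r l + 1) / 2 := by
            intro l
            simp only [vine, add_lt_add_iff_right]
            split_ifs
            · rw [pow_succ]; ring
            · norm_num
          have hv1 : ∀ l, vine r l ≤ 1 := by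
            intro l
            simp only [vine]
            split_ifs
            · linarith [hp l]
            · rfl
          have hv2 : ∀ l, i + 1 ≤ l → 1 - (1 / 2) ^ i * (1 / 2) ≤ vine r l := by
            intro l hl
            simp only [vine]
            split_ifs
            · have := hanti hl
              rw [pow_succ] at this
              linarith
            · linarith
          have h4 := hhigh (i + j) (by omega) (by omega) t s hs0 hs1 ht
          have h5 := hv1 (i + j)
          have h6 := hv1 (i + j + 1)
          have h7 := hv2 (i + j) (by omega)
          have h8 := hv2 (i + j + 1) (by omega)
          rw [bumpFun_third (by nlinarith) (by nlinarith), h4, hv, hv]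
          ring

lemma IsThompsonF.mem_genGroup {f : unitInterval ≃ₜ unitInterval} (hf : IsThompsonF f) :
    f ∈ genGroup := by
  obtain ⟨N, M, d, hd, hfd⟩ := hf.exists_uniform
  obtain ⟨q, hq, hqd⟩ := hd.exists_vine
  have hu : IsDyadicSubdivision N (2 ^ N) fun j => j :=
    ⟨rfl, by simp, fun j _ => ⟨0, by simp, by simp⟩⟩
  obtain ⟨p, hp, hpd⟩ := hu.exists_vine
  have heq : q * f = p := by
    refine Homeomorph.ext fun t => Subtype.ext ?_
    obtain ⟨j, hj, s, hs0, hs1, hts⟩ : ∃ j : ℕ, j < 2 ^ N ∧ ∃ s : ℝ, 0 ≤ s ∧ s ≤ 1 ∧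
        (t : ℝ) * 2 ^ N = j + s := by
      have hpow : (0 : ℝ) < 2 ^ N := by positivity
      have h0 : 0 ≤ (t : ℝ) * 2 ^ N := mul_nonneg t.2.1 hpow.le
      rcases t.2.2.eq_or_lt with h1 | h1
      · refine ⟨2 ^ N - 1, Nat.sub_lt (by positivity) one_pos, 1, zero_le_one, le_rfl, ?_⟩
        rw [h1, Nat.cast_sub Nat.one_le_two_pow]
        simp
      · refine ⟨⌊(t : ℝ) * 2 ^ N⌋₊, ?_, (t : ℝ) * 2 ^ N - ⌊(t : ℝ) * 2 ^ N⌋₊, ?_, ?_, by ring⟩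
        · rw [Nat.floor_lt h0]
          push_cast
          nlinarith
        · linarith [Nat.floor_le h0]
        · linarith [Nat.lt_floor_add_one ((t : ℝ) * 2 ^ N)]
    rw [hpd j hj t s hs0 hs1 (by push_cast; rw [hts]; ring)]
    exact hqd j hj (f t) s hs0 hs1 (hfd j hj t s hs0 hs1 hts)
  rw [← eq_inv_mul_iff_mul_eq] at heq
  rw [heq]
  exact mul_mem (inv_mem hq) hp

end Generation

section Action

/-- The open unit interval, as a subtype of `[0, 1]`. -/
abbrev OpenUnitInterval : Type := {t : unitInterval // t ≠ 0 ∧ t ≠ 1}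

/-- The action on the open unit interval of a group of monotone homeomorphisms of `[0, 1]`. -/
abbrev openIntervalAction (Γ : Subgroup (unitInterval ≃ₜ unitInterval))
    (hΓ : ∀ f ∈ Γ, Monotone f) : MulAction Γ OpenUnitInterval where
  smul f t := ⟨f.1 t.1,
    fun h => t.2.1 (f.1.injective (h.trans (apply_zero_of_monotone (hΓ _ f.2)).symm)),
    fun h => t.2.2 (f.1.injective (h.trans (apply_one_of_monotone (hΓ _ f.2)).symm))⟩
  one_smul _ := rfl
  mul_smul _ _ _ := rfl

lemma lt_one_of_ne {t : unitInterval} (h : t ≠ 1) : (t : ℝ) < 1 :=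
  lt_of_le_of_ne t.2.2 fun h' => h (Subtype.ext h')

lemma pos_of_ne {t : unitInterval} (h : t ≠ 0) : 0 < (t : ℝ) :=
  lt_of_le_of_ne t.2.1 fun h' => h (Subtype.ext h'.symm)

lemma lt_thompsonGen_zero {t : unitInterval} (h0 : t ≠ 0) (h1 : t ≠ 1) :
    t < thompsonGen 0 t := by
  change (t : ℝ) < thompsonGen 0 t
  rw [coe_thompsonGen]
  exact lt_bumpFun (by simpa using pos_of_ne h0) (lt_one_of_ne h1)

lemma exists_dyadic_between {x y : ℝ} (h : x < y) : ∃ z, x < z ∧ z < y ∧ IsDyadicReal z := by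
  obtain ⟨k, hk⟩ := exists_nat_gt (1 / (y - x))
  have hk2 : (k : ℝ) < 2 ^ k := by exact_mod_cast Nat.lt_two_pow_self
  have hp : (0 : ℝ) < 2 ^ k := by positivity
  have hxy : 1 < 2 ^ k * (y - x) := by
    rw [← div_lt_iff₀ (sub_pos.2 h)]
    linarith
  refine ⟨((⌊x * 2 ^ k⌋ + 1 : ℤ) : ℝ) / 2 ^ k, ?_, ?_, _, k, rfl⟩
  · rw [lt_div_iff₀ hp]
    push_cast
    exact Int.lt_floor_add_one _
  · rw [div_lt_iff₀ hp]
    push_cast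
    nlinarith [Int.floor_le (x * 2 ^ k)]

/-- Around a point of the open interval there is a dyadic interval which avoids a finite set. -/
lemma exists_dyadic_interval {P : Set ℝ} (hP : P.Finite) {y : ℝ} (hy : y ∉ P) (h0 : 0 < y)
    (h1 : y < 1) : ∃ a b : ℝ, 0 ≤ a ∧ a < y ∧ y < b ∧ b ≤ 1 ∧ IsDyadicReal a ∧ IsDyadicReal b ∧
      ∀ q ∈ P, q ≤ a ∨ b ≤ q := by
  obtain ⟨ε, hε, hball⟩ := Metric.isOpen_iff.1
    (hP.isClosed.isOpen_compl.inter isOpen_Ioo) y ⟨hy, h0, h1⟩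
  obtain ⟨a, ha, ha', hda⟩ := exists_dyadic_between (show y - ε < y by linarith)
  obtain ⟨b, hb, hb', hdb⟩ := exists_dyadic_between (show y < y + ε by linarith)
  rw [Real.ball_eq_Ioo] at hball
  refine ⟨a, b, (hball ⟨ha, by linarith⟩).2.1.le, ha', hb, (hball ⟨by linarith, hb'⟩).2.2.le,
    hda, hdb, fun q hq => ?_⟩
  by_contra! hc
  exact (hball ⟨ha.trans hc.1, hc.2.trans hb'⟩).1 hq

theorem hasInfiniteGirth_of_coe_smul (Γ : Subgroup (unitInterval ≃ₜ unitInterval))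
    (hΓ : ∀ f : unitInterval ≃ₜ unitInterval, f ∈ Γ ↔ IsThompsonF f) [MulAction Γ OpenUnitInterval]
    (hcoe : ∀ (f : Γ) (t : OpenUnitInterval), (f • t).1 = f.1 t.1) : HasInfiniteGirth Γ := by
  let x₀ : Γ := ⟨thompsonGen 0, (hΓ _).2 (isThompsonF_thompsonGen 0)⟩
  let x₁ : Γ := ⟨thompsonGen 1, (hΓ _).2 (isThompsonF_thompsonGen 1)⟩
  have hx₀ : ∀ t : OpenUnitInterval, t.1 < (x₀ • t).1 := fun t => by
    rw [hcoe]
    exact lt_thompsonGen_zero t.2.1 t.2.2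
  have hinj : ∀ (f : Γ) (t : OpenUnitInterval), t < f • t → Function.Injective fun k : ℕ => f ^ k • t := by
    intro f t h
    have hmono : StrictMono fun s : OpenUnitInterval => f • s := by
      intro s s' hs
      change (f • s).1 < (f • s').1
      rw [hcoe, hcoe]
      exact (((hΓ _).1 f.2).1.strictMono_of_injective f.1.injective) hs
    refine (strictMono_nat_of_lt_succ fun k => ?_).injective
    induction k with
    | zero => simpa using h
    | succ k ih =>
      simp only [pow_succ' f, mul_smul] at ih ⊢
      exact hmono ih
  have hinf : Infinite OpenUnitInterval := by
    have hh : (1 / 2 : ℝ) ∈ unitInterval := by constructor <;> norm_num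
    let t : OpenUnitInterval := ⟨⟨1 / 2, hh⟩, fun h => by simpa using congrArg Subtype.val h,
      fun h => by simpa using congrArg Subtype.val h⟩
    exact Infinite.of_injective _ (hinj x₀ t (hx₀ t))
  have hG : MovesFreely Γ OpenUnitInterval := by
    intro P B y hP hB hy
    have hval : Function.Injective fun t : OpenUnitInterval => (t.1 : ℝ) :=
      Subtype.val_injective.comp Subtype.val_injective
    obtain ⟨a, b, ha, hay, hyb, hb, hda, hdb, hab⟩ := exists_dyadic_interval
      (hP.image fun t : OpenUnitInterval => (t.1 : ℝ)) (y := (y.1 : ℝ))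
      (by rwa [hval.mem_set_image]) (pos_of_ne y.2.1) (lt_one_of_ne y.2.2)
    let φ : Γ := ⟨bump a b ha hb,
      (hΓ _).2 (isThompsonF_bump ha (hay.trans hyb).le hb hda hdb)⟩
    have hfix : ∀ q ∈ P, φ • q = q := fun q hq => Subtype.ext <| by
      rw [hcoe]
      exact Subtype.ext ((hab _ ⟨q, hq, rfl⟩).elim bumpFun_of_le bumpFun_of_ge)
    have hφ : y < φ • y := by
      change y.1 < (φ • y).1
      rw [hcoe]
      exact lt_bumpFun hay hyb
    obtain ⟨k, hk⟩ : ∃ k : ℕ, φ ^ k • y ∉ B := by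
      by_contra! hc
      exact Set.infinite_range_of_injective (hinj φ y hφ)
        (hB.subset (Set.range_subset_iff.2 hc))
    refine ⟨φ ^ k, fun q hq => ?_, hk⟩
    exact MulAction.mem_stabilizer_iff.1
      (pow_mem (MulAction.mem_stabilizer_iff.2 (hfix q hq)) k)
  refine hasInfiniteGirth_of_movesFreely hG (g := ![x₀, x₀ * x₁]) ?_ ?_
  · have h0 : x₀ ∈ Subgroup.closure (Set.range ![x₀, x₀ * x₁]) :=
      Subgroup.subset_closure ⟨0, rfl⟩
    have h1 : x₁ ∈ Subgroup.closure (Set.range ![x₀, x₀ * x₁]) :=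
      (Subgroup.mul_mem_cancel_left _ h0).1 (Subgroup.subset_closure ⟨1, rfl⟩)
    have hle : genGroup ≤ (Subgroup.closure (Set.range ![x₀, x₀ * x₁])).map Γ.subtype := by
      rw [genGroup, Subgroup.closure_le]
      rintro _ (rfl | rfl)
      · exact ⟨x₀, h0, rfl⟩
      · exact ⟨x₁, h1, rfl⟩
    refine (Subgroup.eq_top_iff' _).2 fun f => ?_
    obtain ⟨f', hf', heq⟩ := hle ((hΓ _).1 f.2).mem_genGroup
    rwa [← Subtype.ext heq]
  · intro i t h
    fin_cases i
    · exact (hx₀ t).ne' (congrArg Subtype.val h)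
    · have h1 : t.1 ≤ (x₁ • t).1 := by
        rw [hcoe]
        exact le_max_left (t.1 : ℝ) _
      have h2 := h1.trans_lt (hx₀ (x₁ • t))
      rw [← mul_smul] at h2
      exact h2.ne' (congrArg Subtype.val h)

end Action

/-- Thompson's group `F` has infinite girth. -/
theorem girth_thompsonF_infinite (Γ : Subgroup (unitInterval ≃ₜ unitInterval))
    (hΓ : ∀ f : unitInterval ≃ₜ unitInterval, f ∈ Γ ↔ IsThompsonF f) :
    HasInfiniteGirth Γ := by
  exact @hasInfiniteGirth_of_coe_smul Γ hΓ
    (openIntervalAction Γ fun f hf => ((hΓ f).1 hf).1) fun _ _ => rfl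
end

section
/- Let Γ be a finitely generated subgroup of Homeo_+(I) such that for every N ∈ ℕ, every sequence 0 < x_1 < x_2 < ... < x_N < 1, and every ε > 0, there exists γ ∈ Γ with Fix(γ) = {0, c_1, ..., c_N, 1} where |c_i − x_i| < ε for all i. Then Γ has infinite girth. -/
section IntervalAction

open Filter Topology Set

variable {G : Type*} [Group G]

theorem smul_strictMono_of_monotone [MulAction G unitInterval]
    (hmono : ∀ g : G, Monotone (fun z : unitInterval => g • z)) (g : G) :
    StrictMono (fun z : unitInterval => g • z) :=
  (hmono g).strictMono_of_injective (MulAction.injective g)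

theorem zpow_smul_eq_self_iff [MulAction G unitInterval]
    (hmono : ∀ g : G, Monotone (fun z : unitInterval => g • z))
    (g : G) {e : ℤ} (he : e ≠ 0) (z : unitInterval) : g ^ e • z = z ↔ g • z = z := by
  have key : ∀ n : ℕ, 0 < n → (g ^ n • z = z ↔ g • z = z) := by
    intro n hn
    have hid := Function.Commute.id_right (f := fun z : unitInterval => g • z)
    have := hid.iterate_pos_eq_iff_map_eq (hmono g) strictMono_id (x := z) hn
    simpa [smul_iterate] using this
  have h1 := key e.natAbs (Int.natAbs_pos.mpr he)
  rcases Int.natAbs_eq e with h | h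
  · rw [h, zpow_natCast]; exact h1
  · rw [h, zpow_neg, zpow_natCast, inv_smul_eq_iff, eq_comm]; exact h1

theorem zpow_smul_eq_self [MulAction G unitInterval] {g : G} {z : unitInterval} (hz : g • z = z) (e : ℤ) :
    g ^ e • z = z :=
  MulAction.mem_stabilizer_iff.mp
    (Subgroup.zpow_mem _ (MulAction.mem_stabilizer_iff.mpr hz) e)

theorem exists_tendsto_pow_smul [MulAction G unitInterval] [ContinuousConstSMul G unitInterval]
    (hmono : ∀ g : G, Monotone (fun z : unitInterval => g • z))
    (g : G) (z : unitInterval) :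
    ∃ c, g • c = c ∧ Tendsto (fun M : ℕ => g ^ M • z) atTop (𝓝 c) := by
  have : Fact ((0 : ℝ) ≤ 1) := ⟨zero_le_one⟩
  have hlim : ∃ c, Tendsto (fun M : ℕ => g ^ M • z) atTop (𝓝 c) := by
    rcases le_total z (g • z) with h | h
    · refine ⟨_, tendsto_atTop_ciSup (monotone_nat_of_le_succ fun M => ?_) ⟨1, ?_⟩⟩
      · rw [pow_succ, mul_smul]; exact hmono _ h
      · rintro _ ⟨M, rfl⟩; exact le_top
    · refine ⟨_, tendsto_atTop_ciInf (antitone_nat_of_succ_le fun M => ?_) ⟨0, ?_⟩⟩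
      · rw [pow_succ, mul_smul]; exact hmono _ h
      · rintro _ ⟨M, rfl⟩; exact bot_le
  obtain ⟨c, hc⟩ := hlim
  refine ⟨c, ?_, hc⟩
  have h1 := (tendsto_add_atTop_iff_nat 1).mpr hc
  have h2 := hc.const_smul g
  simp only [← mul_smul, ← pow_succ'] at h2
  exact tendsto_nhds_unique h2 h1

theorem tendsto_pow_smul_of_tendsto [MulAction G unitInterval] [ContinuousConstSMul G unitInterval]
    (hmono : ∀ g : G, Monotone (fun z : unitInterval => g • z))
    {g : G} {z c : unitInterval} (hz : g • z ≠ z) (hgc : g • c = c)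
    (hc : Tendsto (fun M : ℕ => g ^ M • z) atTop (𝓝 c))
    {u : ℕ → unitInterval} (hu : Tendsto u atTop (𝓝 z)) :
    Tendsto (fun M : ℕ => g ^ M • u M) atTop (𝓝 c) := by
  have hshift : ∀ e : ℤ, Tendsto (fun M : ℕ => g ^ M • g ^ e • z) atTop (𝓝 c) := by
    intro e
    have := hc.const_smul (g ^ e)
    rw [zpow_smul_eq_self hgc] at this
    refine this.congr fun M => ?_
    rw [← mul_smul, ← mul_smul, ← zpow_natCast, ← zpow_add, ← zpow_add, add_comm]
  have hsq : ∀ a b : ℤ, g ^ a • z < z → z < g ^ b • z →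
      Tendsto (fun M : ℕ => g ^ M • u M) atTop (𝓝 c) := by
    intro a b ha hb
    refine tendsto_of_tendsto_of_tendsto_of_le_of_le' (hshift a) (hshift b) ?_ ?_
    · filter_upwards [hu.eventually (lt_mem_nhds ha)] with M hM using hmono _ hM.le
    · filter_upwards [hu.eventually (gt_mem_nhds hb)] with M hM using hmono _ hM.le
  have hinv : g • g⁻¹ • z = z := smul_inv_smul g z
  rcases lt_or_gt_of_ne hz with h | h
  · refine hsq 1 (-1) (by simpa using h) ?_
    have := smul_strictMono_of_monotone hmono g⁻¹ h
    simpa using this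
  · refine hsq (-1) 1 ?_ (by simpa using h)
    have := smul_strictMono_of_monotone hmono g⁻¹ h
    simpa using this

/-- The family `x`, `x ^ C (i, true) * b i * x ^ (-C (i, false))`, generating the same group
as `x` and the `b i`. -/
def spreadGenerators {ι : Type*} (C : ι × Bool → ℤ) (b : ι → G) (x : G) : Option ι → G
  | none => x
  | some i => x ^ C (i, true) * b i * x ^ (-C (i, false))

/-- The exponent `1` or `-1` encoded by a Boolean. -/
def boolSign (σ : Bool) : ℤ := cond σ 1 (-1)

/-- The value of a word in the family `s`. -/
def evalWord {α : Type*} (s : α → G) (L : List (α × Bool)) : G :=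
  (L.map fun l => cond l.2 (s l.1) (s l.1)⁻¹).prod

theorem evalWord_cons {α : Type*} (s : α → G) (l : α × Bool) (L : List (α × Bool)) :
    evalWord s (l :: L) = cond l.2 (s l.1) (s l.1)⁻¹ * evalWord s L := by
  simp [evalWord]

theorem evalWord_cons_none {ι : Type*} (C : ι × Bool → ℤ) (b : ι → G) (x : G) (σ : Bool)
    (L : List (Option ι × Bool)) :
    evalWord (spreadGenerators C b x) ((none, σ) :: L) =
      x ^ boolSign σ * evalWord (spreadGenerators C b x) L := by
  rw [evalWord_cons]
  cases σ <;> simp [spreadGenerators, boolSign]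

theorem evalWord_cons_some {ι : Type*} (C : ι × Bool → ℤ) (b : ι → G) (x : G) (i : ι) (σ : Bool)
    (L : List (Option ι × Bool)) :
    evalWord (spreadGenerators C b x) ((some i, σ) :: L) =
      x ^ C (i, σ) * b i ^ boolSign σ * x ^ (-C (i, !σ)) *
        evalWord (spreadGenerators C b x) L := by
  rw [evalWord_cons]
  cases σ <;> simp [spreadGenerators, boolSign, mul_assoc]

/-- The sign of `k` is the sign of the leading letter of `L`, if that letter is `none`. -/
def SignedHead {ι : Type*} (L : List (Option ι × Bool)) (k : ℤ) : Prop :=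
  |k| ≤ L.length ∧ (0 < k → L.head? = some (none, true)) ∧ (k < 0 → L.head? = some (none, false))

theorem SignedHead.cons_none {ι : Type*} {L : List (Option ι × Bool)} {k : ℤ}
    (hk : SignedHead L k) {σ : Bool} (hL : FreeGroup.IsReduced ((none, σ) :: L)) :
    SignedHead ((none, σ) :: L) (boolSign σ + k) ∧ boolSign σ + k ≠ 0 := by
  obtain ⟨h1, h2, h3⟩ := hk
  have hhead : ∀ τ, L.head? = some (none, τ) → σ = τ := by
    intro τ hτ
    cases L with
    | nil => simp at hτ
    | cons y L =>
      simp only [List.head?_cons, Option.some.injEq] at hτ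
      subst hτ
      exact (List.isChain_cons_cons.mp hL).1 rfl
  unfold SignedHead
  rw [abs_le] at *
  push_cast [List.length_cons]
  cases σ with
  | false =>
    have : ¬ 0 < k := fun h => by simpa using hhead _ (h2 h)
    simp only [boolSign, cond_false, List.head?_cons]
    refine ⟨⟨⟨by lia, by lia⟩, by lia, by simp⟩, by lia⟩
  | true =>
    have : ¬ k < 0 := fun h => by simpa using hhead _ (h3 h)
    simp only [boolSign, cond_true, List.head?_cons]
    refine ⟨⟨⟨by lia, by lia⟩, by simp, by lia⟩, by lia⟩

/-- The value of a reduced word `L`, in the family spread out by `h ^ M`, is either the power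
`h ^ (M * k)` with `k ≠ 0` unless `L` is empty, or maps `p` to `h ^ (M * (C q + k)) • v M`, where
`v` converges to a point which `h` moves, and `k ≠ 0` unless the leading letter of `L` is `q`. -/
def WordDynamics [MulAction G unitInterval] {ι : Type*} (h : G) (b : ι → G)
    (C : ι × Bool → ℤ) (p : unitInterval)
    (Z : ℕ → Set unitInterval) (L : List (Option ι × Bool)) : Prop :=
  ∃ k : ℤ, SignedHead L k ∧
    (((k = 0 → L = []) ∧ ∀ M : ℕ, evalWord (spreadGenerators C b (h ^ M)) L = (h ^ M) ^ k) ∨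
    ∃ (q : ι × Bool) (v : ℕ → unitInterval) (z : unitInterval) (j : ℕ),
      (k = 0 → L.head? = some (some q.1, q.2)) ∧ j ≤ L.length ∧ z ∈ Z j ∧ h • z ≠ z ∧
      Tendsto v atTop (𝓝 z) ∧
      ∀ M : ℕ, evalWord (spreadGenerators C b (h ^ M)) L • p = (h ^ M) ^ (C q + k) • v M)

theorem wordDynamics_of_isReduced [MulAction G unitInterval] [ContinuousConstSMul G unitInterval]
    {ι : Type*} {n : ℕ} {h : G} {b : ι → G} {C : ι × Bool → ℤ}
    {p : unitInterval} {Y Z : ℕ → Set unitInterval}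
    (hmono : ∀ g : G, Monotone (fun z : unitInterval => g • z))
    (hC : ∀ q r, q ≠ r → (n : ℤ) < |C q - C r|)
    (hp : h • p = p) (hpY : p ∈ Y 0) (hY : ∀ j, IsClosed (Y j))
    (hZY : ∀ j < n, ∀ z ∈ Z j, ∀ k : ℤ, h ^ k • z ∈ Y j)
    (hYZ : ∀ j < n, ∀ z ∈ Y j, ∀ i σ, b i ^ boolSign σ • z ∈ Z (j + 1))
    (hb : ∀ j < n, ∀ z ∈ Y j, h • z = z → ∀ i σ,
      h • b i ^ boolSign σ • z ≠ b i ^ boolSign σ • z)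
    (L : List (Option ι × Bool)) (hred : FreeGroup.IsReduced L) (hLn : L.length ≤ n) :
    WordDynamics h b C p Z L := by
  induction L with
  | nil => exact ⟨0, by simp [SignedHead], Or.inl ⟨by simp, by simp [evalWord]⟩⟩
  | cons l L ih =>
    obtain ⟨k, hk, hdyn⟩ := ih (hred.infix (List.suffix_cons l L).isInfix)
      (by simp at hLn; lia)
    have hLn' : L.length < n := by simp at hLn; lia
    have hpM : ∀ (M : ℕ) (e : ℤ), (h ^ M) ^ e • p = p := fun M e =>
      zpow_smul_eq_self (by simpa using zpow_smul_eq_self hp (M : ℤ)) e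
    obtain ⟨_ | i, σ⟩ := l
    · obtain ⟨hk', hne⟩ := hk.cons_none hred
      refine ⟨boolSign σ + k, hk', ?_⟩
      rcases hdyn with ⟨-, hdyn⟩ | ⟨q, v, z, j, -, hj, hz, hhz, hv, hdyn⟩
      · refine Or.inl ⟨fun h0 => absurd h0 hne, fun M => ?_⟩
        rw [evalWord_cons_none, hdyn, zpow_add]
      · refine Or.inr ⟨q, v, z, j, fun h0 => absurd h0 hne, by simp; lia, hz, hhz, hv, fun M => ?_⟩
        rw [evalWord_cons_none, mul_smul, hdyn, ← mul_smul, ← zpow_add]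
        congr 2
        ring
    · refine ⟨0, by simp [SignedHead]; positivity, Or.inr ?_⟩
      rcases hdyn with ⟨-, hdyn⟩ | ⟨q, v, z, j, hq, hj, hz, hhz, hv, hdyn⟩
      · refine ⟨(i, σ), fun _ => b i ^ boolSign σ • p, b i ^ boolSign σ • p, 1, fun _ => rfl,
          by simp, hYZ 0 (by lia) p hpY i σ, hb 0 (by lia) p hpY hp i σ,
          tendsto_const_nhds, fun M => ?_⟩
        rw [evalWord_cons_some, hdyn, mul_smul, hpM, mul_smul, hpM, mul_smul, add_zero]
      · set e : ℤ := -C (i, !σ) + (C q + k) with he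
        have hne : e ≠ 0 := by
          intro h0
          by_cases hqi : q = (i, !σ)
          · subst hqi
            have hk0 : k = 0 := by lia
            have hhd := hq hk0
            cases L with
            | nil => simp at hhd
            | cons y L =>
              simp only [List.head?_cons, Option.some.injEq] at hhd
              subst hhd
              simpa using (List.isChain_cons_cons.mp hred).1 rfl
          · have h1 := hC q (i, !σ) hqi
            have h2 : C q - C (i, !σ) = -k := by lia
            have h3 := hk.1
            rw [h2, abs_neg] at h1
            lia
        have hhe : h ^ e • z ≠ z := fun h0 => hhz ((zpow_smul_eq_self_iff hmono h hne z).mp h0)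
        obtain ⟨c, hec, hc⟩ := exists_tendsto_pow_smul hmono (h ^ e) z
        have hhc := (zpow_smul_eq_self_iff hmono h hne c).mp hec
        have hcY : c ∈ Y j := (hY j).mem_of_tendsto hc <| Eventually.of_forall fun M => by
          rw [← zpow_natCast, ← zpow_mul]
          exact hZY j (by lia) z hz _
        refine ⟨(i, σ), fun M => b i ^ boolSign σ • (h ^ e) ^ M • v M, b i ^ boolSign σ • c, j + 1,
          fun _ => rfl, by simp; lia, hYZ j (by lia) c hcY i σ, hb j (by lia) c hcY hhc i σ,
          (tendsto_pow_smul_of_tendsto hmono hhe hec hc hv).const_smul _, fun M => ?_⟩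
        have hcomm : (h ^ e) ^ M = (h ^ M) ^ e := by
          rw [← zpow_natCast, ← zpow_natCast, ← zpow_mul, ← zpow_mul, mul_comm]
        beta_reduce
        rw [evalWord_cons_some, mul_smul, hdyn, add_zero, hcomm, he]
        simp only [zpow_add, mul_smul]

theorem eventually_evalWord_ne_one [MulAction G unitInterval]
    {ι : Type*} {h : G} {b : ι → G} {C : ι × Bool → ℤ}
    {p : unitInterval} {Z : ℕ → Set unitInterval} {L : List (Option ι × Bool)}
    (hmono : ∀ g : G, Monotone (fun z : unitInterval => g • z))
    (hp : h • p = p) (hh : ∃ z : unitInterval, h • z ≠ z) (hL : L ≠ [])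
    (hdyn : WordDynamics h b C p Z L) :
    ∀ᶠ M : ℕ in atTop, evalWord (spreadGenerators C b (h ^ M)) L ≠ 1 := by
  obtain ⟨k, -, ⟨hk, hev⟩ | ⟨q, v, z, j, -, -, -, hhz, hv, hev⟩⟩ := hdyn
  · obtain ⟨z, hz⟩ := hh
    filter_upwards [eventually_ge_atTop 1] with M hM h1
    rw [hev, ← zpow_natCast, ← zpow_mul] at h1
    have hk0 : k ≠ 0 := fun h0 => hL (hk h0)
    have hM0 : (M : ℤ) ≠ 0 := by lia
    exact hz ((zpow_smul_eq_self_iff hmono h (mul_ne_zero hM0 hk0) z).mp (by rw [h1, one_smul]))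
  · have hzp : z ≠ p := fun h0 => hhz (h0 ▸ hp)
    filter_upwards [hv.eventually_ne hzp] with M hM h1
    have h2 := hev M
    have h3 : (h ^ M) ^ (C q + k) • p = p :=
      zpow_smul_eq_self (by simpa using zpow_smul_eq_self hp (M : ℤ)) _
    rw [h1, one_smul] at h2
    exact hM (smul_left_cancel _ (h2.symm.trans h3.symm))

/-- The points of the unit interval at distance at least `δ` from both endpoints. -/
def trimmedInterval (δ : ℝ) : Set unitInterval := {z | δ ≤ z ∧ (z : ℝ) ≤ 1 - δ}

theorem isClosed_trimmedInterval (δ : ℝ) : IsClosed (trimmedInterval δ) :=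
  (isClosed_le continuous_const continuous_subtype_val).inter
    (isClosed_le continuous_subtype_val continuous_const)

theorem smul_zero_of_monotone [MulAction G unitInterval]
    (hmono : ∀ g : G, Monotone (fun z : unitInterval => g • z)) (g : G) :
    g • (0 : unitInterval) = 0 := by
  have := hmono g (bot_le : (0 : unitInterval) ≤ g⁻¹ • 0)
  simp only [smul_inv_smul] at this
  exact le_antisymm this bot_le

theorem smul_one_of_monotone [MulAction G unitInterval]
    (hmono : ∀ g : G, Monotone (fun z : unitInterval => g • z)) (g : G) :
    g • (1 : unitInterval) = 1 := by
  have := hmono g (le_top : g⁻¹ • (1 : unitInterval) ≤ 1)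
  simp only [smul_inv_smul] at this
  exact le_antisymm le_top this

theorem exists_smul_mem_trimmedInterval [MulAction G unitInterval]
    (hmono : ∀ g : G, Monotone (fun z : unitInterval => g • z)) {κ : Type*} [Finite κ]
    (g : κ → G) {δ : ℝ} (h0 : 0 < δ) (h1 : δ < 1 / 2) :
    ∃ δ', 0 < δ' ∧ δ' < δ ∧
      ∀ i, ∀ z ∈ trimmedInterval δ, g i • z ∈ trimmedInterval δ' := by
  let u : unitInterval := ⟨δ, by constructor <;> linarith⟩
  let w : unitInterval := ⟨1 - δ, by constructor <;> linarith⟩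
  have hu : ∀ i, (0 : ℝ) < (g i • u : unitInterval) := fun i => by
    have : (0 : unitInterval) < u := Subtype.coe_lt_coe.mp h0
    have := smul_strictMono_of_monotone hmono (g i) this
    simp only [smul_zero_of_monotone hmono] at this
    exact Subtype.coe_lt_coe.mpr this
  have hw : ∀ i, ((g i • w : unitInterval) : ℝ) < 1 := fun i => by
    have : w < (1 : unitInterval) := Subtype.coe_lt_coe.mp (by simp [w, h0])
    have := smul_strictMono_of_monotone hmono (g i) this
    simp only [smul_one_of_monotone hmono] at this
    exact Subtype.coe_lt_coe.mpr this
  have hev : ∀ᶠ δ' in 𝓝[>] (0 : ℝ), ∀ i, δ' < ((g i • u : unitInterval) : ℝ) ∧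
      δ' < 1 - ((g i • w : unitInterval) : ℝ) := by
    rw [eventually_all]
    exact fun i => nhdsWithin_le_nhds ((gt_mem_nhds (hu i)).and
      (gt_mem_nhds (sub_pos.mpr (hw i))))
  obtain ⟨δ', ⟨hδ', hlt⟩, hpos⟩ :=
    ((hev.and (nhdsWithin_le_nhds (gt_mem_nhds h0))).and self_mem_nhdsWithin).exists
  refine ⟨δ', hpos, hlt, fun i z hz => ?_⟩
  have h2 : ((g i • u : unitInterval) : ℝ) ≤ (g i • z : unitInterval) :=
    hmono (g i) (Subtype.coe_le_coe.mp hz.1 : u ≤ z)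
  have h3 : ((g i • z : unitInterval) : ℝ) ≤ (g i • w : unitInterval) :=
    hmono (g i) (Subtype.coe_le_coe.mp hz.2 : z ≤ w)
  have := hδ' i
  constructor <;> linarith

theorem exists_seq_smul_mem_trimmedInterval [MulAction G unitInterval]
    (hmono : ∀ g : G, Monotone (fun z : unitInterval => g • z)) {κ : Type*} [Finite κ]
    (g : κ → G) :
    ∃ δ : ℕ → ℝ, (∀ j, 0 < δ j) ∧ (∀ j, δ j < 1 / 2) ∧ (∀ j, δ (j + 1) < δ j) ∧
      ∀ j i, ∀ z ∈ trimmedInterval (δ j), g i • z ∈ trimmedInterval (δ (j + 1)) := by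
  have hstep : ∀ δ : {δ : ℝ // 0 < δ ∧ δ < 1 / 2}, ∃ δ' : {δ : ℝ // 0 < δ ∧ δ < 1 / 2},
      (δ' : ℝ) < δ ∧ ∀ i, ∀ z ∈ trimmedInterval δ, g i • z ∈ trimmedInterval δ' := by
    rintro ⟨δ, h0, h1⟩
    obtain ⟨δ', h2, h3, h4⟩ := exists_smul_mem_trimmedInterval hmono g h0 h1
    exact ⟨⟨δ', h2, h3.trans h1⟩, h3, h4⟩
  choose f hf using hstep
  let δ : ℕ → {δ : ℝ // 0 < δ ∧ δ < 1 / 2} := fun j => f^[j] ⟨1 / 4, by norm_num⟩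
  have hδ : ∀ j, δ (j + 1) = f (δ j) := fun j => Function.iterate_succ_apply' f j _
  refine ⟨fun j => δ j, fun j => (δ j).2.1, fun j => (δ j).2.2, fun j => ?_, fun j => ?_⟩
  · simp only [hδ]; exact (hf _).1
  · simp only [hδ]; exact (hf _).2

theorem zpow_smul_mem_trimmedInterval [MulAction G unitInterval]
    (hmono : ∀ g : G, Monotone (fun z : unitInterval => g • z)) {a : G} {δ δ' : ℝ}
    {c d : unitInterval} (hc : a • c = c) (hd : a • d = d) (hcδ : (c : ℝ) ∈ Ioo δ' δ)
    (hdδ : (d : ℝ) ∈ Ioo (1 - δ) (1 - δ')) (k : ℤ) {z : unitInterval}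
    (hz : z ∈ trimmedInterval δ) : a ^ k • z ∈ trimmedInterval δ' := by
  have h2 := hmono (a ^ k) (Subtype.coe_le_coe.mp (hcδ.2.le.trans hz.1) : c ≤ z)
  have h3 := hmono (a ^ k) (Subtype.coe_le_coe.mp (hz.2.trans hdδ.1.le) : z ≤ d)
  simp only [zpow_smul_eq_self hc, zpow_smul_eq_self hd] at h2 h3
  exact ⟨hcδ.1.le.trans h2, le_trans (b := (d : ℝ)) h3 hdδ.2.le⟩

/-- Any finite family of nonempty open subsets of `(0, 1)` is met by the finite fixed-point set of
some element, and covers the interior part of that set. -/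
def HasRichFixedSets (G : Type*) [Group G] [MulAction G unitInterval] : Prop :=
  ∀ (R : Type) [Finite R] (U : R → Set ℝ), (∀ r, IsOpen (U r)) → (∀ r, U r ⊆ Ioo 0 1) →
    (∀ r, (U r).Nonempty) → ∃ γ : G, (∀ r, ∃ c : unitInterval, (c : ℝ) ∈ U r ∧ γ • c = c) ∧
      {c : unitInterval | γ • c = c}.Finite ∧
      ∀ c : unitInterval, γ • c = c → (c : ℝ) ∈ Ioo 0 1 → ∃ r, (c : ℝ) ∈ U r

theorem exists_pow_smul_smul_ne [MulAction G unitInterval]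
    (hmono : ∀ g : G, Monotone (fun z : unitInterval => g • z))
    {ι : Type*} [Finite ι] (g : ι → G) (a : G) {F : Set unitInterval} (hF : F.Finite) :
    ∃ K : ℕ, ∀ i, ∀ c ∈ F, ∀ d ∈ F, a • d ≠ d → a ^ K • g i • c ≠ d := by
  have hsub : ∀ (i : ι) (c d : unitInterval), a • d ≠ d → {K : ℕ | a ^ K • g i • c = d}.Subsingleton := by
    intro i c d hd K hK K' hK'
    by_contra hne
    have h1 : a ^ ((K : ℤ) - K') • d = d := by
      conv_lhs => rw [← (hK' : a ^ K' • g i • c = d)]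
      rw [← mul_smul, ← zpow_natCast, ← zpow_add, sub_add_cancel, zpow_natCast]
      exact hK
    exact hd ((zpow_smul_eq_self_iff hmono a (by lia) d).mp h1)
  have hfin : (⋃ i, ⋃ c ∈ F, ⋃ d ∈ F ∩ {d : unitInterval | a • d ≠ d},
      {K : ℕ | a ^ K • g i • c = d}).Finite :=
    finite_iUnion fun i => hF.biUnion fun c _ =>
      (hF.subset inter_subset_left).biUnion fun d hd => (hsub i c d hd.2).finite
  obtain ⟨K, hK⟩ := hfin.exists_notMem
  refine ⟨K, fun i c hc d hd had h => hK ?_⟩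
  simp only [mem_iUnion]
  exact ⟨i, c, hc, d, ⟨hd, had⟩, h⟩

theorem closure_range_spreadGenerators {ι : Type*} {g : ι → G} (hone : ∃ i, g i = 1)
    (hg : Subgroup.closure (range g) = ⊤) (C : ι × Bool → ℤ) (a x : G) :
    Subgroup.closure (range (spreadGenerators C (fun i => a * g i) x)) = ⊤ := by
  set H := Subgroup.closure (range (spreadGenerators C (fun i => a * g i) x))
  have hx : x ∈ H := Subgroup.subset_closure ⟨none, rfl⟩
  have hb : ∀ i, a * g i ∈ H := by
    intro i
    have h1 : x ^ C (i, true) * (a * g i) * x ^ (-C (i, false)) ∈ H :=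
      Subgroup.subset_closure ⟨some i, rfl⟩
    rwa [Subgroup.mul_mem_cancel_right _ (H.zpow_mem hx _),
      Subgroup.mul_mem_cancel_left _ (H.zpow_mem hx _)] at h1
  obtain ⟨i₀, hi₀⟩ := hone
  have ha : a ∈ H := by simpa [hi₀] using hb i₀
  rw [eq_top_iff, ← hg, Subgroup.closure_le]
  rintro _ ⟨i, rfl⟩
  exact (Subgroup.mul_mem_cancel_left _ ha).mp (hb i)

theorem exists_spread_integers (κ : Type*) [Finite κ] (n : ℕ) :
    ∃ C : κ → ℤ, ∀ q r, q ≠ r → (n : ℤ) < |C q - C r| := by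
  obtain ⟨N, ⟨e⟩⟩ := Finite.exists_equiv_fin κ
  refine ⟨fun q => (n + 1) * (e q : ℕ), fun q r hqr => ?_⟩
  have h1 : ((e q : ℕ) : ℤ) - (e r : ℕ) ≠ 0 := by
    have : (e q : ℕ) ≠ e r := fun h => hqr (e.injective (Fin.ext h))
    lia
  have h2 := Int.one_le_abs h1
  rw [← mul_sub, abs_mul, abs_of_nonneg (by positivity : (0 : ℤ) ≤ n + 1)]
  nlinarith

theorem exists_generators_evalWord_ne_one [MulAction G unitInterval] [ContinuousConstSMul G unitInterval]
    (hmono : ∀ g : G, Monotone (fun z : unitInterval => g • z))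
    (hrich : HasRichFixedSets G) {m : ℕ} {g : Fin m → G} (hone : ∃ i, g i = 1)
    (hg : Subgroup.closure (range g) = ⊤) (n : ℕ) :
    ∃ s : Option (Fin m) → G, Subgroup.closure (range s) = ⊤ ∧
      ∀ L : List (Option (Fin m) × Bool), FreeGroup.IsReduced L → L ≠ [] → L.length ≤ n →
        evalWord s L ≠ 1 := by
  obtain ⟨δ, hδ0, hδ1, hδlt, hδg⟩ := exists_seq_smul_mem_trimmedInterval hmono
    (fun q : Fin m × Bool => g q.1 ^ boolSign q.2)
  let U : Fin (3 * n + 3) × Bool → Set ℝ := fun r =>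
    cond r.2 (Ioo (1 - δ r.1) (1 - δ (r.1 + 1))) (Ioo (δ (r.1 + 1)) (δ r.1))
  have hUo : ∀ r, IsOpen (U r) := by
    rintro ⟨j, _ | _⟩ <;> exact isOpen_Ioo
  have hUs : ∀ r, U r ⊆ Ioo 0 1 := by
    rintro ⟨j, _ | _⟩ t ⟨ht1, ht2⟩ <;>
      constructor <;> linarith [hδ0 j, hδ0 (j + 1), hδ1 j, hδ1 (j + 1)]
  have hUi : ∀ r, (U r).Infinite := by
    rintro ⟨j, _ | _⟩
    · exact Ioo_infinite (hδlt j)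
    · exact Ioo_infinite (by linarith [hδlt j])
  obtain ⟨h, hhU, hhF, -⟩ := hrich _ U hUo hUs fun r => (hUi r).nonempty
  set F : Set unitInterval := {c | h • c = c} with hFdef
  have hF' : (image Subtype.val F).Finite := hhF.image _
  obtain ⟨a, haU, -, haF⟩ := hrich _ (fun r => U r \ (image Subtype.val F))
    (fun r => (hUo r).sdiff hF'.isClosed) (fun r => sdiff_subset.trans (hUs r))
    (fun r => ((hUi r).sdiff hF').nonempty)
  have hstay : ∀ γ : G, (∀ r, ∃ c : unitInterval, (c : ℝ) ∈ U r ∧ γ • c = c) →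
      ∀ j < 3 * n + 3, ∀ z ∈ trimmedInterval (δ j), ∀ k : ℤ,
        γ ^ k • z ∈ trimmedInterval (δ (j + 1)) := by
    intro γ hγ j hj z hz k
    obtain ⟨c, hc, hγc⟩ := hγ (⟨j, hj⟩, false)
    obtain ⟨d, hd, hγd⟩ := hγ (⟨j, hj⟩, true)
    exact zpow_smul_mem_trimmedInterval hmono hγc hγd hc hd k hz
  have hstayh := hstay h hhU
  have hstaya := hstay a fun r => (haU r).imp fun c hc => ⟨hc.1.1, hc.2⟩
  obtain ⟨K, hK⟩ := exists_pow_smul_smul_ne hmono g a hhF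
  obtain ⟨C, hC⟩ := exists_spread_integers (Fin m × Bool) n
  obtain ⟨p, hpU, hp⟩ := hhU (⟨0, by lia⟩, false)
  have hinterior : ∀ {j : ℕ} {z : unitInterval}, z ∈ trimmedInterval (δ j) → z ∈ F →
      a • z ≠ z := by
    intro j z hz hzF haz
    obtain ⟨r, hr⟩ := haF z haz ⟨by linarith [hδ0 j, hz.1], by linarith [hδ0 j, hz.2]⟩
    exact hr.2 ⟨z, hzF, rfl⟩
  have hmoved : ∃ z : unitInterval, h • z ≠ z := by
    have : Infinite unitInterval := (Icc_infinite (zero_lt_one' ℝ)).to_subtype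
    obtain ⟨z, hz⟩ := hhF.exists_notMem
    exact ⟨z, hz⟩
  let b : Fin m → G := fun i => a ^ K * g i
  have hYZ : ∀ j < n, ∀ z ∈ trimmedInterval (δ (3 * j + 1)), ∀ i σ,
      b i ^ boolSign σ • z ∈ trimmedInterval (δ (3 * (j + 1))) := by
    intro j hj z hz i σ
    rw [show 3 * (j + 1) = 3 * j + 1 + 1 + 1 by ring]
    cases σ
    · have h1 := hstaya (3 * j + 1) (by lia) z hz (-K)
      simpa [b, boolSign, mul_smul] using hδg _ (i, false) _ h1
    · have h1 := hstaya (3 * j + 1 + 1) (by lia) _ (hδg _ (i, true) _ hz) K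
      simpa [b, boolSign, mul_smul] using h1
  have hdyn := wordDynamics_of_isReduced (b := b) (p := p)
    (Y := fun j => trimmedInterval (δ (3 * j + 1))) (Z := fun j => trimmedInterval (δ (3 * j)))
    hmono hC hp
    ⟨hpU.1.le, by linarith [show (p : ℝ) < δ 0 from hpU.2, hδ1 0, hδ1 1]⟩
    (fun j => isClosed_trimmedInterval _)
    (fun j hj z hz k => hstayh _ (by lia) z hz k) hYZ (by
      intro j hj z hz hhz i σ hfix
      have h1 := hYZ j hj z hz i σ
      cases σ
      · refine hK i _ hfix z hhz (hinterior hz hhz) ?_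
        simp [b, boolSign, mul_smul]
      · refine hK i z hhz _ hfix (hinterior h1 hfix) ?_
        simp [b, boolSign, mul_smul])
  have hfin : {L : List (Option (Fin m) × Bool) | L.length ≤ n}.Finite :=
    List.finite_length_le _ n
  have hev : ∀ᶠ M : ℕ in atTop, ∀ L ∈ {L : List (Option (Fin m) × Bool) | L.length ≤ n},
      FreeGroup.IsReduced L → L ≠ [] → evalWord (spreadGenerators C b (h ^ M)) L ≠ 1 := by
    rw [hfin.eventually_all]
    intro L hLn
    by_cases hL : FreeGroup.IsReduced L ∧ L ≠ []
    · filter_upwards [eventually_evalWord_ne_one hmono hp hmoved hL.2 (hdyn L hL.1 hLn)]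
        with M hM _ _ using hM
    · exact Eventually.of_forall fun M h1 h2 => absurd ⟨h1, h2⟩ hL
  obtain ⟨M, hM⟩ := hev.exists
  exact ⟨spreadGenerators C b (h ^ M), closure_range_spreadGenerators hone hg C _ _,
    fun L h1 h2 h3 => hM L h3 h1 h2⟩

end IntervalAction

section RichFixedSets

open Filter Topology Set

theorem hasInfiniteGirth_of_evalWord_ne_one {G : Type*} [Group G]
    (hG : ∀ n : ℕ, ∃ (m : ℕ) (s : Option (Fin m) → G), Subgroup.closure (range s) = ⊤ ∧
      ∀ L : List (Option (Fin m) × Bool), FreeGroup.IsReduced L → L ≠ [] → L.length ≤ n →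
        evalWord s L ≠ 1) : HasInfiniteGirth G := by
  intro n
  obtain ⟨m, s, hs, hL⟩ := hG n
  let e := finSuccEquiv m
  refine ⟨m + 1, s ∘ e, by rw [e.surjective.range_comp, hs], fun w hw hwn h1 => ?_⟩
  refine hL (w.toWord.map fun l => (e l.1, l.2)) ?_ ?_ (by simpa [FreeGroup.norm] using hwn) ?_
  · rw [FreeGroup.IsReduced, List.isChain_map]
    simpa [FreeGroup.IsReduced] using FreeGroup.isReduced_toWord (x := w)
  · simpa using hw
  · rw [← FreeGroup.mk_toWord (x := w), FreeGroup.lift_mk] at h1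
    simpa [evalWord, Function.comp_def] using h1

/-- The defining action of a group of self-homeomorphisms. -/
abbrev Subgroup.homeoAction {X : Type*} [TopologicalSpace X] (Γ : Subgroup (X ≃ₜ X)) :
    MulAction Γ X where
  smul γ z := (γ : X ≃ₜ X) z
  one_smul _ := rfl
  mul_smul _ _ _ := rfl

theorem hasRichFixedSets_of_finite_approximation (Γ : Subgroup (unitInterval ≃ₜ unitInterval))
    (hrich : ∀ (N : ℕ) (x : Fin N → ℝ), StrictMono x →
      (∀ i, x i ∈ Set.Ioo (0 : ℝ) 1) → ∀ ε > (0 : ℝ),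
      ∃ γ ∈ Γ, ∃ c : Fin N → ℝ,
        (∀ i, |c i - x i| < ε) ∧
        {t : unitInterval | γ t = t} =
          {t : unitInterval | (t : ℝ) = 0 ∨ (t : ℝ) = 1 ∨ ∃ i, (t : ℝ) = c i}) :
    letI := Γ.homeoAction
    HasRichFixedSets Γ := by
  intro R _ U hUo hUs hUn
  choose y hy using hUn
  have hev : ∀ᶠ ε in 𝓝[>] (0 : ℝ), ∀ r, Metric.ball (y r) ε ⊆ U r := by
    rw [eventually_all]
    intro r
    obtain ⟨ε, hε, hεU⟩ := Metric.isOpen_iff.mp (hUo r) (y r) (hy r)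
    filter_upwards [nhdsWithin_le_nhds (gt_mem_nhds hε)] with ε' hε'
    exact (Metric.ball_subset_ball hε'.le).trans hεU
  obtain ⟨ε, hεU, hε⟩ := (hev.and self_mem_nhdsWithin).exists
  let T : Finset ℝ := (finite_range y).toFinset
  have hT : ∀ t, t ∈ T ↔ ∃ r, y r = t := by simp [T]
  let x := T.orderEmbOfFin rfl
  have hx : ∀ i, ∃ r, y r = x i := fun i => (hT _).mp (T.orderEmbOfFin_mem rfl i)
  obtain ⟨γ, hγ, c, hc, hfix⟩ := hrich T.card x x.strictMono
    (fun i => by obtain ⟨r, hr⟩ := hx i; exact hr ▸ hUs r (hy r)) ε hε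
  have hfix' : ∀ t : unitInterval, γ t = t ↔ (t : ℝ) = 0 ∨ (t : ℝ) = 1 ∨ ∃ i, (t : ℝ) = c i :=
    fun t => Set.ext_iff.mp hfix t
  have hcU : ∀ i r, y r = x i → c i ∈ U r := fun i r hr =>
    hεU r (by rw [Metric.mem_ball, hr, Real.dist_eq]; exact hc i)
  refine ⟨⟨γ, hγ⟩, fun r => ?_, ?_, fun t ht ht01 => ?_⟩
  · obtain ⟨i, hi⟩ : y r ∈ range x := by
      rw [Finset.range_orderEmbOfFin]
      exact (hT _).mpr ⟨r, rfl⟩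
    have hcr := hcU i r hi.symm
    exact ⟨⟨c i, Ioo_subset_Icc_self (hUs r hcr)⟩, hcr, (hfix' _).mpr (Or.inr (Or.inr ⟨i, rfl⟩))⟩
  · refine Finite.subset (Finite.preimage Subtype.val_injective.injOn
      (((finite_range c).insert 1).insert 0)) fun t ht => ?_
    rcases (hfix' t).mp ht with h | h | ⟨i, h⟩
    · exact Or.inl h
    · exact Or.inr (Or.inl h)
    · exact Or.inr (Or.inr ⟨i, h.symm⟩)
  · rcases (hfix' t).mp ht with h | h | ⟨i, h⟩
    · exact absurd h ht01.1.ne'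
    · exact absurd h ht01.2.ne
    · obtain ⟨r, hr⟩ := hx i
      exact ⟨r, h ▸ hcU i r hr⟩

end RichFixedSets

/-- A finitely generated subgroup of `Homeo₊(I)` which, for every `N`, every
`0 < x₁ < … < x_N < 1` and every `ε > 0`, contains an element whose fixed-point set
is exactly `{0, c₁, …, c_N, 1}` with `|cᵢ - xᵢ| < ε`, has infinite girth. -/
theorem girth_infinite_of_rich_fixed_sets
    (Γ : Subgroup (unitInterval ≃ₜ unitInterval))
    (hmono : ∀ g ∈ Γ, Monotone (⇑g : unitInterval → unitInterval))
    (hfg : Group.FG Γ)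
    (hrich : ∀ (N : ℕ) (x : Fin N → ℝ), StrictMono x →
      (∀ i, x i ∈ Set.Ioo (0 : ℝ) 1) → ∀ ε > (0 : ℝ),
      ∃ γ ∈ Γ, ∃ c : Fin N → ℝ,
        (∀ i, |c i - x i| < ε) ∧
        {t : unitInterval | γ t = t} =
          {t : unitInterval | (t : ℝ) = 0 ∨ (t : ℝ) = 1 ∨ ∃ i, (t : ℝ) = c i}) :
    HasInfiniteGirth Γ := by
  let : MulAction Γ unitInterval := Γ.homeoAction
  have : ContinuousConstSMul Γ unitInterval :=
    ⟨fun γ => (γ : unitInterval ≃ₜ unitInterval).continuous⟩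
  obtain ⟨S, hS, hSfin⟩ := Group.fg_iff.mp hfg
  obtain ⟨m, ⟨e⟩⟩ := (Set.finite_coe_iff.mpr (hSfin.insert 1)).exists_equiv_fin
  let g : Fin m → Γ := Subtype.val ∘ e.symm
  have hrange : Set.range g = insert 1 S := by
    rw [e.symm.surjective.range_comp, Subtype.range_coe]
  have hone : ∃ i, g i = 1 := by
    rw [← Set.mem_range, hrange]
    exact Set.mem_insert 1 S
  refine hasInfiniteGirth_of_evalWord_ne_one fun n => ⟨m, ?_⟩
  refine exists_generators_evalWord_ne_one (G := Γ) (g := g) (fun γ => hmono γ γ.2)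
    (hasRichFixedSets_of_finite_approximation Γ hrich) hone ?_ n
  rw [hrange, eq_top_iff, ← hS]
  exact Subgroup.closure_mono (Set.subset_insert 1 S)
end
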